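/- Any two finite groups G and H, each of order 2^5 · 3^2 · 7 · 37^2 · 73^3 · 751 and each having prime graph degrees deg(2) = 3, deg(3) = 2, deg(7) = 1, deg(37) = 3, deg(73) = 2, deg(751) = 1, are isomorphic. -/

import Mathlib

/-- The degree of the prime `p` in the prime graph (Gruenberg–Kegel graph) `GK(G)` of the
group `G`: the number of primes `q ≠ p` such that `G` contains an element of order `p * q`
(two distinct primes being adjacent in `GK(G)` iff `G` has an element of order their
product). -/
noncomputable def gkDegree (G : Type*) [Group G] (p : ℕ) : ℕ :=
  Nat.card {q : ℕ // p ≠ q ∧ p.Prime ∧ q.Prime ∧ ∃ g : G, orderOf g = p * q}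

instance fact_prime_37 : Fact (Nat.Prime 37) := ⟨by norm_num⟩
instance fact_prime_73 : Fact (Nat.Prime 73) := ⟨by norm_num⟩
instance fact_prime_751 : Fact (Nat.Prime 751) := ⟨by norm_num⟩
instance fact_prime_7 : Fact (Nat.Prime 7) := ⟨by norm_num⟩

namespace OD

open Subgroup MulAction
open scoped Pointwise

section Tools

/-- Counting orbits: if `m` divides the size of all orbits inside an invariant set, it divides
the size of that set. -/
theorem dvd_ncard_of_orbits {G : Type*} [Group G] {α : Type*} [Finite α] [MulAction G α] (m : ℕ)
    (s : Set α)
    (hs : ∀ g : G, ∀ a ∈ s, g • a ∈ s) (h : ∀ a ∈ s, m ∣ (orbit G a).ncard) : m ∣ s.ncard := by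
  induction hn : s.ncard using Nat.strong_induction_on generalizing s with
  | _ n ih =>
    rcases s.eq_empty_or_nonempty with rfl | ⟨a, ha⟩
    · simp at hn; simp [← hn]
    · have hsub : orbit G a ⊆ s := by
        rintro _ ⟨g, rfl⟩; exact hs g a ha
      have h1 : (s \ orbit G a).ncard + (orbit G a).ncard = s.ncard :=
        Set.ncard_sdiff_add_ncard_of_subset hsub
      have h2 : 0 < (orbit G a).ncard :=
        (Set.ncard_pos (Set.toFinite _)).2 ⟨a, mem_orbit_self a⟩
      have h3 := ih (s \ orbit G a).ncard (by omega) (s \ orbit G a)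
        (fun g b hb => ⟨hs g b hb.1, fun hc => hb.2 (by
          rw [← orbit_eq_iff, orbit_smul] at hc
          rw [← hc]; exact mem_orbit_self _)⟩)
        (fun b hb => h b hb.1) rfl
      rw [← hn, ← h1]
      exact dvd_add h3 (h a ha)

variable {G : Type*} [Group G]

theorem mem_centralizer_coe_iff {A : Subgroup G} {g : G} :
    g ∈ centralizer (A : Set G) ↔ ∀ a ∈ A, a * g = g * a := by
  simp [mem_centralizer_iff]

/-- Fixed points of an `r`-group acting by conjugation on a subgroup. -/
theorem card_inf_centralizer_modEq [Finite G] {r : ℕ} [Fact r.Prime] {A D : Subgroup G}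
    (hA : IsPGroup r A) (h : A ≤ normalizer (D : Set G)) :
    Nat.card (D ⊓ centralizer (A : Set G) : Subgroup G) ≡ Nat.card D [MOD r] := by
  let _ : MulAction A D :=
    { smul := fun a d => ⟨a * d * (a : G)⁻¹, (mem_normalizer_iff.1 (h a.2) _).1 d.2⟩
      one_smul := fun d => Subtype.ext (by change (1 : G) * d * (1 : G)⁻¹ = d; simp)
      mul_smul := fun a b d => Subtype.ext (by
        change ((a * b : A) : G) * d * ((a * b : A) : G)⁻¹ = a * (b * d * (b : G)⁻¹) * (a : G)⁻¹
        push_cast; group) }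
  have hsm : ∀ (a : A) (d : D), ((a • d : D) : G) = a * d * (a : G)⁻¹ := fun _ _ => rfl
  have h1 := hA.card_modEq_card_fixedPoints D
  refine Nat.ModEq.trans ?_ h1.symm
  have e : (D ⊓ centralizer (A : Set G) : Subgroup G) ≃ fixedPoints A D :=
    { toFun := fun x => ⟨⟨x, x.2.1⟩, fun a => Subtype.ext (by
        rw [hsm]; have := mem_centralizer_coe_iff.1 x.2.2 a a.2
        simp [this])⟩
      invFun := fun x => ⟨x.1, x.1.2, mem_centralizer_coe_iff.2 fun a ha => by
        have := congrArg Subtype.val (x.2 ⟨a, ha⟩)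
        rw [hsm] at this
        exact mul_inv_eq_iff_eq_mul.1 this⟩
      left_inv := fun x => rfl
      right_inv := fun x => rfl }
  rw [Nat.card_congr e]

/-- The order of the group of fixed points divides the order of the group acted upon. -/
theorem card_inf_dvd (D C : Subgroup G) : Nat.card (D ⊓ C : Subgroup G) ∣ Nat.card D :=
  card_dvd_of_le inf_le_left

theorem exists_mem_orderOf [Finite G] {p : ℕ} [Fact p.Prime] {A : Subgroup G}
    (h : p ∣ Nat.card A) : ∃ a ∈ A, orderOf a = p := by
  obtain ⟨a, ha⟩ := exists_prime_orderOf_dvd_card' p h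
  exact ⟨a, a.2, by simpa using ha⟩

theorem exists_orderOf_mul [Finite G] {p q : ℕ} [hp : Fact p.Prime] [hq : Fact q.Prime]
    (hpq : p ≠ q) {A B : Subgroup G} (hA : p ∣ Nat.card A) (hB : q ∣ Nat.card B)
    (h : A ≤ centralizer (B : Set G)) : ∃ g : G, orderOf g = p * q := by
  obtain ⟨a, ha, ha'⟩ := exists_mem_orderOf hA
  obtain ⟨b, hb, hb'⟩ := exists_mem_orderOf hB
  refine ⟨a * b, ?_⟩
  have hc : Commute a b := (mem_centralizer_coe_iff.1 (h ha) b hb).symm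
  rw [hc.orderOf_mul_eq_mul_orderOf_of_coprime, ha', hb']
  rw [ha', hb']
  exact (Nat.coprime_primes hp.out hq.out).2 hpq

/-- If the intersections of a Sylow subgroup `Q` with the other ones have index divisible by `m`
in `Q`, then the number of Sylow subgroups is `1` modulo `m`. -/
theorem card_sylow_modEq_of_relIndex [Finite G] {p : ℕ} [Fact p.Prime] (Q : Sylow p G) (m : ℕ)
    (h : ∀ Q' : Sylow p G, Q' ≠ Q → m ∣ (Q' : Subgroup G).relIndex Q) :
    Nat.card (Sylow p G) ≡ 1 [MOD m] := by
  have h1 : m ∣ ({Q}ᶜ : Set (Sylow p G)).ncard := by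
    refine dvd_ncard_of_orbits (G := (Q : Subgroup G)) m _ ?_ ?_
    · intro g a ha hga
      apply ha
      have : g • a = Q := hga
      have hg : (g : G) • a = (g : G) • Q := by
        rw [Sylow.smul_eq_iff_mem_normalizer.2 (le_normalizer g.2)]; exact this
      exact smul_left_cancel _ hg
    · intro a ha
      have := h a ha
      rw [← index_stabilizer]
      convert this using 1
      rw [relIndex]
      congr 1
      ext x
      have h2 : (x : G) ∈ (Q : Subgroup G) ⊓ normalizer ((a : Subgroup G) : Set G) ↔
        (x : G) ∈ (Q : Subgroup G) ⊓ a := by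
        have e : (Q : Subgroup G) ⊓ normalizer ((a : Subgroup G) : Set G) = (Q : Subgroup G) ⊓ (a : Subgroup G) :=
          IsPGroup.inf_normalizer_sylow Q.2 a
        rw [e]
      rw [mem_stabilizer_iff, mem_subgroupOf]
      have h3 : x • a = (x : G) • a := rfl
      rw [h3, Sylow.smul_eq_iff_mem_normalizer]
      simpa using h2
  have h2 := Set.ncard_add_ncard_compl ({Q} : Set (Sylow p G))
  rw [Set.ncard_singleton] at h2
  rw [← h2]
  exact ((Nat.modEq_zero_iff_dvd.2 h1).add_left 1)

theorem relIndex_eq_of_isPGroup [Finite G] {p : ℕ} [Fact p.Prime] {A B : Subgroup G}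
    (hB : IsPGroup p B) : ∃ n, A.relIndex B = p ^ n := by
  obtain ⟨n, hn⟩ := IsPGroup.iff_card.1 hB
  have : A.relIndex B ∣ p ^ n := by
    rw [← hn]; exact index_dvd_card _
  obtain ⟨k, -, hk⟩ := (Nat.dvd_prime_pow (Fact.out)).1 this
  exact ⟨k, hk⟩

/-- A subgroup of index `p` of a `p`-group is normal. -/
theorem le_normalizer_of_relIndex_eq [Finite G] {p : ℕ} [hp : Fact p.Prime] {A B : Subgroup G}
    (hB : IsPGroup p B) (h : A ≤ B) (h' : A.relIndex B = p) : B ≤ normalizer (A : Set G) := by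
  rw [← normal_subgroupOf_iff_le_normalizer h]
  apply normal_of_index_eq_minFac_card
  obtain ⟨n, hn⟩ := IsPGroup.iff_card.1 hB
  rw [hn, Nat.Prime.pow_minFac hp.out]
  · exact h'
  · rintro rfl
    have : p ∣ Nat.card B := by
      rw [← h']; exact index_dvd_card _
    rw [hn, pow_zero, Nat.dvd_one] at this
    exact hp.out.ne_one this

theorem conj_mem_of_le_normalizer {A B : Subgroup G} (h : A ≤ normalizer (B : Set G)) {a b : G}
    (ha : a ∈ A) (hb : b ∈ B) : a * b * a⁻¹ ∈ B :=
  (mem_normalizer_iff.1 (h ha) b).1 hb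

theorem smul_eq_of_mem_normalizer {B : Subgroup G} {g : G} :
    MulAut.conj g • B = B ↔ g ∈ normalizer (B : Set G) := by
  rw [mem_normalizer_iff]
  constructor
  · intro h x
    conv_rhs => rw [← h]
    rw [mem_pointwise_smul_iff_inv_smul_mem]
    simp [MulAut.smul_def, mul_assoc]
  · intro h
    ext x
    rw [mem_pointwise_smul_iff_inv_smul_mem, h]
    simp [MulAut.smul_def, mul_assoc]

theorem card_dvd_of_isPGroup [Finite G] {p n : ℕ} [hp : Fact p.Prime] (P : Sylow p G)
    {A : Subgroup G} (hA : IsPGroup p A) (hn : Nat.card P = p ^ n) : Nat.card A ∣ p ^ n := by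
  obtain ⟨Q, hQ⟩ := hA.exists_le_sylow
  rw [← hn, ← Nat.card_congr (Sylow.equiv Q P).toEquiv]
  exact card_dvd_of_le hQ

end Tools

section PClosed

theorem relIndex_mul_card {G : Type*} [Group G] {H K : Subgroup G} (h : H ≤ K) :
    H.relIndex K * Nat.card H = Nat.card K := by
  have := index_mul_card (H.subgroupOf K)
  rwa [Nat.card_congr (subgroupOfEquivOfLe h).toEquiv] at this

theorem card_conj_smul {G : Type*} [Group G] (g : G) (H : Subgroup G) :
    Nat.card (MulAut.conj g • H : Subgroup G) = Nat.card H :=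
  (Nat.card_congr (equivSMul (MulAut.conj g) H).toEquiv).symm

variable {Y : Type*} [Group Y] [Finite Y]

theorem mem_of_dvd_of_modEq : ∀ d ∈ Nat.divisors (2 ^ 5 * 73), d % 37 = 1 → d = 1 := by
  decide +kernel

theorem subsingleton_sylow_37 (h : Nat.card Y ∣ 73 * (2 ^ 5 * 37 ^ 2)) :
    Subsingleton (Sylow 37 Y) := by
  have h1 := card_sylow_modEq_one 37 Y
  let R : Sylow 37 Y := default
  have h2 : Nat.card (Sylow 37 Y) ∣ 73 * (2 ^ 5 * 37 ^ 2) :=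
    (R.card_dvd_index.trans (index_dvd_card _)).trans h
  have h3 : Nat.Coprime (Nat.card (Sylow 37 Y)) (37 ^ 2) :=
    Nat.Coprime.pow_right _ (by rw [Nat.Coprime, h1.gcd_eq]; rfl)
  have h4 : Nat.card (Sylow 37 Y) ∣ 2 ^ 5 * 73 := by
    refine h3.dvd_of_dvd_mul_right (h2.trans (dvd_of_eq (by norm_num)))
  have h5 := mem_of_dvd_of_modEq _ (Nat.mem_divisors.2 ⟨h4, by norm_num⟩) h1
  exact (Nat.card_eq_one_iff_unique.1 h5).1

theorem dvd_thirtyTwo : ∀ d ∈ Nat.divisors (2 ^ 5), d % 73 = 1 → d = 1 := by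
  decide +kernel

theorem dvd_complement_73 : ∀ d ∈ Nat.divisors (2 ^ 5 * 37 ^ 2), d % 5329 = 1 → d = 1 := by
  decide +kernel

theorem subsingleton_sylow_73_aux (h : Nat.card Y ∣ 73 * (2 ^ 5 * 37 ^ 2)) :
    Subsingleton (Sylow 73 Y) := by
  have := subsingleton_sylow_37 h
  let R : Sylow 37 Y := default
  let Q : Sylow 73 Y := default
  have hR : (R : Subgroup Y).Normal := R.normal_of_subsingleton
  have h1 := card_inf_centralizer_modEq (A := (Q : Subgroup Y)) (D := (R : Subgroup Y)) Q.2 le_normalizer_of_normal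
  have hcR : Nat.card R ∣ 37 ^ 2 := by
    obtain ⟨n, hn⟩ := IsPGroup.iff_card.1 R.2
    have : (Nat.card R).Coprime (73 * 2 ^ 5) := by
      rw [hn]; exact Nat.Coprime.pow_left _ (by norm_num)
    refine this.dvd_of_dvd_mul_left ((card_subgroup_dvd_card _).trans (h.trans (by norm_num)))
  have h2 : (R : Subgroup Y) ≤ centralizer ((Q : Subgroup Y) : Set Y) := by
    have h3 := card_inf_dvd (R : Subgroup Y) (centralizer ((Q : Subgroup Y) : Set Y))
    have h4 : Nat.card ((R : Subgroup Y) ⊓ centralizer ((Q : Subgroup Y) : Set Y) : Subgroup Y)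
        = Nat.card R := by
      obtain ⟨i, hi, hi'⟩ := (Nat.dvd_prime_pow (Fact.out)).1 hcR
      obtain ⟨j, hj, hj'⟩ := (Nat.dvd_prime_pow (Fact.out)).1 (h3.trans hcR)
      rw [hi', hj'] at h1 ⊢
      interval_cases i <;> interval_cases j <;> simp_all [Nat.ModEq]
    exact inf_eq_left.1 (eq_of_le_of_card_ge inf_le_left h4.ge)
  have h5 : (R : Subgroup Y) ≤ normalizer ((Q : Subgroup Y) : Set Y) :=
    h2.trans (centralizer_le_normalizer _)
  have h6 := Q.card_eq_index_normalizer
  have h7 := card_sylow_modEq_one 73 Y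
  have h8 : Nat.card (Sylow 73 Y) ∣ (R : Subgroup Y).index := h6 ▸ index_dvd_of_le h5
  have h9 : (Nat.card (Sylow 73 Y)).Coprime 37 :=
    ((Nat.Prime.coprime_iff_not_dvd (Fact.out)).2 fun hd => R.not_dvd_index (hd.trans h8)).symm
  have h10 : (Nat.card (Sylow 73 Y)).Coprime 73 := by rw [Nat.Coprime, h7.gcd_eq]; rfl
  have h11 : Nat.card (Sylow 73 Y) ∣ 2 ^ 5 := by
    refine (h10.mul_right (h9.pow_right 2)).dvd_of_dvd_mul_left
      ((h8.trans (index_dvd_card _)).trans (h.trans (by norm_num)))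
  have h12 := dvd_thirtyTwo _ (Nat.mem_divisors.2 ⟨h11, by norm_num⟩) h7
  exact (Nat.card_eq_one_iff_unique.1 h12).1

theorem eq_of_normal (D : Subgroup Y) [D.Normal] (hD : IsPGroup 73 D)
    (h : D.index ∣ 73 * (2 ^ 5 * 37 ^ 2)) : Subsingleton (Sylow 73 Y) := by
  have h1 : Subsingleton (Sylow 73 (Y ⧸ D)) := subsingleton_sylow_73_aux h
  let P : Sylow 73 (Y ⧸ D) := default
  have h2 : IsPGroup 73 (comap (QuotientGroup.mk' D) (P : Subgroup (Y ⧸ D))) :=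
    P.2.comap_of_ker_isPGroup _ (by rwa [QuotientGroup.ker_mk'])
  have h3 : ∀ Q : Sylow 73 Y, comap (QuotientGroup.mk' D) (P : Subgroup (Y ⧸ D)) = Q := by
    intro Q
    refine Q.is_maximal' h2 (map_le_iff_le_comap.1 ?_)
    obtain ⟨P', hP'⟩ := (Q.2.map (QuotientGroup.mk' D)).exists_le_sylow
    rwa [Subsingleton.elim P P']
  exact ⟨fun Q Q' => Sylow.ext ((h3 Q).symm.trans (h3 Q'))⟩

theorem subsingleton_sylow_73 {k : ℕ} (h : Nat.card Y ∣ 73 ^ k * (2 ^ 5 * 37 ^ 2)) :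
    Subsingleton (Sylow 73 Y) := by
  let Q : Sylow 73 Y := default
  have h7 := card_sylow_modEq_one 73 Y
  have h8 : Nat.card (Sylow 73 Y) ∣ 2 ^ 5 * 37 ^ 2 := by
    have : (Nat.card (Sylow 73 Y)).Coprime (73 ^ k) :=
      Nat.Coprime.pow_right _ (by rw [Nat.Coprime, h7.gcd_eq]; rfl)
    exact this.dvd_of_dvd_mul_left ((Q.card_dvd_index.trans (index_dvd_card _)).trans h)
  by_cases h9 : Nat.card (Sylow 73 Y) ≡ 1 [MOD 73 ^ 2]
  · have := dvd_complement_73 _ (Nat.mem_divisors.2 ⟨h8, by norm_num⟩) h9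
    exact (Nat.card_eq_one_iff_unique.1 this).1
  · exfalso
    have h10 := mt (card_sylow_modEq_of_relIndex Q (73 ^ 2)) h9
    push Not at h10
    obtain ⟨Q', hne, hdvd⟩ := h10
    have hidx : (Q' : Subgroup Y).relIndex Q = 73 := by
      obtain ⟨n, hn⟩ := relIndex_eq_of_isPGroup (A := Q') Q.2
      rw [hn] at hdvd ⊢
      rcases n with _ | _ | n
      · exfalso
        rw [pow_zero, relIndex_eq_one] at hn
        exact hne (Sylow.ext (Q.is_maximal' Q'.2 hn))
      · rfl
      · exact absurd (pow_dvd_pow 73 (by omega)) hdvd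
    set D : Subgroup Y := (Q : Subgroup Y) ⊓ Q' with hD
    have hDQ : D.relIndex Q = 73 := by rw [hD, inf_relIndex_left]; exact hidx
    have hc : Nat.card Q = Nat.card Q' := Nat.card_congr (Sylow.equiv Q Q').toEquiv
    have hDQ1 := relIndex_mul_card (H := D) (K := Q) inf_le_left
    have hDQ' : D.relIndex Q' = 73 := by
      have := relIndex_mul_card (H := D) (K := Q') inf_le_right
      rw [hDQ, hc, ← this] at hDQ1
      exact (Nat.eq_of_mul_eq_mul_right Nat.card_pos hDQ1).symm
    have hDp : IsPGroup 73 D := Q.2.to_le inf_le_left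
    have hQN := le_normalizer_of_relIndex_eq Q.2 inf_le_left hDQ
    have hQN' := le_normalizer_of_relIndex_eq Q'.2 inf_le_right hDQ'
    have : Subsingleton (Sylow 73 (normalizer (D : Set Y))) := by
      refine eq_of_normal (D.subgroupOf _) (hDp.comap_subtype) ?_
      have e1 := relIndex_mul_index (H := D) (K := normalizer (D : Set Y)) le_normalizer
      have e2 := relIndex_mul_index (H := D) (K := Q) inf_le_left
      rw [hDQ] at e2
      have e3 : ((D.subgroupOf (normalizer (D : Set Y))).index) ∣ 73 * (Q : Subgroup Y).index := by
        rw [e2]; exact ⟨_, e1.symm⟩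
      refine e3.trans (mul_dvd_mul_left _ ?_)
      refine ((Nat.Coprime.pow_right k ?_).dvd_of_dvd_mul_left ((index_dvd_card _).trans h))
      exact ((Nat.Prime.coprime_iff_not_dvd (Fact.out)).2 Q.not_dvd_index).symm
    exact hne (Sylow.subtype_injective (hP := hQN') (hQ := hQN) (Subsingleton.elim _ _))

theorem exists_isPGroup_ge {G : Type*} [Group G] [Finite G] (Y : Subgroup G) {k : ℕ}
    (h : Nat.card Y ∣ 73 ^ k * (2 ^ 5 * 37 ^ 2)) :
    ∃ T ≤ Y, IsPGroup 73 T ∧ (∀ A ≤ Y, IsPGroup 73 A → A ≤ T) ∧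
      normalizer (Y : Set G) ≤ normalizer (T : Set G) := by
  have := subsingleton_sylow_73 h
  let P : Sylow 73 Y := default
  have hP : IsPGroup 73 (map Y.subtype (P : Subgroup Y)) := P.2.map _
  have hle : map Y.subtype (P : Subgroup Y) ≤ Y := map_subtype_le _
  have hmax : ∀ A ≤ Y, IsPGroup 73 A → A ≤ map Y.subtype (P : Subgroup Y) := by
    intro A hA hp
    have h1 : IsPGroup 73 (A.subgroupOf Y) := hp.comap_subtype
    obtain ⟨P', hP'⟩ := h1.exists_le_sylow
    rw [Subsingleton.elim P' P] at hP'
    have := map_mono (f := Y.subtype) hP'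
    rwa [map_subgroupOf_eq_of_le hA] at this
  refine ⟨_, hle, hP, hmax, fun g hg => ?_⟩
  rw [← smul_eq_of_mem_normalizer] at hg ⊢
  refine eq_of_le_of_card_ge (hmax _ ?_ (hP.map _)) (card_conj_smul g _).ge
  conv_rhs => rw [← hg]
  exact pointwise_smul_le_pointwise_smul_iff.2 hle

end PClosed

section Data

variable {G : Type*} [Group G]

/-- The set of neighbours of a prime in the prime graph. -/
def gkNeighbors (G : Type*) [Group G] (p : ℕ) : Set ℕ :=
  {q : ℕ | p ≠ q ∧ p.Prime ∧ q.Prime ∧ ∃ g : G, orderOf g = p * q}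

theorem ncard_gkNeighbors (p : ℕ) : (gkNeighbors G p).ncard = gkDegree G p := rfl

theorem mem_gkNeighbors_comm {p q : ℕ} : p ∈ gkNeighbors G q ↔ q ∈ gkNeighbors G p := by
  simp only [gkNeighbors, Set.mem_ofPred_eq, mul_comm q p]
  tauto

/-- The facts about a group of order `|U₃(73)|` with the right degree pattern that are used to
identify it. -/
structure UData (G : Type*) [Group G] [Finite G] : Prop where
  card : Nat.card G = 2^5 * 3^2 * 7 * 37^2 * 73^3 * 751
  not_seven : ∀ r ∈ ({2, 3, 37, 73} : Finset ℕ), ∀ g : G, orderOf g ≠ 7 * r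
  not_751 : ∀ r ∈ ({2, 3, 37, 73} : Finset ℕ), ∀ g : G, orderOf g ≠ 751 * r
  not_three : ∀ g : G, orderOf g ≠ 3 * 73
  exists_orderOf : ∃ g : G, orderOf g = 37 * 73
  card_normalizer : ∀ P : Sylow 751 G, Nat.card (normalizer ((P : Subgroup G) : Set G)) = 21 * 751

theorem card_sylow_eq [Finite G] {p n m : ℕ} [hp : Fact p.Prime] (h : Nat.card G = p ^ n * m)
    (hm : ¬ p ∣ m) (P : Sylow p G) : Nat.card P = p ^ n := by
  obtain ⟨k, hk⟩ := IsPGroup.iff_card.1 P.2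
  have h1 : p ^ n ∣ Nat.card P := P.pow_dvd_card_of_pow_dvd_card (h ▸ dvd_mul_right _ _)
  have h2 : p ^ k ∣ p ^ n := by
    have : p ^ k ∣ p ^ n * m := by rw [← h, ← hk]; exact card_subgroup_dvd_card _
    exact (Nat.Coprime.pow_left _ ((Nat.Prime.coprime_iff_not_dvd hp.out).2 hm)).dvd_of_dvd_mul_right
      this
  exact Nat.dvd_antisymm (hk ▸ h2) h1

/-- The automizer of a subgroup of prime order `p` has order dividing `p - 1`. -/
theorem relIndex_centralizer_dvd [Finite G] {p : ℕ} [hp : Fact p.Prime] {P : Subgroup G}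
    (hP : Nat.card P = p) :
    (centralizer (P : Set G)).relIndex (normalizer (P : Set G)) ∣ p - 1 := by
  have : IsCyclic P := isCyclic_of_prime_card hP
  have h1 : (normalizerMonoidHom P).ker.index ∣ Nat.card (MulAut P) := by
    rw [index_ker]; exact card_subgroup_dvd_card _
  rw [normalizerMonoidHom_ker] at h1
  rw [relIndex]
  rwa [Nat.card_congr (IsCyclic.mulAutMulEquiv P).toEquiv, hP, Nat.card_eq_fintype_card,
    ZMod.card_units] at h1

theorem mem_of_dvd_card {q : ℕ} (hq : q.Prime)
    (h : q ∣ 2^5 * 3^2 * 7 * 37^2 * 73^3 * 751) : q ∈ ({2, 3, 7, 37, 73, 751} : Finset ℕ) := by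
  have : q ∈ Nat.primeFactors (2^5 * 3^2 * 7 * 37^2 * 73^3 * 751) :=
    Nat.mem_primeFactors.2 ⟨hq, h, by norm_num⟩
  have e : ∀ p : ℕ, p.Prime → q ∣ p → q = p := fun p hp h => (Nat.prime_dvd_prime_iff_eq hq hp).1 h
  simp only [hq.dvd_mul] at h
  have h7 : Nat.Prime 7 := by norm_num
  have h751 : Nat.Prime 751 := by norm_num
  have h37 : Nat.Prime 37 := by norm_num
  have h73 : Nat.Prime 73 := by norm_num
  rcases h with ((((h | h) | h) | h) | h) | h
  · simp [e 2 Nat.prime_two (hq.dvd_of_dvd_pow h)]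
  · simp [e 3 Nat.prime_three (hq.dvd_of_dvd_pow h)]
  · simp [e 7 h7 h]
  · simp [e 37 h37 (hq.dvd_of_dvd_pow h)]
  · simp [e 73 h73 (hq.dvd_of_dvd_pow h)]
  · simp [e 751 h751 h]

theorem gkNeighbors_subset [Finite G] (hG : Nat.card G = 2^5 * 3^2 * 7 * 37^2 * 73^3 * 751) (p : ℕ) :
    gkNeighbors G p ⊆ ({2, 3, 7, 37, 73, 751} : Finset ℕ) := by
  rintro q ⟨-, -, hq, g, hg⟩
  refine mem_of_dvd_card hq ?_
  rw [← hG]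
  exact (Dvd.intro_left _ hg.symm).trans (orderOf_dvd_natCard g)

theorem arith_751 : ∀ r ∈ ({2, 3, 7, 37, 73} : Finset ℕ), ∀ a ∈ Finset.range 6,
    ∀ e ∈ ({1, 2, 3, 6} : Finset ℕ), r ^ a ∣ 2^5 * 3^2 * 7 * 37^2 * 73^3 →
    r ^ a * e % 751 = 21 → r = 7 ∧ r ^ a * e = 21 := by
  decide +kernel

theorem seven_mem_and_card_normalizer [Finite G]
    (hG : Nat.card G = 2^5 * 3^2 * 7 * 37^2 * 73^3 * 751) (hdeg : gkDegree G 751 = 1)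
    (P : Sylow 751 G) :
    gkNeighbors G 751 = {7} ∧ Nat.card (normalizer ((P : Subgroup G) : Set G)) = 21 * 751 := by
  have hP : Nat.card P = 751 := by
    have := card_sylow_eq (n := 1) (m := 2^5 * 3^2 * 7 * 37^2 * 73^3) (by rw [hG]; norm_num)
      (by norm_num) P
    simpa using this
  rw [← ncard_gkNeighbors, Set.ncard_eq_one] at hdeg
  obtain ⟨r, hr⟩ := hdeg
  have hr1 : r ∈ gkNeighbors G 751 := by rw [hr]; rfl
  have hr2 : r ∈ ({2, 3, 7, 37, 73} : Finset ℕ) := by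
    have h1 := gkNeighbors_subset hG _ hr1
    have h2 := hr1.1
    simp only [Finset.coe_insert, Finset.coe_singleton, Set.mem_insert_iff,
      Set.mem_singleton_iff] at h1
    simp only [Finset.mem_insert, Finset.mem_singleton]
    tauto
  set C := centralizer ((P : Subgroup G) : Set G) with hC
  set N := normalizer ((P : Subgroup G) : Set G) with hN
  have hPC : (P : Subgroup G) ≤ C := by
    have : IsCyclic P := isCyclic_of_prime_card hP
    have hc : IsMulCommutative (P : Subgroup G) := inferInstance
    exact le_centralizer _
  obtain ⟨c, hc⟩ : 751 ∣ Nat.card C := hP ▸ card_dvd_of_le hPC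
  have hcr : ∀ {q : ℕ}, q.Prime → q ∣ c → q = r := by
    intro q hq hqc
    have hf : Fact q.Prime := ⟨hq⟩
    have hne : 751 ≠ q := by
      rintro rfl
      have h1 : 751 * 751 ∣ Nat.card G :=
        (mul_dvd_mul_left 751 hqc).trans (hc ▸ card_subgroup_dvd_card C)
      rw [hG] at h1
      norm_num at h1
    obtain ⟨g, hg⟩ := exists_orderOf_mul (p := q) (q := 751) hne.symm (A := C) (B := P)
      (by rw [hc]; exact hqc.mul_left _) (by rw [hP]) le_rfl
    have : q ∈ gkNeighbors G 751 := ⟨hne, by norm_num, hq, g, by rw [hg, mul_comm]⟩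
    rwa [hr] at this
  have hc0 : c ≠ 0 := by
    rintro rfl
    exact Nat.card_pos.ne' hc
  obtain ⟨a, ha⟩ : ∃ a, c = r ^ a := ⟨_, Nat.eq_prime_pow_of_unique_prime_dvd hc0 hcr⟩
  have hrel := relIndex_centralizer_dvd hP
  rw [← hC, ← hN] at hrel
  set e := C.relIndex N with he
  have hNC : e * Nat.card C = Nat.card N := relIndex_mul_card (centralizer_le_normalizer _)
  have hNG : Nat.card N * N.index = Nat.card G := card_mul_index N
  have hidx : Nat.card (Sylow 751 G) = N.index := P.card_eq_index_normalizer
  have hmod := card_sylow_modEq_one 751 G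
  rw [hidx] at hmod
  have hM : r ^ a * e * N.index = 2^5 * 3^2 * 7 * 37^2 * 73^3 := by
    rw [← hNC, hc, ha, hG] at hNG
    refine Nat.eq_of_mul_eq_mul_right (show 0 < 751 by norm_num) ?_
    rw [← hNG]; ring
  have hmod2 : r ^ a * e % 751 = 21 := by
    have := hmod.mul_left (r ^ a * e)
    rw [hM, mul_one] at this
    exact this.symm
  have hra : r ^ a ∣ 2^5 * 3^2 * 7 * 37^2 * 73^3 := ⟨e * N.index, by rw [← hM]; ring⟩
  have he6 : e ∈ ({1, 2, 3, 6} : Finset ℕ) := by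
    have h1 : e ∣ 2^5 * 3^2 * 7 * 37^2 * 73^3 := ⟨r ^ a * N.index, by rw [← hM]; ring⟩
    have h2 : e ∣ 6 := by
      have := Nat.dvd_gcd hrel h1
      norm_num at this
      exact this
    have h3 : e ∈ Nat.divisors 6 := Nat.mem_divisors.2 ⟨h2, by norm_num⟩
    have h4 : Nat.divisors 6 = {1, 2, 3, 6} := by decide +kernel
    rwa [h4] at h3
  have ha6 : a ∈ Finset.range 6 := by
    rw [Finset.mem_range]
    by_contra! hcon
    have h1 : r ^ 6 ∣ 2^5 * 3^2 * 7 * 37^2 * 73^3 := (pow_dvd_pow r hcon).trans hra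
    simp only [Finset.mem_insert, Finset.mem_singleton] at hr2
    rcases hr2 with rfl | rfl | rfl | rfl | rfl <;> norm_num at h1
  obtain ⟨h1, h2⟩ := arith_751 r hr2 a ha6 e he6 hra hmod2
  refine ⟨h1 ▸ hr, ?_⟩
  rw [← hNC, hc, ha, ← h2]; ring

theorem uData_of_gkDegree [Finite G]
    (hG : Nat.card G = 2^5 * 3^2 * 7 * 37^2 * 73^3 * 751)
    (h2 : gkDegree G 2 = 3) (h3 : gkDegree G 3 = 2) (h7 : gkDegree G 7 = 1)
    (h37 : gkDegree G 37 = 3) (h751 : gkDegree G 751 = 1) : UData G := by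
  have n751 := (seven_mem_and_card_normalizer hG h751 default).1
  have m7 : 751 ∈ gkNeighbors G 7 := by
    rw [mem_gkNeighbors_comm, n751]; rfl
  have n7 : gkNeighbors G 7 = {751} := by
    rw [← ncard_gkNeighbors, Set.ncard_eq_one] at h7
    obtain ⟨a, ha⟩ := h7
    rw [ha] at m7 ⊢
    rw [show a = 751 from (Set.mem_singleton_iff.1 m7).symm]
  have key : ∀ p ∈ ({2, 3, 37, 73} : Finset ℕ), gkNeighbors G p ⊆
      ((({2, 3, 37, 73} : Finset ℕ).erase p : Finset ℕ) : Set ℕ) := by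
    intro p hp q hq
    have e1 := gkNeighbors_subset hG _ hq
    have e2 := hq.1
    have e3 : q ≠ 7 := by
      rintro rfl
      rw [mem_gkNeighbors_comm, n7, Set.mem_singleton_iff] at hq
      subst hq; simp at hp
    have e4 : q ≠ 751 := by
      rintro rfl
      rw [mem_gkNeighbors_comm, n751, Set.mem_singleton_iff] at hq
      subst hq; simp at hp
    simp only [Finset.coe_insert, Finset.coe_singleton, Set.mem_insert_iff,
      Set.mem_singleton_iff] at e1
    simp only [Finset.coe_erase, Finset.coe_insert, Finset.coe_singleton, Set.mem_sdiff,
      Set.mem_insert_iff, Set.mem_singleton_iff]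
    exact ⟨by tauto, fun h => e2 h.symm⟩
  have full : ∀ p ∈ ({2, 3, 37, 73} : Finset ℕ), gkDegree G p = 3 → gkNeighbors G p =
      ((({2, 3, 37, 73} : Finset ℕ).erase p : Finset ℕ) : Set ℕ) := by
    intro p hp hd
    refine Set.eq_of_subset_of_ncard_le (key p hp) ?_ (Finset.finite_toSet _)
    rw [Set.ncard_coe_finset, Finset.card_erase_of_mem hp, ncard_gkNeighbors, hd]
    decide
  have f2 := full 2 (by simp) h2
  have f37 := full 37 (by simp) h37
  have a23 : 2 ∈ gkNeighbors G 3 := by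
    rw [mem_gkNeighbors_comm, f2]; simp
  have a37 : 37 ∈ gkNeighbors G 3 := by
    rw [mem_gkNeighbors_comm, f37]; simp
  have a73 : 73 ∈ gkNeighbors G 37 := by rw [f37]; simp
  have n73 : 73 ∉ gkNeighbors G 3 := by
    intro h
    have hs : (({2, 37, 73} : Finset ℕ) : Set ℕ) ⊆ gkNeighbors G 3 := by
      intro x hx
      simp only [Finset.coe_insert, Finset.coe_singleton, Set.mem_insert_iff,
        Set.mem_singleton_iff] at hx
      rcases hx with rfl | rfl | rfl <;> assumption
    have := Set.ncard_le_ncard hs ((Finset.finite_toSet _).subset (gkNeighbors_subset hG 3))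
    rw [Set.ncard_coe_finset, ncard_gkNeighbors, h3] at this
    revert this; decide
  have pr : ∀ r ∈ ({2, 3, 37, 73} : Finset ℕ), r.Prime := by
    intro r hr
    simp only [Finset.mem_insert, Finset.mem_singleton] at hr
    rcases hr with rfl | rfl | rfl | rfl <;> norm_num
  refine ⟨hG, ?_, ?_, ?_, ?_, fun P => (seven_mem_and_card_normalizer hG h751 P).2⟩
  · intro r hr g hg
    have : r ∈ gkNeighbors G 7 := ⟨by rintro rfl; simp at hr, by norm_num, pr r hr, g, hg⟩
    rw [n7, Set.mem_singleton_iff] at this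
    subst this; simp at hr
  · intro r hr g hg
    have : r ∈ gkNeighbors G 751 := ⟨by rintro rfl; simp at hr, by norm_num, pr r hr, g, hg⟩
    rw [n751, Set.mem_singleton_iff] at this
    subst this; simp at hr
  · intro g hg
    exact n73 ⟨by norm_num, by norm_num, by norm_num, g, hg⟩
  · obtain ⟨-, -, -, g, hg⟩ := a73
    exact ⟨g, hg⟩

end Data

section Local

variable {G : Type*} [Group G] [Finite G]

theorem not_dvd_card_normalizer {p q : ℕ} [hp : Fact p.Prime] [hq : Fact q.Prime] (hne : q ≠ p)
    (hadj : ∀ g : G, orderOf g ≠ q * p) {D : Subgroup G} (hD : IsPGroup p D)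
    (h : ¬ Nat.card D ≡ 1 [MOD q]) : ¬ q ∣ Nat.card (normalizer (D : Set G)) := by
  intro hdvd
  obtain ⟨a, ha, ha'⟩ := exists_mem_orderOf hdvd
  have hA : Nat.card (zpowers a) = q := by rw [Nat.card_zpowers, ha']
  have h1 := card_inf_centralizer_modEq (A := zpowers a) (D := D)
    (IsPGroup.of_card (n := 1) (by rw [hA, pow_one])) (by simpa using ha)
  obtain ⟨j, hj⟩ := IsPGroup.iff_card.1 (hD.to_le
    (inf_le_left : D ⊓ centralizer ((zpowers a : Subgroup G) : Set G) ≤ D))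
  rcases j with _ | j
  · rw [hj, pow_zero] at h1
    exact h h1.symm
  · obtain ⟨g, hg⟩ := exists_orderOf_mul (p := p) (q := q) hne.symm
      (A := D ⊓ centralizer ((zpowers a : Subgroup G) : Set G)) (B := zpowers a)
      (by rw [hj]; exact dvd_pow_self _ (by omega)) (by rw [hA]) inf_le_right
    exact hadj g (by rw [hg, mul_comm])

theorem card_isPGroup_73 (U : UData G) {D : Subgroup G} (hD : IsPGroup 73 D) :
    ∃ i ≤ 3, Nat.card D = 73 ^ i := by
  have := card_dvd_of_isPGroup (n := 3) default hD
    (card_sylow_eq (m := 2^5 * 3^2 * 7 * 37^2 * 751) (by rw [U.card]; norm_num) (by norm_num) _)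
  exact (Nat.dvd_prime_pow (by norm_num)).1 this

theorem card_sylow_73 (U : UData G) (Q : Sylow 73 G) : Nat.card Q = 73 ^ 3 :=
  card_sylow_eq (m := 2^5 * 3^2 * 7 * 37^2 * 751) (by rw [U.card]; norm_num) (by norm_num) _

theorem card_sylow_37 (U : UData G) (Q : Sylow 37 G) : Nat.card Q = 37 ^ 2 :=
  card_sylow_eq (m := 2^5 * 3^2 * 7 * 73^3 * 751) (by rw [U.card]; norm_num) (by norm_num) _

theorem not_dvd_normalizer_73 (U : UData G) {D : Subgroup G} (hD : IsPGroup 73 D)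
    (h : D ≠ ⊥) : ¬ 7 ∣ Nat.card (normalizer (D : Set G)) ∧
      ¬ 751 ∣ Nat.card (normalizer (D : Set G)) := by
  obtain ⟨i, hi, hi'⟩ := card_isPGroup_73 U hD
  have h0 : i ≠ 0 := by
    rintro rfl
    exact h (eq_bot_of_card_eq _ hi')
  refine ⟨not_dvd_card_normalizer (by norm_num) (U.not_seven 73 (by simp)) hD ?_,
    not_dvd_card_normalizer (by norm_num) (U.not_751 73 (by simp)) hD ?_⟩ <;>
  · rw [hi']
    interval_cases i
    · omega
    all_goals decide

theorem not_dvd_normalizer_37 (U : UData G) {D : Subgroup G} (hD : IsPGroup 37 D)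
    (h : D ≠ ⊥) : ¬ 7 ∣ Nat.card (normalizer (D : Set G)) ∧
      ¬ 751 ∣ Nat.card (normalizer (D : Set G)) := by
  obtain ⟨i, hi, hi'⟩ := (Nat.dvd_prime_pow (by norm_num)).1
    (card_dvd_of_isPGroup default hD (card_sylow_37 U _))
  have h0 : i ≠ 0 := by
    rintro rfl
    exact h (eq_bot_of_card_eq _ hi')
  refine ⟨not_dvd_card_normalizer (by norm_num) (U.not_seven 37 (by simp)) hD ?_,
    not_dvd_card_normalizer (by norm_num) (U.not_751 37 (by simp)) hD ?_⟩ <;>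
  · rw [hi']
    interval_cases i
    · omega
    all_goals decide

theorem index_dvd_card_of_sup_eq_top {N L : Subgroup G} [L.Normal] (h : N ⊔ L = ⊤) :
    L.index ∣ Nat.card N := by
  have h1 := relIndex_sup_right N L
  rw [h, relIndex_top_right] at h1
  rw [h1]
  exact index_dvd_card _

/-- The Frattini argument. -/
theorem exists_index_dvd_card_normalizer {p : ℕ} [hp : Fact p.Prime] (L : Subgroup G) [L.Normal]
    (h : p ∣ Nat.card L) : ∃ D ≤ L, IsPGroup p D ∧ D ≠ ⊥ ∧
      L.index ∣ Nat.card (normalizer (D : Set G)) := by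
  let P : Sylow p L := default
  refine ⟨map L.subtype P, map_subtype_le _, P.2.map _, fun hb => ?_,
    index_dvd_card_of_sup_eq_top P.normalizer_sup_eq_top⟩
  have h1 : p ∣ Nat.card P := P.dvd_card_of_dvd_card h
  rw [map_eq_bot_iff_of_injective _ (subtype_injective L)] at hb
  rw [hb, card_bot, Nat.dvd_one] at h1
  exact hp.out.ne_one h1

/-- A normal subgroup whose order is divisible by `73` also has order divisible by `751`. -/
theorem dvd_card_of_normal (U : UData G) (L : Subgroup G) [L.Normal] (h : 73 ∣ Nat.card L) :
    751 ∣ Nat.card L := by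
  obtain ⟨D, -, hD, hne, hdvd⟩ := exists_index_dvd_card_normalizer L h
  have h1 := (not_dvd_normalizer_73 U hD hne).2
  have h2 : 751 ∣ Nat.card L * L.index := by
    rw [card_mul_index, U.card]; exact dvd_mul_left _ _
  exact ((Nat.Prime.dvd_mul (by norm_num)).1 h2).resolve_right fun h3 => h1 (h3.trans hdvd)

theorem normalizer_le_normalizer_centralizer (D : Subgroup G) :
    normalizer (D : Set G) ≤ normalizer ((centralizer (D : Set G) : Subgroup G) : Set G) := by
  have key : ∀ g ∈ normalizer (D : Set G), ∀ x ∈ centralizer (D : Set G),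
      g * x * g⁻¹ ∈ centralizer (D : Set G) := by
    intro g hg x hx
    rw [mem_centralizer_coe_iff] at hx ⊢
    intro a ha
    have h1 : g⁻¹ * a * g ∈ D := by
      have := (mem_normalizer_iff.1 (inv_mem hg) a).1 ha
      simpa using this
    have h2 := hx _ h1
    calc a * (g * x * g⁻¹) = g * ((g⁻¹ * a * g) * x) * g⁻¹ := by group
      _ = g * x * g⁻¹ * a := by rw [h2]; group
  intro g hg
  rw [mem_normalizer_iff]
  refine fun x => ⟨key g hg x, fun h => ?_⟩
  have := key g⁻¹ (inv_mem hg) _ h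
  simpa [mul_assoc] using this

theorem card_centralizer_dvd (U : UData G) {D : Subgroup G} (hD : 73 ∣ Nat.card D) :
    Nat.card (centralizer (D : Set G)) ∣ 73 ^ 3 * (2 ^ 5 * 37 ^ 2) := by
  have key : ∀ q : ℕ, q.Prime → q ≠ 73 → (∀ g : G, orderOf g ≠ q * 73) →
      ¬ q ∣ Nat.card (centralizer (D : Set G)) := by
    intro q hq hne hadj hdvd
    have : Fact q.Prime := ⟨hq⟩
    obtain ⟨g, hg⟩ := exists_orderOf_mul hne hdvd hD le_rfl
    exact hadj g hg
  have h3 := (Nat.Prime.coprime_iff_not_dvd (by norm_num)).2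
    (key 3 (by norm_num) (by norm_num) U.not_three)
  have h7 := (Nat.Prime.coprime_iff_not_dvd (by norm_num)).2
    (key 7 (by norm_num) (by norm_num) (U.not_seven 73 (by simp)))
  have h751 := (Nat.Prime.coprime_iff_not_dvd (by norm_num)).2
    (key 751 (by norm_num) (by norm_num) (U.not_751 73 (by simp)))
  have hc : (Nat.card (centralizer (D : Set G))).Coprime (3 ^ 2 * 7 * 751) :=
    (((Nat.Coprime.pow_left 2 h3).mul_left h7).mul_left h751).symm
  refine hc.dvd_of_dvd_mul_left ((card_subgroup_dvd_card _).trans (dvd_of_eq ?_))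
  rw [U.card]; norm_num

/-- Centralizers of subgroups of order divisible by `73` have a unique Sylow `73`-subgroup. -/
theorem exists_core (U : UData G) {D : Subgroup G} (hD : 73 ∣ Nat.card D) :
    ∃ T ≤ centralizer (D : Set G), IsPGroup 73 T ∧
      (∀ A ≤ centralizer (D : Set G), IsPGroup 73 A → A ≤ T) ∧
      normalizer (D : Set G) ≤ normalizer (T : Set G) := by
  obtain ⟨T, h1, h2, h3, h4⟩ := exists_isPGroup_ge _ (card_centralizer_dvd U hD)
  exact ⟨T, h1, h2, h3, (normalizer_le_normalizer_centralizer D).trans h4⟩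

theorem normalizer_le_of_le_centralizer (U : UData G) {D : Subgroup G} (hD : 73 ∣ Nat.card D)
    {Q : Sylow 73 G} (hQ : (Q : Subgroup G) ≤ centralizer (D : Set G)) :
    normalizer (D : Set G) ≤ normalizer ((Q : Subgroup G) : Set G) := by
  obtain ⟨T, h1, h2, h3, h4⟩ := exists_core U hD
  rwa [Q.is_maximal' h2 (h3 _ hQ Q.2)] at h4

theorem eq_of_le_centralizer (U : UData G) {D : Subgroup G} (hD : 73 ∣ Nat.card D)
    {Q Q' : Sylow 73 G} (hQ : (Q : Subgroup G) ≤ centralizer (D : Set G))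
    (hQ' : (Q' : Subgroup G) ≤ centralizer (D : Set G)) : Q = Q' := by
  obtain ⟨T, h1, h2, h3, h4⟩ := exists_core U hD
  exact Sylow.ext ((Q.is_maximal' h2 (h3 _ hQ Q.2)).symm.trans
    (Q'.is_maximal' h2 (h3 _ hQ' Q'.2)))

theorem le_of_le_centralizer (U : UData G) {D A : Subgroup G} (hD : 73 ∣ Nat.card D)
    {Q : Sylow 73 G} (hQ : (Q : Subgroup G) ≤ centralizer (D : Set G))
    (hA : A ≤ centralizer (D : Set G)) (hAp : IsPGroup 73 A) : A ≤ Q := by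
  obtain ⟨T, h1, h2, h3, h4⟩ := exists_core U hD
  rw [← Q.is_maximal' h2 (h3 _ hQ Q.2)]
  exact h3 _ hA hAp

theorem le_centralizer_comm {A B : Subgroup G} (h : A ≤ centralizer (B : Set G)) :
    B ≤ centralizer (A : Set G) := by
  intro b hb
  rw [mem_centralizer_coe_iff]
  intro a ha
  exact (mem_centralizer_coe_iff.1 (h ha) b hb).symm

theorem dvd_card_center (U : UData G) (Q : Sylow 73 G) :
    73 ∣ Nat.card ((Q : Subgroup G) ⊓ centralizer ((Q : Subgroup G) : Set G) : Subgroup G) := by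
  have h := card_inf_centralizer_modEq (A := (Q : Subgroup G)) (D := (Q : Subgroup G)) Q.2
    le_normalizer
  rw [card_sylow_73 U] at h
  exact (Nat.modEq_zero_iff_dvd.1 (h.trans (by decide)))

theorem card_normalizer_eq_card_normalizer {p : ℕ} [Fact p.Prime] (Q Q' : Sylow p G) :
    Nat.card (normalizer ((Q : Subgroup G) : Set G)) =
      Nat.card (normalizer ((Q' : Subgroup G) : Set G)) := by
  have h1 := card_mul_index (normalizer ((Q : Subgroup G) : Set G))
  have h2 := card_mul_index (normalizer ((Q' : Subgroup G) : Set G))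
  have e1 : Nat.card (Sylow p G) = (normalizer ((Q : Subgroup G) : Set G)).index :=
    Q.card_eq_index_normalizer
  have e2 : Nat.card (Sylow p G) = (normalizer ((Q' : Subgroup G) : Set G)).index :=
    Q'.card_eq_index_normalizer
  rw [← e1] at h1
  rw [← e2, ← h1] at h2
  exact (Nat.eq_of_mul_eq_mul_right Nat.card_pos h2).symm

theorem dvd_card_normalizer_sylow (U : UData G) (Q : Sylow 73 G) :
    37 ∣ Nat.card (normalizer ((Q : Subgroup G) : Set G)) := by
  obtain ⟨g, hg⟩ := U.exists_orderOf
  have hu : orderOf (g ^ 37) = 73 := by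
    rw [orderOf_pow, hg]; norm_num
  have hw : orderOf (g ^ 73) = 37 := by
    rw [orderOf_pow, hg]; norm_num
  have hcu : Nat.card (zpowers (g ^ 37)) = 73 := by rw [Nat.card_zpowers, hu]
  have hcw : Nat.card (zpowers (g ^ 73)) = 37 := by rw [Nat.card_zpowers, hw]
  set A := zpowers (g ^ 37) with hA
  set W := zpowers (g ^ 73) with hW
  have hAp : IsPGroup 73 A := IsPGroup.of_card (n := 1) (by rw [hcu, pow_one])
  have hWp : IsPGroup 37 W := IsPGroup.of_card (n := 1) (by rw [hcw, pow_one])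
  have hAW : A ≤ centralizer (W : Set G) := by
    rw [hA, zpowers_le, mem_centralizer_coe_iff]
    intro a ha
    obtain ⟨k, rfl⟩ := mem_zpowers_iff.1 ha
    exact (((Commute.refl g).pow_pow _ _).zpow_left _)
  suffices ∃ Q3 : Sylow 73 G, W ≤ normalizer ((Q3 : Subgroup G) : Set G) by
    obtain ⟨Q3, h3⟩ := this
    rw [card_normalizer_eq_card_normalizer Q Q3, ← hcw]
    exact card_dvd_of_le h3
  obtain ⟨T, h1, h2, h3, h4⟩ := exists_core U (D := A) (by rw [hcu])
  have hAT : A ≤ T := by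
    refine h3 _ ?_ hAp
    have : IsMulCommutative A := inferInstance
    exact le_centralizer A
  have hWT : W ≤ normalizer (T : Set G) :=
    (le_centralizer_comm hAW).trans ((centralizer_le_normalizer _).trans h4)
  obtain ⟨Q3, hQ3⟩ := h2.exists_le_sylow
  refine ⟨Q3, ?_⟩
  by_cases hT : T ≤ centralizer (W : Set G)
  · set Z := (Q3 : Subgroup G) ⊓ centralizer ((Q3 : Subgroup G) : Set G) with hZ
    have hZT : Z ≤ T := by
      refine h3 _ ?_ (Q3.2.to_le inf_le_left)
      exact inf_le_right.trans (centralizer_le (hAT.trans hQ3))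
    refine (le_centralizer_comm (hZT.trans hT)).trans ((centralizer_le_normalizer _).trans ?_)
    exact normalizer_le_of_le_centralizer U (dvd_card_center U Q3) (le_centralizer_comm inf_le_right)
  · suffices hTQ : T = Q3 by rwa [← hTQ]
    have h5 := card_inf_centralizer_modEq hWp hWT
    obtain ⟨i, hi, hi'⟩ := card_isPGroup_73 U h2
    obtain ⟨j, hj, hj'⟩ := (Nat.dvd_prime_pow (by norm_num)).1
      (hi' ▸ card_inf_dvd T (centralizer (W : Set G)))
    have hj0 : j ≠ 0 := by
      rintro rfl
      have := card_dvd_of_le (le_inf hAT hAW)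
      rw [hj', hcu] at this
      norm_num at this
    have hij : j ≠ i := by
      rintro rfl
      exact hT (inf_eq_left.1 (eq_of_le_of_card_ge inf_le_left (by rw [hi', hj'])))
    have hi3 : i = 3 := by
      rw [hi', hj'] at h5
      interval_cases i <;> interval_cases j <;> simp_all [Nat.ModEq]
    exact eq_of_le_of_card_ge hQ3 (by rw [hi', card_sylow_73 U, hi3])

theorem exists_of_dvd {q n m : ℕ} (hq : q.Prime) (h : m ∣ 2 ^ 5 * 3 ^ 2 * q ^ n) :
    ∃ i < 6, ∃ j < 3, ∃ k < n + 1, m = 2 ^ i * 3 ^ j * q ^ k := by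
  obtain ⟨y, z, hy, hz, rfl⟩ := Nat.dvd_mul.1 h
  obtain ⟨y1, y2, hy1, hy2, rfl⟩ := Nat.dvd_mul.1 hy
  obtain ⟨i, hi, rfl⟩ := (Nat.dvd_prime_pow Nat.prime_two).1 hy1
  obtain ⟨j, hj, rfl⟩ := (Nat.dvd_prime_pow Nat.prime_three).1 hy2
  obtain ⟨k, hk, rfl⟩ := (Nat.dvd_prime_pow hq).1 hz
  exact ⟨i, by omega, j, by omega, k, by omega, rfl⟩

theorem arith_sylow {m : ℕ} (h : m ∣ 2 ^ 5 * 3 ^ 2 * 37 ^ 2) (hm : m % 73 = 1) :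
    m = 1 ∨ m = 74 ∨ m = 5476 := by
  obtain ⟨i, hi, j, hj, k, hk, rfl⟩ := exists_of_dvd (by norm_num) h
  have : ∀ i < 6, ∀ j < 3, ∀ k < 3, 2 ^ i * 3 ^ j * 37 ^ k % 73 = 1 →
      2 ^ i * 3 ^ j * 37 ^ k = 1 ∨ 2 ^ i * 3 ^ j * 37 ^ k = 74 ∨
        2 ^ i * 3 ^ j * 37 ^ k = 5476 := by decide +kernel
  exact this i hi j hj k hk hm

theorem card_normalizer_sylow (U : UData G) (Q : Sylow 73 G) :
    Nat.card (normalizer ((Q : Subgroup G) : Set G)) = 73 ^ 3 * (72 * 74 ^ 2) ∨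
      Nat.card (normalizer ((Q : Subgroup G) : Set G)) = 73 ^ 3 * (72 * 74) := by
  have hne : (Q : Subgroup G) ≠ ⊥ := by
    intro h
    have := card_sylow_73 U Q
    rw [h, card_bot] at this
    norm_num at this
  obtain ⟨h7, h751⟩ := not_dvd_normalizer_73 U Q.2 hne
  set N := normalizer ((Q : Subgroup G) : Set G) with hN
  obtain ⟨k, hk⟩ : 73 ^ 3 ∣ Nat.card N := card_sylow_73 U Q ▸ card_dvd_of_le le_normalizer
  have hidx := card_mul_index N
  have e1 : Nat.card (Sylow 73 G) = N.index := Q.card_eq_index_normalizer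
  rw [← e1, U.card] at hidx
  have hcop : (Nat.card N).Coprime (7 * 751) :=
    (((Nat.Prime.coprime_iff_not_dvd (by norm_num)).2 h7).mul_left
      ((Nat.Prime.coprime_iff_not_dvd (by norm_num)).2 h751)).symm
  obtain ⟨m, hm⟩ : 7 * 751 ∣ Nat.card (Sylow 73 G) := by
    refine hcop.symm.dvd_of_dvd_mul_left (m := Nat.card N) ?_
    rw [hidx]
    exact ⟨2^5 * 3^2 * 37^2 * 73^3, by norm_num⟩
  have hmk : k * m = 2 ^ 5 * 3 ^ 2 * 37 ^ 2 := by
    rw [hk, hm] at hidx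
    refine Nat.eq_of_mul_eq_mul_left (show 0 < 73 ^ 3 * (7 * 751) by norm_num) ?_
    rw [show 73 ^ 3 * (7 * 751) * (k * m) = 73 ^ 3 * k * (7 * 751 * m) by ring, hidx]
    norm_num
  have hm1 : m % 73 = 1 := by
    have := card_sylow_modEq_one 73 G
    rw [hm, Nat.ModEq] at this
    omega
  have hk37 : 37 ∣ k := by
    have := dvd_card_normalizer_sylow U Q
    rw [← hN, hk] at this
    exact ((Nat.Prime.dvd_mul (by norm_num)).1 this).resolve_left (by norm_num)
  rcases arith_sylow (m := m) ⟨k, by rw [← hmk]; ring⟩ hm1 with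
    rfl | rfl | rfl
  · left; rw [hk]; omega
  · right; rw [hk]; omega
  · omega

end Local

section Tools

variable {G : Type*} [Group G] [Finite G]

theorem le_centralizer_of_card_sq {p : ℕ} [Fact p.Prime] {A : Subgroup G}
    (h : Nat.card A = p ^ 2) : A ≤ centralizer (A : Set G) := by
  have := IsPGroup.isMulCommutative_of_card_eq_prime_sq h
  exact le_centralizer A

theorem commutator_mem_of_card {p : ℕ} [Fact p.Prime] {Z Q : Subgroup G} (hZ : Z ≤ Q)
    (hN : Q ≤ normalizer (Z : Set G)) (h : Nat.card Q = p ^ 2 * Nat.card Z) {x y : G} (hx : x ∈ Q)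
    (hy : y ∈ Q) : x * y * x⁻¹ * y⁻¹ ∈ Z := by
  have hn : (Z.subgroupOf Q).Normal := (normal_subgroupOf_iff_le_normalizer hZ).2 hN
  have hc : Nat.card (Q ⧸ Z.subgroupOf Q) = p ^ 2 := by
    have h1 := relIndex_mul_card hZ
    rw [h] at h1
    exact Nat.eq_of_mul_eq_mul_right Nat.card_pos h1
  have hm := (IsPGroup.isMulCommutative_of_card_eq_prime_sq hc).is_comm.comm
    (QuotientGroup.mk (⟨x, hx⟩ : Q)) (QuotientGroup.mk (⟨y, hy⟩ : Q))
  rw [← QuotientGroup.mk_mul, ← QuotientGroup.mk_mul, eq_comm, QuotientGroup.eq] at hm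
  have h2 : (y * x)⁻¹ * (x * y) ∈ Z := by simpa [mem_subgroupOf] using hm
  have h3 := conj_mem_of_le_normalizer hN (mul_mem hy hx) h2
  convert h3 using 1
  group

theorem exists_le_card_pow {p n : ℕ} [Fact p.Prime] {N : Subgroup G} (h : p ^ n ∣ Nat.card N) :
    ∃ R ≤ N, Nat.card R = p ^ n := by
  obtain ⟨K, hK⟩ := Sylow.exists_subgroup_card_pow_prime p h
  exact ⟨map N.subtype K, map_subtype_le _, by
    rw [← hK]; exact Nat.card_congr (K.equivMapOfInjective _ (subtype_injective N)).symm.toEquiv⟩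

theorem exists_sylow_ge {p n m : ℕ} [Fact p.Prime] {N A : Subgroup G} (hA : IsPGroup p A)
    (hAN : A ≤ N) (hc : Nat.card N = p ^ n * m) (hm : ¬ p ∣ m) :
    ∃ R ≤ N, A ≤ R ∧ Nat.card R = p ^ n := by
  obtain ⟨P, hP⟩ := (hA.comap_subtype (K := N)).exists_le_sylow
  refine ⟨map N.subtype P, map_subtype_le _, ?_, ?_⟩
  · have := map_mono (f := N.subtype) hP
    rwa [← subgroupOf, map_subgroupOf_eq_of_le hAN] at this
  · rw [← card_sylow_eq hc hm P]
    exact Nat.card_congr ((P : Subgroup N).equivMapOfInjective _ (subtype_injective N)).symm.toEquiv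

theorem isPGroup_of_card_prime {p : ℕ} {A : Subgroup G} (h : Nat.card A = p) : IsPGroup p A :=
  IsPGroup.of_card (n := 1) (by rw [h, pow_one])

/-- A coprime action of a `37`-group on a group of order `73` is trivial. -/
theorem le_centralizer_of_card_73 {R Z : Subgroup G} (hR : IsPGroup 37 R)
    (hZ : Nat.card Z = 73) (h : R ≤ normalizer (Z : Set G)) : Z ≤ centralizer (R : Set G) := by
  have h1 := card_inf_centralizer_modEq hR h
  rw [hZ] at h1
  rcases (Nat.dvd_prime (by norm_num)).1 (hZ ▸ card_inf_dvd Z (centralizer (R : Set G))) with h2 | h2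
  · rw [h2] at h1
    exact absurd h1 (by decide)
  · exact inf_eq_left.1 (eq_of_le_of_card_ge inf_le_left (by rw [h2, hZ]))

theorem card_inf_centralizer_37 {R Q : Subgroup G} (hR : IsPGroup 37 R)
    (hQ : Nat.card Q = 73 ^ 3) (h : R ≤ normalizer (Q : Set G)) :
    Nat.card (Q ⊓ centralizer (R : Set G) : Subgroup G) = 73 ∨ Q ≤ centralizer (R : Set G) := by
  have h1 := card_inf_centralizer_modEq hR h
  obtain ⟨j, hj, hj'⟩ := (Nat.dvd_prime_pow (by norm_num)).1
    (hQ ▸ card_inf_dvd Q (centralizer (R : Set G)))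
  rw [hj', hQ] at h1
  interval_cases j
  · exact absurd h1 (by decide)
  · left; rw [hj', pow_one]
  · exact absurd h1 (by decide)
  · right
    exact inf_eq_left.1 (eq_of_le_of_card_ge inf_le_left (by rw [hj', hQ]))

/-- The center of a Sylow subgroup, as a subgroup of the ambient group. -/
abbrev cent (Q : Sylow 73 G) : Subgroup G :=
  (Q : Subgroup G) ⊓ centralizer ((Q : Subgroup G) : Set G)

theorem le_centralizer_cent (Q : Sylow 73 G) :
    (Q : Subgroup G) ≤ centralizer (cent Q : Set G) :=
  le_centralizer_comm inf_le_right

theorem normalizer_inf_le (A B : Subgroup G) :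
    normalizer (A : Set G) ⊓ normalizer (B : Set G) ≤ normalizer ((A ⊓ B : Subgroup G) : Set G) := by
  rintro g ⟨h1, h2⟩
  refine mem_normalizer_iff.2 fun x => ?_
  have h1' := mem_normalizer_iff.1 h1 x
  have h2' := mem_normalizer_iff.1 h2 x
  exact and_congr h1' h2'

theorem normalizer_le_normalizer_cent (Q : Sylow 73 G) :
    normalizer ((Q : Subgroup G) : Set G) ≤ normalizer (cent Q : Set G) :=
  (le_inf le_rfl (normalizer_le_normalizer_centralizer _)).trans (normalizer_inf_le _ _)

theorem normalizer_cent_le (U : UData G) (Q : Sylow 73 G) :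
    normalizer (cent Q : Set G) ≤ normalizer ((Q : Subgroup G) : Set G) :=
  normalizer_le_of_le_centralizer U (dvd_card_center U Q) (le_centralizer_cent Q)

/-- Two elements of order `37^2` cannot normalize a Sylow subgroup with center of order `73`. -/
theorem card_normalizer_of_card_cent (U : UData G) (Q : Sylow 73 G) (hZ : Nat.card (cent Q) = 73) :
    Nat.card (normalizer ((Q : Subgroup G) : Set G)) = 73 ^ 3 * (72 * 74) := by
  refine (card_normalizer_sylow U Q).resolve_left fun hN => ?_
  obtain ⟨R, hRN, hR⟩ := exists_le_card_pow (p := 37) (n := 2)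
    (N := normalizer ((Q : Subgroup G) : Set G)) (by rw [hN]; norm_num)
  have hRp : IsPGroup 37 R := IsPGroup.of_card hR
  have hZR := le_centralizer_of_card_73 hRp hZ (hRN.trans (normalizer_le_normalizer_cent Q))
  have hne : R ≠ ⊥ := by
    rintro rfl
    rw [card_bot] at hR; norm_num at hR
  obtain ⟨h7, h751⟩ := not_dvd_normalizer_37 U hRp hne
  set N := normalizer (R : Set G) with hNdef
  obtain ⟨k, hk⟩ : 37 ^ 2 ∣ Nat.card N := hR ▸ card_dvd_of_le le_normalizer
  obtain ⟨S, hS⟩ := hRp.exists_le_sylow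
  have hSR : R = S := eq_of_le_of_card_ge hS (by rw [hR, card_sylow_37 U])
  have hcard := card_mul_index N
  have hidx : Nat.card (Sylow 37 G) = (normalizer ((S : Subgroup G) : Set G)).index :=
    S.card_eq_index_normalizer
  have hmod := card_sylow_modEq_one 37 G
  rw [hidx, ← hSR, ← hNdef] at hmod
  rw [U.card] at hcard
  have hcop : (Nat.card N).Coprime (7 * 751) :=
    (((Nat.Prime.coprime_iff_not_dvd (by norm_num)).2 h7).mul_left
      ((Nat.Prime.coprime_iff_not_dvd (by norm_num)).2 h751)).symm
  obtain ⟨m, hm⟩ : 7 * 751 ∣ N.index := by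
    refine hcop.symm.dvd_of_dvd_mul_left (m := Nat.card N) ?_
    rw [hcard]
    exact ⟨2^5 * 3^2 * 37^2 * 73^3, by norm_num⟩
  have hmk : k * m = 2 ^ 5 * 3 ^ 2 * 73 ^ 3 := by
    rw [hk, hm] at hcard
    refine Nat.eq_of_mul_eq_mul_left (show 0 < 37 ^ 2 * (7 * 751) by norm_num) ?_
    rw [show 37 ^ 2 * (7 * 751) * (k * m) = 37 ^ 2 * k * (7 * 751 * m) by ring, hcard]
    norm_num
  have arith : ∀ i < 6, ∀ j < 3, ∀ l < 4, 7 * 751 * (2 ^ 5 * 3 ^ 2 * 73 ^ 3 /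
      (2 ^ i * 3 ^ j * 73 ^ l)) % 37 ≠ 1 ∨ (¬ 73 ∣ 2 ^ i * 3 ^ j * 73 ^ l) ∨
      (73 ^ 2 ∣ 2 ^ i * 3 ^ j * 73 ^ l ∧ ¬ 73 ^ 3 ∣ 2 ^ i * 3 ^ j * 73 ^ l) := by
    decide +kernel
  have hk0 : 0 < k := Nat.pos_of_ne_zero (by rintro rfl; norm_num at hmk)
  have h73k : 73 ∣ k := by
    have h1 : 73 ∣ Nat.card N := hZ ▸ card_dvd_of_le (hZR.trans (centralizer_le_normalizer _))
    rw [hk] at h1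
    exact ((Nat.Prime.dvd_mul (by norm_num)).1 h1).resolve_left (by norm_num)
  have hmeq : 2 ^ 5 * 3 ^ 2 * 73 ^ 3 / k = m := by
    rw [← hmk]; exact Nat.mul_div_cancel_left m hk0
  have harith : 73 ^ 2 ∣ k ∧ ¬ 73 ^ 3 ∣ k := by
    obtain ⟨a, ha, b, hb, c, hc, rfl⟩ := exists_of_dvd (m := k) (by norm_num) ⟨m, hmk.symm⟩
    exact ((arith a ha b hb c hc).resolve_left (not_not.2 (by
      rw [hmeq]; rw [hm] at hmod; exact hmod))).resolve_left (not_not.2 h73k)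
  obtain ⟨h2, h3⟩ := harith
  obtain ⟨l, hl⟩ := h2
  have hl73 : ¬ 73 ∣ 37 ^ 2 * l := by
    intro h
    have h4 : 73 ∣ l := ((Nat.Prime.dvd_mul (by norm_num)).1 h).resolve_left (by norm_num)
    exact h3 (by rw [hl, pow_succ]; exact mul_dvd_mul_left _ h4)
  obtain ⟨P, hPN, hZP, hP⟩ := exists_sylow_ge (p := 73) (n := 2) (m := 37 ^ 2 * l)
    (isPGroup_of_card_prime hZ) (hZR.trans (centralizer_le_normalizer _))
    (by rw [hk, hl]; ring) hl73
  have hPp : IsPGroup 73 P := IsPGroup.of_card hP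
  have hPR : P ≤ centralizer (R : Set G) := by
    refine le_centralizer_comm ?_
    have h1 := card_inf_centralizer_modEq hPp hPN
    obtain ⟨j, hj, hj'⟩ := (Nat.dvd_prime_pow (by norm_num)).1
      (hR ▸ card_inf_dvd R (centralizer (P : Set G)))
    rw [hj', hR] at h1
    interval_cases j
    · exact absurd h1 (by decide)
    · exact absurd h1 (by decide)
    · exact inf_eq_left.1 (eq_of_le_of_card_ge inf_le_left (by rw [hj', hR]))
  have hPQ : P ≤ Q := le_of_le_centralizer U (dvd_card_center U Q) (le_centralizer_cent Q)
    ((le_centralizer_of_card_sq hP).trans (centralizer_le hZP)) hPp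
  rcases card_inf_centralizer_37 hRp (card_sylow_73 U Q) hRN with h4 | h4
  · have := card_dvd_of_le (le_inf hPQ hPR)
    rw [hP, h4] at this
    norm_num at this
  · have h5 := card_dvd_of_le (h4.trans (centralizer_le_normalizer _))
    rw [← hNdef, card_sylow_73 U, hk] at h5
    exact h3 ((Nat.Coprime.pow 3 2 (show Nat.Coprime 73 37 by norm_num)).dvd_of_dvd_mul_left h5)

/-- Schur–Zassenhaus in the normalizer of a Sylow `73`-subgroup. -/
theorem exists_complement (U : UData G) (Q : Sylow 73 G)
    (hN : Nat.card (normalizer ((Q : Subgroup G) : Set G)) = 73 ^ 3 * (72 * 74)) :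
    ∃ K ≤ normalizer ((Q : Subgroup G) : Set G), Nat.card K = 72 * 74 ∧
      ∀ n ∈ normalizer ((Q : Subgroup G) : Set G), ∃ q ∈ (Q : Subgroup G), ∃ k ∈ K, n = q * k := by
  set N := normalizer ((Q : Subgroup G) : Set G) with hNdef
  have hQN : (Q : Subgroup G) ≤ N := le_normalizer
  set Q' := (Q : Subgroup G).subgroupOf N with hQ'
  have hnorm : Q'.Normal := (normal_subgroupOf_iff_le_normalizer hQN).2 le_rfl
  have hQ'c : Nat.card Q' = 73 ^ 3 := by
    rw [Nat.card_congr (subgroupOfEquivOfLe hQN).toEquiv, card_sylow_73 U]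
  have hi : Q'.index = 72 * 74 := by
    have := card_mul_index Q'
    rw [hQ'c, hN] at this
    exact Nat.eq_of_mul_eq_mul_left (by norm_num) this
  obtain ⟨K, hK⟩ := exists_right_complement'_of_coprime (N := Q') (by
    rw [hQ'c, hi]; norm_num)
  refine ⟨map N.subtype K, map_subtype_le _, ?_, ?_⟩
  · rw [← Nat.card_congr (K.equivMapOfInjective _ (subtype_injective N)).toEquiv]
    have := hK.card_mul_card
    rw [hQ'c, hN] at this
    exact Nat.eq_of_mul_eq_mul_left (by norm_num) this
  · intro n hn
    have : (⟨n, hn⟩ : N) ∈ Q' ⊔ K := by rw [hK.sup_eq_top]; trivial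
    obtain ⟨y, hy, z, hz, e⟩ := mem_sup_of_normal_left.1 this
    exact ⟨y, hy, z, ⟨z, hz, rfl⟩, (congrArg Subtype.val e).symm⟩

theorem exists_card_37 {K : Subgroup G} (hK : Nat.card K = 72 * 74) :
    ∃ W ≤ K, Nat.card W = 37 ∧ K ≤ normalizer (W : Set G) ∧
      ∀ A ≤ K, IsPGroup 37 A → A ≤ W := by
  let R : Sylow 37 K := default
  have hR : Nat.card R = 37 ^ 1 := card_sylow_eq (m := 144) (by rw [hK]; norm_num) (by norm_num) R
  have h1 := card_sylow_modEq_one 37 K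
  have h2 := R.card_dvd_index
  have h3 := card_mul_index (R : Subgroup K)
  rw [hR, hK] at h3
  have h4 : (R : Subgroup K).index = 144 := by omega
  rw [h4] at h2
  have arith : ∀ d ∈ Nat.divisors 144, d % 37 = 1 → d = 1 := by decide +kernel
  have h5 := arith _ (Nat.mem_divisors.2 ⟨h2, by norm_num⟩) h1
  have hs := (Nat.card_eq_one_iff_unique.1 h5).1
  have hn : (R : Subgroup K).Normal := R.normal_of_subsingleton
  refine ⟨map K.subtype R, map_subtype_le _, ?_, ?_, ?_⟩
  · rw [← Nat.card_congr ((R : Subgroup K).equivMapOfInjective _ (subtype_injective K)).toEquiv, hR,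
      pow_one]
  · rw [← normal_subgroupOf_iff_le_normalizer (map_subtype_le _)]
    convert hn
    exact comap_map_eq_self_of_injective (subtype_injective K) _
  · intro A hA hAp
    obtain ⟨P, hP⟩ := (hAp.comap_subtype (K := K)).exists_le_sylow
    rw [Subsingleton.elim P R] at hP
    have := map_mono (f := K.subtype) hP
    rwa [← subgroupOf, map_subgroupOf_eq_of_le hA] at this

/-- A normal `p`-subgroup of index prime to `p` contains all `p`-subgroups. -/
theorem le_of_isPGroup_of_normal {p m : ℕ} [Fact p.Prime] {W N A : Subgroup G}
    (hWN : W ≤ N) (hN : N ≤ normalizer (W : Set G)) (hW : IsPGroup p W)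
    (hc : Nat.card N = Nat.card W * m) (hm : ¬ p ∣ m) (hA : A ≤ N) (hAp : IsPGroup p A) :
    A ≤ W := by
  have hn : (comap N.subtype W).Normal := (normal_subgroupOf_iff_le_normalizer hWN).2 hN
  obtain ⟨n, hn'⟩ := IsPGroup.iff_card.1 hW
  obtain ⟨P, hP⟩ := (hAp.comap_subtype (K := N)).exists_le_sylow
  have h1 : W.subgroupOf N ≤ P := (hW.comap_subtype (K := N)).le_sylow_of_normal P
  have h2 : W.subgroupOf N = P := by
    refine eq_of_le_of_card_ge h1 ?_
    rw [card_sylow_eq (hn' ▸ hc) hm P, Nat.card_congr (subgroupOfEquivOfLe hWN).toEquiv, hn']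
  rw [← h2] at hP
  have := map_mono (f := N.subtype) hP
  rwa [← subgroupOf, map_subgroupOf_eq_of_le hA, map_subgroupOf_eq_of_le hWN] at this

theorem pow_mem_centralizer {p : ℕ} [hp : Fact p.Prime] {W : Subgroup G} (hW : Nat.card W = p)
    {x : G} (hx : x ∈ normalizer (W : Set G)) : x ^ (p - 1) ∈ centralizer (W : Set G) := by
  obtain ⟨k, hk⟩ := relIndex_centralizer_dvd hW
  have hn : ((centralizer (W : Set G)).subgroupOf (normalizer (W : Set G))).Normal := by
    rw [← normalizerMonoidHom_ker]; infer_instance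
  have h1 := pow_index_mem ((centralizer (W : Set G)).subgroupOf (normalizer (W : Set G))) ⟨x, hx⟩
  rw [mem_subgroupOf] at h1
  rw [hk, pow_mul]
  exact pow_mem h1 k

end Tools

section Pairs

variable {G : Type*} [Group G] [Finite G]

theorem card_inf_centralizer_zpowers (U : UData G) (Q : Sylow 73 G) {u : G}
    (hu : u ∈ (Q : Subgroup G)) (ho : orderOf u = 73) :
    73 ^ 2 ∣ Nat.card ((Q : Subgroup G) ⊓ centralizer (zpowers u : Set G) : Subgroup G) := by
  have hA : Nat.card (zpowers u) = 73 := by rw [Nat.card_zpowers, ho]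
  set E := (Q : Subgroup G) ⊓ centralizer (zpowers u : Set G) with hE
  obtain ⟨j, hj, hj'⟩ := card_isPGroup_73 U (Q.2.to_le (inf_le_left : E ≤ Q))
  have hAE : zpowers u ≤ E := le_inf (by rwa [zpowers_le]) (le_centralizer _)
  have hZE : cent Q ≤ E := inf_le_inf_left _ (centralizer_le (by
    rw [SetLike.coe_subset_coe, zpowers_le]; exact hu))
  rw [hj']
  refine pow_dvd_pow _ ?_
  by_contra! hj2
  have hj1 : j = 1 := by
    have := card_dvd_of_le hAE
    rw [hA, hj'] at this
    interval_cases j <;> simp_all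
  subst hj1
  have h1 : zpowers u = E := eq_of_le_of_card_ge hAE (by rw [hA, hj', pow_one])
  have h2 : cent Q = E := eq_of_le_of_card_ge hZE (by
    rw [hj', pow_one]; exact Nat.le_of_dvd Nat.card_pos (dvd_card_center U Q))
  have h3 : (Q : Subgroup G) ≤ E := le_inf le_rfl (by
    rw [h1, ← h2]; exact le_centralizer_cent Q)
  have := card_dvd_of_le h3
  rw [card_sylow_73 U, hj'] at this
  norm_num at this

theorem eq_of_sylow_le (U : UData G) {Q₁ Q₂ : Sylow 73 G} (h : (Q₁ : Subgroup G) ≤ Q₂) : Q₁ = Q₂ :=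
  Sylow.ext (eq_of_le_of_card_ge h (by rw [card_sylow_73 U, card_sylow_73 U]))

theorem exists_pair (U : UData G) {Q₁ Q₂ : Sylow 73 G} (hne : Q₁ ≠ Q₂)
    (hD : (Q₁ : Subgroup G) ⊓ Q₂ ≠ ⊥) :
    ∃ P₁ P₂ : Sylow 73 G, P₁ ≠ P₂ ∧ Nat.card ((P₁ : Subgroup G) ⊓ P₂ : Subgroup G) = 73 ^ 2 := by
  obtain ⟨i, hi, hi'⟩ := card_isPGroup_73 U (Q₁.2.to_le (inf_le_left : (Q₁ : Subgroup G) ⊓ Q₂ ≤ Q₁))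
  have h73 : 73 ∣ Nat.card ((Q₁ : Subgroup G) ⊓ Q₂ : Subgroup G) := by
    rw [hi']
    refine dvd_pow_self _ ?_
    rintro rfl
    exact hD (eq_bot_of_card_eq _ hi')
  obtain ⟨u, hu, ho⟩ := exists_mem_orderOf h73
  have hA : Nat.card (zpowers u) = 73 := by rw [Nat.card_zpowers, ho]
  obtain ⟨T, h1, h2, h3, -⟩ := exists_core U (D := zpowers u) (by rw [hA])
  obtain ⟨Q₃, hQ₃⟩ := h2.exists_le_sylow
  have key : ∀ Q : Sylow 73 G, u ∈ (Q : Subgroup G) → Q ≠ Q₃ →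
      Nat.card ((Q : Subgroup G) ⊓ Q₃ : Subgroup G) = 73 ^ 2 := by
    intro Q huQ hne
    have h4 : (Q : Subgroup G) ⊓ centralizer (zpowers u : Set G) ≤ (Q : Subgroup G) ⊓ Q₃ :=
      le_inf inf_le_left ((h3 _ inf_le_right (Q.2.to_le inf_le_left)).trans hQ₃)
    have h5 := (card_inf_centralizer_zpowers U Q huQ ho).trans (card_dvd_of_le h4)
    obtain ⟨j, hj, hj'⟩ := card_isPGroup_73 U (Q.2.to_le (inf_le_left : (Q : Subgroup G) ⊓ Q₃ ≤ Q))
    rw [hj', Nat.pow_dvd_pow_iff_le_right (by norm_num)] at h5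
    have h6 : j ≠ 3 := by
      rintro rfl
      have h7 : (Q : Subgroup G) ⊓ Q₃ = Q :=
        eq_of_le_of_card_ge inf_le_left (by rw [hj', card_sylow_73 U])
      exact hne (eq_of_sylow_le U (inf_eq_left.1 h7))
    obtain rfl : j = 2 := by omega
    exact hj'
  by_cases h : Q₁ = Q₃
  · exact ⟨Q₂, Q₃, fun h' => hne (h.trans h'.symm), key _ hu.2 fun h' => hne (h.trans h'.symm)⟩
  · exact ⟨Q₁, Q₃, h, key _ hu.1 h⟩

variable {Q₁ Q₂ : Sylow 73 G}

theorem le_normalizer_inf (U : UData G)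
    (hD : Nat.card ((Q₁ : Subgroup G) ⊓ Q₂ : Subgroup G) = 73 ^ 2) :
    (Q₁ : Subgroup G) ≤ normalizer (((Q₁ : Subgroup G) ⊓ Q₂ : Subgroup G) : Set G) := by
  refine le_normalizer_of_relIndex_eq Q₁.2 inf_le_left ?_
  have := relIndex_mul_card (inf_le_left : (Q₁ : Subgroup G) ⊓ Q₂ ≤ Q₁)
  rw [card_sylow_73 U, hD] at this
  exact Nat.eq_of_mul_eq_mul_right (show 0 < 73 ^ 2 by norm_num) (this.trans (by norm_num))

theorem sup_eq_of_not_le (U : UData G) {D B : Subgroup G} (Q : Sylow 73 G) (hD : D ≤ Q)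
    (hc : 73 ^ 2 ∣ Nat.card D) (hB : B ≤ Q) (h : ¬ B ≤ D) : D ⊔ B = Q := by
  have hle : D ⊔ B ≤ Q := sup_le hD hB
  obtain ⟨j, hj, hj'⟩ := card_isPGroup_73 U (Q.2.to_le hle)
  obtain ⟨i, hi, hi'⟩ := card_isPGroup_73 U (Q.2.to_le hD)
  have h1 := card_dvd_of_le (le_sup_left : D ≤ D ⊔ B)
  rw [hj', hi', Nat.pow_dvd_pow_iff_le_right (by norm_num)] at h1
  rw [hi', Nat.pow_dvd_pow_iff_le_right (by norm_num)] at hc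
  have h2 : i ≠ j := by
    rintro rfl
    have h3 : D = D ⊔ B := eq_of_le_of_card_ge le_sup_left (by rw [hi', hj'])
    exact h (h3 ▸ le_sup_right)
  obtain rfl : j = 3 := by omega
  exact eq_of_le_of_card_ge hle (by rw [hj', card_sylow_73 U])

theorem cent_le_inf (U : UData G) (hne : Q₁ ≠ Q₂)
    (hD : Nat.card ((Q₁ : Subgroup G) ⊓ Q₂ : Subgroup G) = 73 ^ 2) :
    cent Q₁ ≤ (Q₁ : Subgroup G) ⊓ Q₂ := by
  by_contra h
  have h2 : (Q₂ : Subgroup G) ≤ normalizer (((Q₁ : Subgroup G) ⊓ Q₂ : Subgroup G) : Set G) := by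
    rw [inf_comm] at hD ⊢
    exact le_normalizer_inf U hD
  set D := (Q₁ : Subgroup G) ⊓ Q₂ with hDdef
  have hDC : D ≤ centralizer (D : Set G) := le_centralizer_of_card_sq hD
  have h1 : (Q₁ : Subgroup G) ≤ centralizer (D : Set G) := by
    rw [← sup_eq_of_not_le U Q₁ inf_le_left (by rw [hD]) inf_le_left h]
    exact sup_le hDC (inf_le_right.trans (centralizer_le inf_le_left))
  have h3 := card_inf_centralizer_modEq Q₂.2 h2
  rw [hD] at h3
  refine hne (eq_of_le_centralizer U (D := D ⊓ centralizer ((Q₂ : Subgroup G) : Set G))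
    (Nat.modEq_zero_iff_dvd.1 (h3.trans (by decide))) (h1.trans (centralizer_le inf_le_left))
    (le_centralizer_comm inf_le_right))

theorem card_cent_of_pair (U : UData G) (hne : Q₁ ≠ Q₂)
    (hD : Nat.card ((Q₁ : Subgroup G) ⊓ Q₂ : Subgroup G) = 73 ^ 2) :
    Nat.card (cent Q₁) = 73 := by
  have h1 := cent_le_inf U hne hD
  have h2 := cent_le_inf U hne.symm (by rwa [inf_comm] at hD)
  rw [inf_comm] at h2
  have h3 := dvd_card_center U Q₁
  obtain ⟨j, hj, hj'⟩ := (Nat.dvd_prime_pow (by norm_num)).1 (hD ▸ card_dvd_of_le h1)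
  interval_cases j
  · rw [hj'] at h3; norm_num at h3
  · rw [hj', pow_one]
  · have h4 : cent Q₁ = _ := eq_of_le_of_card_ge h1 (by rw [hj', hD])
    rw [← h4] at h2
    exact absurd (eq_of_le_centralizer U (dvd_card_center U Q₂)
      ((le_centralizer_cent Q₁).trans (centralizer_le h2)) (le_centralizer_cent Q₂)) hne

theorem cent_inf_cent (U : UData G) (hne : Q₁ ≠ Q₂)
    (hD : Nat.card ((Q₁ : Subgroup G) ⊓ Q₂ : Subgroup G) = 73 ^ 2) :
    cent Q₁ ⊓ cent Q₂ = ⊥ := by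
  have h := card_cent_of_pair U hne hD
  rcases (Nat.dvd_prime (by norm_num)).1 (h ▸ card_inf_dvd (cent Q₁) (cent Q₂)) with h2 | h2
  · exact eq_bot_of_card_eq _ h2
  · exact absurd (eq_of_le_centralizer U (D := cent Q₁ ⊓ cent Q₂) (by rw [h2])
      ((le_centralizer_cent Q₁).trans (centralizer_le inf_le_left))
      ((le_centralizer_cent Q₂).trans (centralizer_le inf_le_right))) hne

/-- The normalizer of a `37`-subgroup centralizing a Sylow `73`-subgroup is too large. -/
theorem false_of_le_centralizer (U : UData G) (hne : Q₁ ≠ Q₂)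
    (hD : Nat.card ((Q₁ : Subgroup G) ⊓ Q₂ : Subgroup G) = 73 ^ 2) {K W : Subgroup G}
    (hKN : K ≤ normalizer ((Q₁ : Subgroup G) : Set G))
    (hNK : ∀ n ∈ normalizer ((Q₁ : Subgroup G) : Set G), ∃ q ∈ (Q₁ : Subgroup G), ∃ k ∈ K, n = q * k)
    (hWK : W ≤ K) (hW : Nat.card W = 37) (hKW : K ≤ normalizer (W : Set G))
    (hQW : (Q₁ : Subgroup G) ≤ centralizer (W : Set G)) : False := by
  have hZ := card_cent_of_pair U hne hD
  have hN := card_normalizer_of_card_cent U Q₁ hZ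
  have hWp : IsPGroup 37 W := isPGroup_of_card_prime hW
  set N := normalizer ((Q₁ : Subgroup G) : Set G) with hNdef
  set X := normalizer (W : Set G) with hXdef
  have hNX : N ≤ X := by
    intro n hn
    obtain ⟨q, hq, k, hk, rfl⟩ := hNK n hn
    exact mul_mem (centralizer_le_normalizer _ (hQW hq)) (hKW hk)
  have hWmax : ∀ A ≤ N, IsPGroup 37 A → A ≤ W := fun A hA hAp =>
    le_of_isPGroup_of_normal (m := 73 ^ 3 * 144) (hWK.trans hKN) hNX hWp
      (by rw [hN, hW]; norm_num) (by norm_num) hA hAp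
  set D := (Q₁ : Subgroup G) ⊓ Q₂ with hDdef
  have hDN : normalizer (D : Set G) ≤ X := by
    intro g hg
    have h1 : MulAut.conj g • W ≤ W := by
      refine hWmax _ ?_ (IsPGroup.of_card (n := 1) (by rw [card_conj_smul, hW, pow_one]))
      have h2 : W ≤ centralizer (D : Set G) :=
        le_centralizer_comm (inf_le_left.trans hQW)
      have h3 := smul_eq_of_mem_normalizer.2 (normalizer_le_normalizer_centralizer D hg)
      calc MulAut.conj g • W ≤ MulAut.conj g • centralizer (D : Set G) :=
            pointwise_smul_le_pointwise_smul_iff.2 h2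
        _ = centralizer (D : Set G) := h3
        _ ≤ centralizer (cent Q₁ : Set G) := centralizer_le (cent_le_inf U hne hD)
        _ ≤ normalizer (cent Q₁ : Set G) := centralizer_le_normalizer _
        _ ≤ N := normalizer_cent_le U Q₁
    exact smul_eq_of_mem_normalizer.1 (eq_of_le_of_card_ge h1 (by rw [card_conj_smul]))
  have hQ2X : (Q₂ : Subgroup G) ≤ X := by
    refine le_trans ?_ hDN
    rw [hDdef, inf_comm]
    exact le_normalizer_inf U (by rwa [hDdef, inf_comm] at hD)
  have hne' : W ≠ ⊥ := by
    rintro rfl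
    rw [card_bot] at hW; norm_num at hW
  obtain ⟨h7, h751⟩ := not_dvd_normalizer_37 U hWp hne'
  have hcop : (Nat.card X).Coprime (7 * 751) :=
    (((Nat.Prime.coprime_iff_not_dvd (by norm_num)).2 h7).mul_left
      ((Nat.Prime.coprime_iff_not_dvd (by norm_num)).2 h751)).symm
  have hXdvd : Nat.card X ∣ 73 ^ 3 * (72 * 74) * 74 := by
    refine hcop.dvd_of_dvd_mul_right (n := 7 * 751) ?_
    have := card_subgroup_dvd_card X
    rw [U.card] at this
    exact this.trans (by norm_num)
  have hr := relIndex_mul_card hNX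
  rw [hN] at hr
  have hr74 : N.relIndex X ∣ 74 := by
    rw [← hr, mul_comm] at hXdvd
    exact Nat.dvd_of_mul_dvd_mul_left (by norm_num) hXdvd
  have hr73 : 73 ≤ N.relIndex X := by
    obtain ⟨n, hn⟩ := relIndex_eq_of_isPGroup (A := N) Q₂.2
    refine le_trans ?_ (relIndex_le_of_le_right hQ2X (by
      rw [relIndex]; exact index_ne_zero_of_finite))
    rw [hn]
    refine Nat.le_self_pow ?_ 73
    rintro rfl
    rw [pow_zero, relIndex_eq_one] at hn
    have h5 : (Q₂ : Subgroup G) ⊓ N = (Q₂ : Subgroup G) ⊓ Q₁ := Q₂.2.inf_normalizer_sylow Q₁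
    rw [inf_eq_left.2 hn] at h5
    exact hne.symm (eq_of_sylow_le U (inf_eq_left.1 h5.symm))
  have hreq : N.relIndex X = 74 := by
    have := Nat.le_of_dvd (by norm_num) hr74
    have h2 : N.relIndex X ≠ 73 := by
      intro h; rw [h] at hr74; norm_num at hr74
    omega
  have hXi : X.index = 5257 := by
    have := card_mul_index X
    rw [← hr, hreq, U.card] at this
    omega
  have hcore : cent Q₁ ≤ X.normalCore := by
    intro z hz g
    set Y := MulAut.conj g⁻¹ • X with hY
    have hYi : Y.index = 5257 := by
      have h1 := card_mul_index Y
      rw [hY, card_conj_smul, ← card_mul_index X] at h1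
      rw [hY, Nat.eq_of_mul_eq_mul_left Nat.card_pos h1, hXi]
    have hzY : cent Q₁ ≤ Y := by
      by_contra hcon
      set S := (Q₁ : Subgroup G) ⊓ Y with hS
      have hSc : 73 ^ 2 ∣ Nat.card S := by
        obtain ⟨n, hn⟩ := relIndex_eq_of_isPGroup (A := Y) Q₁.2
        have h1 : Y.relIndex Q₁ ≤ 5257 := by
          rw [← hYi, ← relIndex_top_right]
          exact relIndex_le_of_le_right le_top (by
            rw [relIndex_top_right]; exact index_ne_zero_of_finite)
        have h2 : n ≤ 1 := by
          by_contra! h3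
          have h4 := Nat.pow_le_pow_right (show 0 < 73 by norm_num) h3
          rw [← hn] at h4
          norm_num at h4
          omega
        have h3 := relIndex_mul_card (inf_le_left : S ≤ Q₁)
        rw [inf_relIndex_left, hn, ← hS, card_sylow_73 U] at h3
        interval_cases n
        · exact ⟨73, by rw [pow_zero, one_mul] at h3; rw [h3]; norm_num⟩
        · exact ⟨1, by rw [pow_one] at h3; omega⟩
      have hnS : ¬ cent Q₁ ≤ S := fun h => hcon (h.trans inf_le_right)
      have hsup := sup_eq_of_not_le U Q₁ (inf_le_left : S ≤ Q₁) hSc inf_le_left hnS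
      have hSS : S ≤ centralizer (S : Set G) := by
        obtain ⟨j, hj, hj'⟩ := card_isPGroup_73 U (Q₁.2.to_le (inf_le_left : S ≤ Q₁))
        rw [hj', Nat.pow_dvd_pow_iff_le_right (by norm_num)] at hSc
        have h3 : j ≠ 3 := by
          rintro rfl
          have h4 : S = Q₁ := eq_of_le_of_card_ge inf_le_left (by rw [hj', card_sylow_73 U])
          exact hnS (h4 ▸ inf_le_left)
        obtain rfl : j = 2 := by omega
        exact le_centralizer_of_card_sq hj'
      have h1 : (Q₁ : Subgroup G) ≤ centralizer (S : Set G) := by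
        conv_lhs => rw [← hsup]
        exact sup_le hSS (inf_le_right.trans (centralizer_le inf_le_left))
      have h2 : (Q₁ : Subgroup G) ≤ centralizer ((Q₁ : Subgroup G) : Set G) := by
        conv_lhs => rw [← hsup]
        exact sup_le (le_centralizer_comm h1) inf_le_right
      have h3 := card_sylow_73 U Q₁
      rw [cent, inf_eq_left.2 h2, h3] at hZ
      norm_num at hZ
    have := hzY hz
    rw [hY, mem_pointwise_smul_iff_inv_smul_mem] at this
    simpa using this
  have h73 := hZ ▸ card_dvd_of_le hcore
  exact h751 ((dvd_card_of_normal U X.normalCore h73).trans (card_dvd_of_le (normalCore_le X)))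

end Pairs

section Conj

variable {G : Type*} [Group G]

theorem conj_pow_apply {x a b : G} (ha : MulAut.conj x a = b * a) (hb : MulAut.conj x b = b)
    (n : ℕ) : MulAut.conj (x ^ n) a = b ^ n * a := by
  induction n with
  | zero => simp
  | succ n ih =>
    rw [pow_succ', map_mul, MulAut.mul_apply, ih, map_mul, map_pow, ha, hb, pow_succ, mul_assoc]

theorem conj_pow_apply_self {x b : G} (hb : MulAut.conj x b = b) (n : ℕ) :
    MulAut.conj (x ^ n) b = b := by
  induction n with
  | zero => simp
  | succ n ih => rw [pow_succ', map_mul, MulAut.mul_apply, ih, hb]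

theorem conj_pow_apply_pow {x b : G} {m : ℕ} (hb : MulAut.conj x b = b ^ m) (n : ℕ) :
    MulAut.conj (x ^ n) b = b ^ m ^ n := by
  induction n with
  | zero => simp
  | succ n ih => rw [pow_succ', map_mul, MulAut.mul_apply, ih, map_pow, hb, ← pow_mul, pow_succ']

/-- In the group generated by two opposite root subgroups of `SL₂(73)`, the matrix
`diag(5, 44)`. -/
theorem exists_conj_eq_pow {z₁ z₂ x₁ x₂ : G} (hc : Commute z₁ z₂) (h₁₁ : MulAut.conj x₁ z₁ = z₁)
    (h₁₂ : MulAut.conj x₁ z₂ = z₁ * z₂) (h₂₁ : MulAut.conj x₂ z₁ = z₂ * z₁)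
    (h₂₂ : MulAut.conj x₂ z₂ = z₂) (o₁ : z₁ ^ 73 = 1) (o₂ : z₂ ^ 73 = 1) :
    ∃ h : G, MulAut.conj h z₁ = z₁ ^ 5 ∧ MulAut.conj h z₂ = z₂ ^ 44 := by
  refine ⟨x₁ * (x₂ ^ 4 * (x₁ ^ 29 * x₂ ^ 53)), ?_, ?_⟩
  · have e1 : (z₁ ^ 29 * z₂) ^ 53 * z₁ = z₁ ^ 5 * z₂ ^ 53 := by
      rw [(hc.pow_left 29).mul_pow, ← pow_mul, mul_assoc, ← (hc.pow_right 53).eq, ← mul_assoc,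
        ← pow_succ, pow_eq_pow_mod _ o₁]
    have e2 : (z₂ ^ 4 * z₁) ^ 5 * z₂ ^ 53 = z₁ ^ 5 := by
      rw [(hc.symm.pow_left 4).mul_pow, ← pow_mul, (hc.symm.pow_pow _ _).eq, mul_assoc, ← pow_add,
        o₂, mul_one]
    simp only [map_mul, MulAut.mul_apply]
    rw [conj_pow_apply h₂₁ h₂₂, map_mul (MulAut.conj (x₁ ^ 29)), map_pow (MulAut.conj (x₁ ^ 29)),
      conj_pow_apply h₁₂ h₁₁, conj_pow_apply_self h₁₁, e1, map_mul (MulAut.conj (x₂ ^ 4)),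
      map_pow (MulAut.conj (x₂ ^ 4)), map_pow (MulAut.conj (x₂ ^ 4)),
      conj_pow_apply h₂₁ h₂₂, conj_pow_apply_self h₂₂, e2, map_pow, h₁₁]
  · have e1 : (z₂ ^ 4 * z₁) ^ 29 * z₂ = z₁ ^ 29 * z₂ ^ 44 := by
      rw [(hc.symm.pow_left 4).mul_pow, ← pow_mul, (hc.symm.pow_pow _ _).eq, mul_assoc, ← pow_succ,
        pow_eq_pow_mod _ o₂]
    have e2 : z₁ ^ 29 * (z₁ * z₂) ^ 44 = z₂ ^ 44 := by
      rw [hc.mul_pow, ← mul_assoc, ← pow_add, o₁, one_mul]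
    simp only [map_mul, MulAut.mul_apply]
    rw [conj_pow_apply_self h₂₂, conj_pow_apply h₁₂ h₁₁, map_mul (MulAut.conj (x₂ ^ 4)),
      map_pow (MulAut.conj (x₂ ^ 4)), conj_pow_apply h₂₁ h₂₂, conj_pow_apply_self h₂₂, e1,
      map_mul, map_pow, map_pow, h₁₁, h₁₂, e2]

theorem mul_comm_of_commutator_sq {a b : G} (hc : (a * b * a⁻¹ * b⁻¹) ^ 73 = 1)
    (h : (a * b * a⁻¹ * b⁻¹)⁻¹ = a * b * a⁻¹ * b⁻¹) : a * b = b * a := by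
  set c := a * b * a⁻¹ * b⁻¹ with hcd
  have h2 : c ^ 2 = 1 := by
    rw [sq]; nth_rewrite 1 [← h]; exact inv_mul_cancel c
  have h3 : c = 1 := by
    rw [show 73 = 2 * 36 + 1 by norm_num, pow_succ, pow_mul, h2, one_pow, one_mul] at hc
    exact hc
  rw [hcd, mul_inv_eq_one, mul_inv_eq_iff_eq_mul] at h3
  exact h3

end Conj

section Disjoint

variable {G : Type*} [Group G] [Finite G] {Q₁ Q₂ : Sylow 73 G}

theorem zpowers_eq_of_card {p : ℕ} [hp : Fact p.Prime] {Z : Subgroup G} (hZ : Nat.card Z = p) {z : G}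
    (hz : z ∈ Z) (h1 : z ≠ 1) : zpowers z = Z := by
  have ho : orderOf z = p := by
    have h2 : orderOf z ∣ p := hZ ▸ Subgroup.orderOf_dvd_natCard Z hz
    exact ((Nat.dvd_prime hp.out).1 h2).resolve_left (by rwa [orderOf_eq_one_iff])
  exact eq_of_le_of_card_ge (by rwa [zpowers_le]) (by rw [Nat.card_zpowers, ho, hZ])

theorem pow_card_mem {Z : Subgroup G} {z : G} (hz : z ∈ Z) : z ^ Nat.card Z = 1 :=
  congrArg Subtype.val (pow_card_eq_one' (x := (⟨z, hz⟩ : Z)))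

theorem exists_conj_eq_mul {Z Q : Subgroup G} (hZ : Nat.card Z = 73) (hZQ : Z ≤ centralizer (Q : Set G))
    (hcomm : ∀ x ∈ Q, ∀ y ∈ Q, x * y * x⁻¹ * y⁻¹ ∈ Z) {a b : G} (ha : a ∈ Q)
    (ha' : a ∉ centralizer (Q : Set G)) (hb : b ∈ Z) :
    ∃ x ∈ Q, MulAut.conj x a = b * a := by
  rw [mem_centralizer_coe_iff] at ha'
  push Not at ha'
  obtain ⟨y, hy, hya⟩ := ha'
  set c := y * a * y⁻¹ * a⁻¹ with hc
  have hcZ : c ∈ Z := hcomm y hy a ha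
  have hc1 : c ≠ 1 := by
    intro h
    rw [hc, mul_inv_eq_one, mul_inv_eq_iff_eq_mul] at h
    exact hya h
  obtain ⟨m, hm⟩ : b ∈ Submonoid.powers c := by
    rw [← zpowers_eq_of_card hZ hcZ hc1] at hb
    exact mem_powers_iff_mem_zpowers.2 hb
  refine ⟨y ^ m, pow_mem hy m, ?_⟩
  rw [conj_pow_apply (b := c), ← hm]
  · rw [MulAut.conj_apply, hc]; group
  · have := mem_centralizer_coe_iff.1 (hZQ hcZ) y hy
    rw [MulAut.conj_apply, this, mul_inv_cancel_right]

theorem false_of_card_inf_centralizer (U : UData G) (hne : Q₁ ≠ Q₂)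
    (hD : Nat.card ((Q₁ : Subgroup G) ⊓ Q₂ : Subgroup G) = 73 ^ 2) {K W : Subgroup G}
    (hKN : K ≤ normalizer ((Q₁ : Subgroup G) : Set G))
    (hNK : ∀ n ∈ normalizer ((Q₁ : Subgroup G) : Set G), ∃ q ∈ (Q₁ : Subgroup G), ∃ k ∈ K, n = q * k)
    (hWK : W ≤ K) (hW : Nat.card W = 37) (hKW : K ≤ normalizer (W : Set G))
    (hQW : Nat.card ((Q₁ : Subgroup G) ⊓ centralizer (W : Set G) : Subgroup G) = 73) : False := by
  have hWp : IsPGroup 37 W := isPGroup_of_card_prime hW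
  have hD' : Nat.card ((Q₂ : Subgroup G) ⊓ Q₁ : Subgroup G) = 73 ^ 2 := by rwa [inf_comm] at hD
  have hZ₁ := card_cent_of_pair U hne hD
  have hZ₂ := card_cent_of_pair U hne.symm hD'
  have hZD₁ := cent_le_inf U hne hD
  have hZD₂ := cent_le_inf U hne.symm hD'
  have hcomm : ∀ Q : Sylow 73 G, Nat.card (cent Q) = 73 → ∀ x ∈ (Q : Subgroup G),
      ∀ y ∈ (Q : Subgroup G), x * y * x⁻¹ * y⁻¹ ∈ cent Q := fun Q hQ x hx y hy =>
    commutator_mem_of_card (p := 73) inf_le_left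
      (le_normalizer.trans (normalizer_le_normalizer_cent Q))
      (by rw [hQ, card_sylow_73 U]; norm_num) hx hy
  have hbot := cent_inf_cent U hne hD
  obtain ⟨z₂, hz₂, ho₂⟩ := exists_mem_orderOf (p := 73) (by rw [hZ₂] : 73 ∣ Nat.card (cent Q₂))
  obtain ⟨z₁, hz₁, ho₁⟩ := exists_mem_orderOf (p := 73) (by rw [hZ₁] : 73 ∣ Nat.card (cent Q₁))
  have hz₁' : z₁ ≠ 1 := by rintro rfl; simp at ho₁
  have hz₂' : z₂ ≠ 1 := by rintro rfl; simp at ho₂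
  have hzz₂ : z₂ ∉ centralizer ((Q₁ : Subgroup G) : Set G) := fun h =>
    hz₂' ((mem_bot (G := G)).1 (hbot ▸ ⟨⟨(hZD₂ hz₂).2, h⟩, hz₂⟩))
  have hzz₁ : z₁ ∉ centralizer ((Q₂ : Subgroup G) : Set G) := fun h =>
    hz₁' ((mem_bot (G := G)).1 (hbot ▸ ⟨hz₁, ⟨(hZD₁ hz₁).2, h⟩⟩))
  obtain ⟨x₁, hx₁, hx₁'⟩ := exists_conj_eq_mul hZ₁ inf_le_right (hcomm Q₁ hZ₁) (hZD₂ hz₂).2 hzz₂ hz₁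
  obtain ⟨x₂, hx₂, hx₂'⟩ := exists_conj_eq_mul hZ₂ inf_le_right (hcomm Q₂ hZ₂) (hZD₁ hz₁).2 hzz₁ hz₂
  have hcen : ∀ {Q : Sylow 73 G} {z x : G}, z ∈ cent Q → x ∈ (Q : Subgroup G) →
      MulAut.conj x z = z := fun hz hx => by
    rw [MulAut.conj_apply, mem_centralizer_coe_iff.1 hz.2 _ hx, mul_inv_cancel_right]
  obtain ⟨h, hh₁, hh₂⟩ := exists_conj_eq_pow (mem_centralizer_coe_iff.1 hz₂.2 z₁ (hZD₁ hz₁).2)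
    (hcen hz₁ hx₁) hx₁' hx₂' (hcen hz₂ hx₂) (ho₁ ▸ pow_orderOf_eq_one z₁)
    (ho₂ ▸ pow_orderOf_eq_one z₂)
  have hZ₁z : zpowers z₁ = cent Q₁ := zpowers_eq_of_card hZ₁ hz₁ hz₁'
  have hhN : h ∈ normalizer ((Q₁ : Subgroup G) : Set G) := by
    refine normalizer_cent_le U Q₁ (smul_eq_of_mem_normalizer.1 (eq_of_le_of_card_ge ?_
      (by rw [card_conj_smul])))
    rw [← hZ₁z]
    rintro _ ⟨y, hy, rfl⟩
    obtain ⟨k, rfl⟩ := mem_zpowers_iff.1 hy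
    change MulAut.conj h (z₁ ^ k) ∈ _
    rw [map_zpow, hh₁]
    exact zpow_mem (pow_mem (mem_zpowers _) _) _
  obtain ⟨q, hq, k, hk, rfl⟩ := hNK h hhN
  have hk₁ : MulAut.conj k z₁ = z₁ ^ 5 := by
    have h1 : MulAut.conj k z₁ = MulAut.conj q⁻¹ (MulAut.conj (q * k) z₁) := by
      rw [← MulAut.mul_apply, ← map_mul, inv_mul_cancel_left]
    rw [h1, hh₁, map_pow, hcen hz₁ (inv_mem hq)]
  have hk₂ : ∃ ζ ∈ cent Q₁, MulAut.conj k z₂ = ζ * z₂ ^ 44 := by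
    have h1 : MulAut.conj k z₂ = MulAut.conj q⁻¹ (MulAut.conj (q * k) z₂) := by
      rw [← MulAut.mul_apply, ← map_mul, inv_mul_cancel_left]
    refine ⟨q⁻¹ * z₂ ^ 44 * q⁻¹⁻¹ * (z₂ ^ 44)⁻¹, hcomm Q₁ hZ₁ _ (inv_mem hq) _
      (pow_mem (hZD₂ hz₂).2 _), ?_⟩
    rw [h1, hh₂, inv_mul_cancel_right, MulAut.conj_apply]
  set f := k ^ 36 with hf
  have hfW : f ∈ centralizer (W : Set G) := pow_mem_centralizer hW (hKW hk)
  have hf₁ : MulAut.conj f z₁ = z₁⁻¹ := by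
    rw [conj_pow_apply_pow hk₁, eq_inv_iff_mul_eq_one, ← pow_succ, ← orderOf_dvd_iff_pow_eq_one, ho₁]
    norm_num
  have hfZ : ∀ z ∈ cent Q₁, MulAut.conj f z = z⁻¹ := by
    intro z hz
    rw [← hZ₁z] at hz
    obtain ⟨m, rfl⟩ := mem_zpowers_iff.1 hz
    rw [map_zpow, hf₁, inv_zpow]
  have hkN : k ∈ normalizer (cent Q₁ : Set G) := normalizer_le_normalizer_cent Q₁ (hKN hk)
  have hf₂ : ∃ ζ ∈ cent Q₁, MulAut.conj f z₂ = ζ * z₂⁻¹ := by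
    have h1 : ∀ n, ∃ ζ ∈ cent Q₁, MulAut.conj (k ^ n) z₂ = ζ * z₂ ^ 44 ^ n := by
      intro n
      induction n with
      | zero => exact ⟨1, one_mem _, by simp⟩
      | succ n ih =>
        obtain ⟨ζ, hζ, e⟩ := ih
        obtain ⟨ξ, hξ, e'⟩ := hk₂
        have hc : Commute ξ (z₂ ^ 44) :=
          (show Commute _ _ from mem_centralizer_coe_iff.1 hξ.2 _ (pow_mem (hZD₂ hz₂).2 44)).symm
        refine ⟨MulAut.conj k ζ * ξ ^ 44 ^ n, mul_mem ((mem_normalizer_iff.1 hkN _).1 hζ)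
          (pow_mem hξ _), ?_⟩
        rw [pow_succ', map_mul, MulAut.mul_apply, e, map_mul, map_pow, e', hc.mul_pow, ← pow_mul,
          mul_assoc, pow_succ' 44]
    obtain ⟨ζ, hζ, e⟩ := h1 36
    refine ⟨ζ, hζ, ?_⟩
    rw [e, mul_right_inj, eq_inv_iff_mul_eq_one, ← pow_succ, ← orderOf_dvd_iff_pow_eq_one, ho₂]
    norm_num
  obtain ⟨ζ, hζ, hζ'⟩ := hf₂
  have hWN : W ≤ normalizer ((Q₁ : Subgroup G) : Set G) := hWK.trans hKN
  have hZW : cent Q₁ ≤ centralizer (W : Set G) :=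
    le_centralizer_of_card_73 hWp hZ₁ (hWN.trans (normalizer_le_normalizer_cent Q₁))
  set D := (Q₁ : Subgroup G) ⊓ Q₂ with hDdef
  have hDD : D ≤ centralizer (D : Set G) := le_centralizer_of_card_sq hD
  have hQc := hcomm Q₁ hZ₁
  have hmem : ∀ w ∈ W, w * z₂ * w⁻¹ ∈ D := by
    intro w hw
    set x := w * z₂ * w⁻¹ with hx
    have hxQ : x ∈ (Q₁ : Subgroup G) := conj_mem_of_le_normalizer hWN hw (hZD₂ hz₂).2
    have hfx : MulAut.conj f x = ζ * x⁻¹ := by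
      have h1 : MulAut.conj f x = MulAut.conj w (MulAut.conj f z₂) := by
        have h2 : w * f = f * w := mem_centralizer_coe_iff.1 hfW w hw
        rw [← MulAut.mul_apply, ← map_mul, h2, map_mul MulAut.conj, MulAut.mul_apply,
          MulAut.conj_apply w]
      have h2 : MulAut.conj w ζ = ζ := by
        rw [MulAut.conj_apply, mem_centralizer_coe_iff.1 (hZW hζ) w hw, mul_inv_cancel_right]
      rw [h1, hζ', map_mul, map_inv, h2, MulAut.conj_apply]
    have hζc : ∀ y ∈ (Q₁ : Subgroup G), Commute y ζ := fun y hy => mem_centralizer_coe_iff.1 hζ.2 y hy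
    have hz₂Q : z₂ ∈ (Q₁ : Subgroup G) := (hZD₂ hz₂).2
    have hcx : z₂ * x = x * z₂ := by
      have hcZ := hQc z₂ hz₂Q x hxQ
      refine mul_comm_of_commutator_sq (hZ₁ ▸ pow_card_mem hcZ) ?_
      rw [← hfZ _ hcZ]
      simp only [map_mul, map_inv, hζ', hfx]
      have hcc : ∀ y ∈ (Q₁ : Subgroup G), Commute y (z₂ * x * z₂⁻¹ * x⁻¹) := fun y hy =>
        mem_centralizer_coe_iff.1 hcZ.2 y hy
      have e1 := (hζc _ (inv_mem hz₂Q)).eq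
      have e2 := (hζc _ (inv_mem hxQ)).eq
      calc ζ * z₂⁻¹ * (ζ * x⁻¹) * (ζ * z₂⁻¹)⁻¹ * (ζ * x⁻¹)⁻¹
          = ζ * (z₂⁻¹ * (ζ * x⁻¹) * z₂) * ζ⁻¹ * (ζ * x⁻¹)⁻¹ := by group
        _ = z₂⁻¹ * ζ * x⁻¹ * z₂ * x * ζ⁻¹ := by
          rw [← (hζc _ (mul_mem (mul_mem (inv_mem hz₂Q) (mul_mem hζ.1 (inv_mem hxQ))) hz₂Q)).eq,
            mul_inv_cancel_right]
          group
        _ = ζ * (z₂⁻¹ * x⁻¹ * z₂ * x) * ζ⁻¹ := by rw [e1]; group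
        _ = z₂⁻¹ * x⁻¹ * z₂ * x := by
          rw [← (hζc _ (mul_mem (mul_mem (mul_mem (inv_mem hz₂Q) (inv_mem hxQ)) hz₂Q) hxQ)).eq,
            mul_inv_cancel_right]
        _ = (x * z₂)⁻¹ * (z₂ * x * z₂⁻¹ * x⁻¹) * (x * z₂) := by group
        _ = z₂ * x * z₂⁻¹ * x⁻¹ := by
          rw [((hcc _ (mul_mem hxQ hz₂Q)).inv_left).eq, inv_mul_cancel_right]
    by_contra hxD
    have hsup := sup_eq_of_not_le U Q₁ (B := zpowers x) (inf_le_left : D ≤ Q₁) (by rw [hD])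
      (by rwa [zpowers_le]) (by rwa [zpowers_le])
    have hle : (Q₁ : Subgroup G) ≤ centralizer (zpowers z₂ : Set G) := by
      rw [← hsup]
      refine sup_le (hDD.trans (centralizer_le ?_)) ?_
      · rw [SetLike.coe_subset_coe, zpowers_le]; exact ⟨(hZD₂ hz₂).2, (hZD₂ hz₂).1⟩
      · rw [zpowers_le, mem_centralizer_coe_iff]
        intro a ha
        obtain ⟨m, rfl⟩ := mem_zpowers_iff.1 ha
        exact (show Commute z₂ x from hcx).zpow_left m
    exact hzz₂ (le_centralizer_comm hle (mem_zpowers _))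
  have hDgen : D ≤ cent Q₁ ⊔ zpowers z₂ := by
    have h1 : cent Q₁ ⊔ zpowers z₂ ≤ D :=
      sup_le hZD₁ (by rw [zpowers_le]; exact ⟨(hZD₂ hz₂).2, (hZD₂ hz₂).1⟩)
    obtain ⟨j, hj, hj'⟩ := (Nat.dvd_prime_pow (by norm_num)).1 (hD ▸ card_dvd_of_le h1)
    refine (eq_of_le_of_card_ge h1 ?_).ge
    rw [hD, hj']
    refine Nat.pow_le_pow_right (by norm_num) ?_
    by_contra! hj2
    have h2 := card_dvd_of_le (le_sup_left : cent Q₁ ≤ cent Q₁ ⊔ zpowers z₂)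
    have h3 : cent Q₁ = cent Q₁ ⊔ zpowers z₂ := by
      refine eq_of_le_of_card_ge le_sup_left ?_
      rw [hj', hZ₁]
      interval_cases j <;> norm_num
    have h4 : z₂ ∈ cent Q₁ := by rw [h3]; exact le_sup_right (a := cent Q₁) (mem_zpowers z₂)
    exact hzz₂ h4.2
  have hWD : W ≤ normalizer (D : Set G) := by
    intro w hw
    refine smul_eq_of_mem_normalizer.1 (eq_of_le_of_card_ge ?_ (by rw [card_conj_smul]))
    have h1 : MulAut.conj w • D ≤ MulAut.conj w • (cent Q₁ ⊔ zpowers z₂) :=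
      pointwise_smul_le_pointwise_smul_iff.2 hDgen
    refine h1.trans ?_
    rw [smul_sup]
    refine sup_le ?_ ?_
    · rw [smul_eq_of_mem_normalizer.2 (normalizer_le_normalizer_cent Q₁ (hWN hw))]
      exact hZD₁
    · rintro _ ⟨y, hy, rfl⟩
      obtain ⟨m, rfl⟩ := mem_zpowers_iff.1 hy
      change MulAut.conj w (z₂ ^ m) ∈ D
      rw [map_zpow]
      exact zpow_mem (hmem w hw) m
  have h1 := card_inf_centralizer_modEq hWp hWD
  obtain ⟨j, hj, hj'⟩ := (Nat.dvd_prime_pow (by norm_num)).1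
    (hD ▸ card_inf_dvd D (centralizer (W : Set G)))
  have h2 := card_dvd_of_le (le_inf hZD₁ hZW)
  have h3 := card_dvd_of_le (inf_le_inf_right (centralizer (W : Set G)) (inf_le_left : D ≤ Q₁))
  rw [hQW, hj'] at h3
  rw [hZ₁, hj'] at h2
  rw [hj', hD] at h1
  interval_cases j
  · norm_num at h2
  · exact absurd h1 (by decide)
  · norm_num at h3

/-- Distinct Sylow `73`-subgroups intersect trivially. -/
theorem inf_eq_bot (U : UData G) (hne : Q₁ ≠ Q₂) : (Q₁ : Subgroup G) ⊓ Q₂ = ⊥ := by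
  by_contra hbot
  obtain ⟨P₁, P₂, hne', hD⟩ := exists_pair U hne hbot
  obtain ⟨K, hKN, hK, hNK⟩ := exists_complement U P₁
    (card_normalizer_of_card_cent U P₁ (card_cent_of_pair U hne' hD))
  obtain ⟨W, hWK, hW, hKW, -⟩ := exists_card_37 hK
  rcases card_inf_centralizer_37 (isPGroup_of_card_prime hW) (card_sylow_73 U P₁)
    (hWK.trans hKN) with h | h
  · exact false_of_card_inf_centralizer U hne' hD hKN hNK hWK hW hKW h
  · exact false_of_le_centralizer U hne' hD hKN hNK hWK hW hKW h

end Disjoint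

/-- A doubly transitive action together with the subgroups controlling a pair of points. -/
structure PointData (G : Type*) {Ω : Type*} [Group G] [MulAction G Ω] (Q W : Subgroup G)
    (i o : Ω) : Prop where
  card_points : Nat.card Ω = 73 ^ 3 + 1
  card_Q : Nat.card Q = 73 ^ 3
  card_W : Nat.card W = 37
  ne : o ≠ i
  Q_le : Q ≤ stabilizer G i
  stabilizer_le : stabilizer G i ≤ normalizer (Q : Set G)
  free : ∀ q ∈ Q, ∀ x : Ω, x ≠ i → q • x = x → q = 1
  trans : ∀ x : Ω, ∃ g : G, g • i = x
  faithful : ∀ g : G, (∀ x : Ω, g • x = x) → g = 1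
  card_K : Nat.card (stabilizer G i ⊓ stabilizer G o : Subgroup G) = 72 * 74
  W_le : W ≤ stabilizer G i ⊓ stabilizer G o
  K_le : stabilizer G i ⊓ stabilizer G o ≤ normalizer (W : Set G)
  W_max : ∀ A ≤ stabilizer G i ⊓ stabilizer G o, IsPGroup 37 A → A ≤ W
  card_Z : Nat.card (Q ⊓ centralizer (W : Set G) : Subgroup G) = 73
  not_three : ∀ g : G, orderOf g ≠ 3 * 73

section Regular

variable {G Ω : Type*} [Group G] [MulAction G Ω] [Finite G] [Finite Ω]

/-- A semiregular action of the right cardinality off a fixed point is regular. -/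
theorem exists_smul_eq_of_free {Q : Subgroup G} {i o : Ω} (hΩ : Nat.card Ω = Nat.card Q + 1)
    (ho : o ≠ i) (hQ : Q ≤ stabilizer G i) (hfree : ∀ q ∈ Q, ∀ x : Ω, x ≠ i → q • x = x → q = 1)
    {x : Ω} (hx : x ≠ i) : ∃ q ∈ Q, q • o = x := by
  classical
  let f : Q → {x : Ω // x ≠ i} := fun q => ⟨(q : G) • o, fun h =>
    ho (by rw [← inv_smul_smul (q : G) o, h]; exact inv_mem (hQ q.2))⟩
  have hinj : Function.Injective f := by
    intro q r h
    have h1 : (q : G) • o = (r : G) • o := congrArg Subtype.val h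
    have h2 := hfree _ (mul_mem (inv_mem r.2) q.2) o ho (by rw [mul_smul, h1, inv_smul_smul])
    exact Subtype.ext (inv_mul_eq_one.1 h2).symm
  have hcard : Nat.card Q = Nat.card {x : Ω // x ≠ i} := by
    have h1 := Nat.card_congr (Equiv.sumCompl (fun x : Ω => x = i))
    rw [Nat.card_sum, hΩ] at h1
    simp only [Nat.card_unique] at h1
    change 1 + Nat.card {x : Ω // x ≠ i} = _ at h1
    omega
  have hbij : Function.Bijective f := (Nat.bijective_iff_injective_and_card f).2 ⟨hinj, hcard⟩
  obtain ⟨q, hq⟩ := hbij.2 ⟨x, hx⟩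
  exact ⟨q, q.2, congrArg Subtype.val hq⟩

theorem card_stabilizer_eq_mul {Q : Subgroup G} {i o : Ω} (hΩ : Nat.card Ω = Nat.card Q + 1)
    (ho : o ≠ i) (hQ : Q ≤ stabilizer G i)
    (hfree : ∀ q ∈ Q, ∀ x : Ω, x ≠ i → q • x = x → q = 1) :
    Nat.card (stabilizer G i) =
      Nat.card Q * Nat.card (stabilizer G i ⊓ stabilizer G o : Subgroup G) := by
  rw [← Nat.card_prod]
  refine (Nat.card_congr (Equiv.ofBijective (fun x : Q × (stabilizer G i ⊓ stabilizer G o :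
    Subgroup G) => (⟨(x.1 : G) * x.2, mul_mem (hQ x.1.2) x.2.2.1⟩ : stabilizer G i)) ⟨?_, ?_⟩)).symm
  · rintro ⟨⟨q, hq⟩, ⟨k, hk⟩⟩ ⟨⟨r, hr⟩, ⟨l, hl⟩⟩ h
    have h1 : q * k = r * l := congrArg Subtype.val h
    have h2 : (q * k) • o = (r * l) • o := by rw [h1]
    rw [mul_smul, mul_smul, hk.2, hl.2] at h2
    have h3 := hfree _ (mul_mem (inv_mem hr) hq) o ho (by rw [mul_smul, h2, inv_smul_smul])
    obtain rfl := inv_mul_eq_one.1 h3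
    simpa using h1
  · rintro ⟨n, hn⟩
    obtain ⟨q, hq, h⟩ := exists_smul_eq_of_free hΩ ho hQ hfree (x := n • o) (fun h => ho (by
      rw [← inv_smul_smul n o, h]; exact (stabilizer G i).inv_mem hn))
    exact ⟨⟨⟨q, hq⟩, ⟨q⁻¹ * n, (stabilizer G i).mul_mem ((stabilizer G i).inv_mem (hQ hq)) hn, by
      change (q⁻¹ * n) • o = o
      rw [mul_smul, ← h, inv_smul_smul]⟩⟩, by simp⟩

end Regular

section

variable {G : Type*} [Group G] [Finite G]

theorem card_sylow_and_normalizer (U : UData G) (Q : Sylow 73 G) :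
    Nat.card (Sylow 73 G) = 73 ^ 3 + 1 ∧
      Nat.card (normalizer ((Q : Subgroup G) : Set G)) = 73 ^ 3 * (72 * 74) := by
  have h1 := card_sylow_modEq_of_relIndex Q (73 ^ 3) (fun Q' hne => by
    have h2 := relIndex_mul_card (inf_le_left : (Q : Subgroup G) ⊓ Q' ≤ Q)
    rw [inf_eq_bot U hne.symm, card_bot, mul_one, relIndex_bot_left, card_sylow_73 U] at h2
    rw [← inf_relIndex_left, inf_eq_bot U hne.symm, relIndex_bot_left, card_sylow_73 U])
  have h2 := card_mul_index (normalizer ((Q : Subgroup G) : Set G))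
  have e1 : Nat.card (Sylow 73 G) = (normalizer ((Q : Subgroup G) : Set G)).index :=
    Q.card_eq_index_normalizer
  rw [← e1, U.card] at h2
  rw [Nat.ModEq] at h1
  rcases card_normalizer_sylow U Q with h | h
  · rw [h] at h2
    omega
  · rw [h] at h2
    exact ⟨by omega, h⟩

theorem commute_of_normal_disjoint {L Q : Subgroup G} [L.Normal] (hLQ : L ≤ normalizer (Q : Set G))
    (h : L ⊓ Q = ⊥) : L ≤ centralizer (Q : Set G) := by
  intro l hl
  rw [mem_centralizer_coe_iff]
  intro q hq
  have h1 : l * q * l⁻¹ * q⁻¹ ∈ L ⊓ Q := by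
    refine ⟨?_, (Q.mul_mem) (conj_mem_of_le_normalizer hLQ hl hq) (Q.inv_mem hq)⟩
    rw [mul_assoc, mul_assoc, ← mul_assoc q]
    exact mul_mem hl (Normal.conj_mem inferInstance _ (L.inv_mem hl) q)
  rw [h, mem_bot, mul_inv_eq_one, mul_inv_eq_iff_eq_mul] at h1
  exact h1.symm

theorem eq_bot_of_normal_le_normalizer (U : UData G) (Q : Sylow 73 G) (L : Subgroup G) [L.Normal]
    (hL : L ≤ normalizer ((Q : Subgroup G) : Set G)) : L = ⊥ := by
  have hQne : (Q : Subgroup G) ≠ ⊥ := by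
    intro h
    have := card_sylow_73 U Q
    rw [h, card_bot] at this
    norm_num at this
  have h73 : ¬ 73 ∣ Nat.card L := fun h => (not_dvd_normalizer_73 U Q.2 hQne).2
    ((dvd_card_of_normal U L h).trans (card_dvd_of_le hL))
  have hbot : L ⊓ Q = ⊥ := by
    obtain ⟨j, hj, hj'⟩ := card_isPGroup_73 U (Q.2.to_le (inf_le_right : L ⊓ Q ≤ Q))
    have h1 := card_dvd_of_le (inf_le_left : L ⊓ Q ≤ L)
    rw [hj'] at h1
    have : j = 0 := by
      by_contra h
      exact h73 ((dvd_pow_self 73 h).trans h1)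
    subst this
    exact eq_bot_of_card_eq _ hj'
  have hLQ := commute_of_normal_disjoint hL hbot
  have hQ73 : 73 ∣ Nat.card (Q : Subgroup G) := by rw [card_sylow_73 U]; norm_num
  have h3 : ¬ 3 ∣ Nat.card L := fun h => by
    obtain ⟨g, hg⟩ := exists_orderOf_mul (p := 3) (by norm_num) h hQ73 hLQ
    exact U.not_three g hg
  have hdvd : Nat.card L ∣ 592 := by
    have h1 := card_dvd_of_le hL
    rw [(card_sylow_and_normalizer U Q).2] at h1
    have hc : (Nat.card L).Coprime (73 ^ 3 * 3 ^ 2) :=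
      ((((Nat.Prime.coprime_iff_not_dvd (by norm_num)).2 h73).pow_left 3).mul_left
        (((Nat.Prime.coprime_iff_not_dvd (by norm_num)).2 h3).pow_left 2)).symm
    exact hc.dvd_of_dvd_mul_left (h1.trans (by norm_num))
  let P : Sylow 751 G := default
  have hP : Nat.card P = 751 := (card_sylow_eq (n := 1) (m := 2^5 * 3^2 * 7 * 37^2 * 73^3)
    (by rw [U.card]; norm_num) (by norm_num) P).trans (pow_one _)
  have hLP : L ≤ centralizer ((P : Subgroup G) : Set G) := by
    have h1 := card_inf_centralizer_modEq (D := L) P.2 (by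
      rw [normalizer_eq_top]; exact le_top)
    have h2 := Nat.le_of_dvd (by norm_num) hdvd
    have h4 : Nat.card (L ⊓ centralizer ((P : Subgroup G) : Set G) : Subgroup G) ≤ Nat.card L :=
      Nat.le_of_dvd Nat.card_pos (card_inf_dvd _ _)
    exact inf_eq_left.1 (eq_of_le_of_card_ge inf_le_left
      (Nat.ModEq.eq_of_lt_of_lt h1 (by omega) (by omega)).ge)
  have key : ∀ q ∈ ({2, 3, 37, 73} : Finset ℕ), q.Prime → ¬ q ∣ Nat.card L := by
    intro q hq hqp h
    have : Fact q.Prime := ⟨hqp⟩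
    obtain ⟨g, hg⟩ := exists_orderOf_mul (p := q) (q := 751) (by
      rintro rfl; simp at hq) h (by rw [hP]) hLP
    rw [mul_comm] at hg
    exact U.not_751 q hq g hg
  have h2 := key 2 (by simp) (by norm_num)
  have h37 := key 37 (by simp) (by norm_num)
  have hc : (Nat.card L).Coprime (2 ^ 4 * 37) :=
    ((((Nat.Prime.coprime_iff_not_dvd (by norm_num)).2 h2).pow_left 4).mul_left
      ((Nat.Prime.coprime_iff_not_dvd (by norm_num)).2 h37)).symm
  exact eq_bot_of_card_eq _ (Nat.Coprime.eq_one_of_dvd hc (hdvd.trans (by norm_num)))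

theorem exists_pointData (U : UData G) (Q : Sylow 73 G) :
    ∃ (W : Subgroup G) (o : Sylow 73 G), PointData G (Q : Subgroup G) W Q o := by
  obtain ⟨hn, hN⟩ := card_sylow_and_normalizer U Q
  obtain ⟨o, ho⟩ : ∃ o, o ≠ Q := by
    have : Nontrivial (Sylow 73 G) := by
      rw [← Finite.one_lt_card_iff_nontrivial, hn]; norm_num
    exact exists_ne Q
  have hstab : stabilizer G Q = normalizer ((Q : Subgroup G) : Set G) := Q.stabilizer_eq_normalizer
  have hQle : (Q : Subgroup G) ≤ stabilizer G Q := hstab ▸ le_normalizer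
  have hfree : ∀ q ∈ (Q : Subgroup G), ∀ x : Sylow 73 G, x ≠ Q → q • x = x → q = 1 := by
    intro q hq x hx h
    have h1 : (Q : Subgroup G) ⊓ normalizer ((x : Subgroup G) : Set G) = (Q : Subgroup G) ⊓ x :=
      Q.2.inf_normalizer_sylow x
    rw [inf_eq_bot U hx.symm] at h1
    rw [← mem_bot, ← h1]
    exact ⟨hq, Sylow.smul_eq_iff_mem_normalizer.1 h⟩
  have hΩ : Nat.card (Sylow 73 G) = Nat.card (Q : Subgroup G) + 1 := by rw [hn, card_sylow_73 U]
  have hK : Nat.card (stabilizer G Q ⊓ stabilizer G o : Subgroup G) = 72 * 74 := by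
    have h1 := card_stabilizer_eq_mul hΩ ho hQle hfree
    rw [hstab, hN, card_sylow_73 U] at h1
    rw [hstab]
    exact (Nat.eq_of_mul_eq_mul_left (by norm_num) h1).symm
  have hfaith : ∀ g : G, (∀ x : Sylow 73 G, g • x = x) → g = 1 := by
    intro g hg
    have h1 := eq_bot_of_normal_le_normalizer U Q (MulAction.toPermHom G (Sylow 73 G)).ker (by
      intro g hg
      rw [← hstab]
      exact congrArg (fun σ : Equiv.Perm (Sylow 73 G) => σ Q) hg)
    rw [← mem_bot, ← h1]
    exact Equiv.ext hg
  obtain ⟨W, hWK, hW, hKW, hWmax⟩ := exists_card_37 hK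
  have hWQ : W ≤ normalizer ((Q : Subgroup G) : Set G) := hWK.trans (inf_le_left.trans hstab.le)
  refine ⟨W, o, hn, card_sylow_73 U Q, hW, ho, hQle, hstab.le, hfree,
    fun x => exists_smul_eq G Q x, hfaith, hK, hWK, hKW, hWmax, ?_, U.not_three⟩
  refine (card_inf_centralizer_37 (isPGroup_of_card_prime hW) (card_sylow_73 U Q)
    hWQ).resolve_right fun h => ?_
  have hbot : W = ⊥ := by
    rw [eq_bot_iff]
    intro w hw
    rw [mem_bot]
    refine hfaith w fun x => ?_
    by_cases hx : x = Q
    · rw [hx]; exact (hWK hw).1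
    · obtain ⟨q, hq, rfl⟩ := exists_smul_eq_of_free hΩ ho hQle hfree hx
      rw [← mul_smul, mem_centralizer_coe_iff.1 (h hq) w hw, mul_smul, (hWK hw).2]
  rw [hbot, card_bot] at hW
  norm_num at hW

end

section FixSet

variable {G α : Type*} [Group G] [MulAction G α]

/-- The points fixed by every element of the subgroup `A`. -/
def fixSet (α : Type*) [MulAction G α] (A : Subgroup G) : Set α := {x | ∀ a ∈ A, a • x = x}

theorem ncard_inter_fixSet_modEq [Finite α] {r : ℕ} [Fact r.Prime] {A : Subgroup G}
    (hA : IsPGroup r A) (s : Set α) (hs : ∀ a ∈ A, ∀ x ∈ s, a • x ∈ s) :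
    (s ∩ fixSet α A).ncard ≡ s.ncard [MOD r] := by
  let _ : MulAction A s :=
    { smul := fun a x => ⟨(a : G) • (x : α), hs a a.2 x x.2⟩
      one_smul := fun x => Subtype.ext (one_smul G (x : α))
      mul_smul := fun a b x => Subtype.ext (mul_smul (a : G) (b : G) (x : α)) }
  have h := hA.card_modEq_card_fixedPoints s
  rw [Nat.card_coe_set_eq] at h
  refine (Nat.ModEq.trans h ?_).symm
  have : (s ∩ fixSet α A).ncard = Nat.card (fixedPoints A s) := by
    rw [← Nat.card_coe_set_eq]
    refine Nat.card_congr
      { toFun := fun x => ⟨⟨x, x.2.1⟩, fun a => Subtype.ext (x.2.2 a a.2)⟩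
        invFun := fun x => ⟨x.1, x.1.2, fun a ha => congrArg Subtype.val (x.2 ⟨a, ha⟩)⟩
        left_inv := fun x => rfl
        right_inv := fun x => rfl }
  rw [this]

theorem smul_fixSet (g : G) (A : Subgroup G) :
    g • fixSet α A = fixSet α (MulAut.conj g • A) := by
  ext x
  rw [Set.mem_smul_set_iff_inv_smul_mem]
  constructor
  · intro h a ha
    obtain ⟨b, hb, rfl⟩ := ha
    have := h b hb
    change (g * b * g⁻¹) • x = x
    rw [mul_smul, mul_smul, this, smul_inv_smul]
  · intro h a ha
    have := h (g * a * g⁻¹) ⟨a, ha, rfl⟩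
    rw [mul_smul, mul_smul] at this
    rw [eq_inv_smul_iff, this]

theorem smul_fixSet_of_mem_normalizer {g : G} {A : Subgroup G} (h : g ∈ normalizer (A : Set G)) :
    g • fixSet α A = fixSet α A := by
  rw [smul_fixSet, smul_eq_of_mem_normalizer.2 h]

/-- The translates of the fixed point set of `A`. -/
def blocks (α : Type*) [MulAction G α] (A : Subgroup G) : Set (Set α) :=
  orbit G (fixSet α A)

theorem smul_mem_blocks {A : Subgroup G} (g : G) {B : Set α} (hB : B ∈ blocks α A) :
    g • B ∈ blocks α A := by
  obtain ⟨h, rfl⟩ := hB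
  exact ⟨g * h, mul_smul _ _ _⟩

theorem fixSet_mem_blocks {A : Subgroup G} : fixSet α A ∈ blocks α A := mem_orbit_self _

end FixSet

namespace PointData

variable {G Ω : Type*} [Group G] [MulAction G Ω] [Finite G] [Finite Ω]
  {Q W : Subgroup G} {i o : Ω} (D : PointData G Q W i o)

include D

theorem exists_smul_eq {x : Ω} (hx : x ≠ i) : ∃ q ∈ Q, q • o = x :=
  exists_smul_eq_of_free (by rw [D.card_points, D.card_Q]) D.ne D.Q_le D.free hx

theorem smul_eq_i {q : G} (hq : q ∈ Q) : q • i = i := D.Q_le hq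

theorem smul_ne {q : G} (hq : q ∈ Q) : q • o ≠ i := fun h => D.ne (by
  rw [← inv_smul_smul q o, h]; exact D.smul_eq_i (Q.inv_mem hq))

theorem smul_inj {q r : G} (hq : q ∈ Q) (hr : r ∈ Q) (h : q • o = r • o) : q = r := by
  have := D.free (r⁻¹ * q) (Q.mul_mem (Q.inv_mem hr) hq) o D.ne (by
    rw [mul_smul, h, inv_smul_smul])
  exact (inv_mul_eq_one.1 this).symm

theorem conj_mem {k q : G} (hk : k ∈ stabilizer G i) (hq : q ∈ Q) : k * q * k⁻¹ ∈ Q :=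
  conj_mem_of_le_normalizer D.stabilizer_le hk hq

theorem smul_smul_eq {k q : G} (hk : k ∈ stabilizer G i ⊓ stabilizer G o) :
    k • q • o = (k * q * k⁻¹) • o := by
  have : k⁻¹ • o = o := inv_smul_eq_iff.2 hk.2.symm
  rw [mul_smul, mul_smul, this]

theorem mem_fixSet {q : G} (hq : q ∈ Q) :
    q • o ∈ fixSet Ω W ↔ q ∈ centralizer (W : Set G) := by
  rw [mem_centralizer_coe_iff]
  refine forall₂_congr fun w hw => ?_
  rw [D.smul_smul_eq (D.W_le hw)]
  constructor
  · intro h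
    exact mul_inv_eq_iff_eq_mul.1 (D.smul_inj (D.conj_mem (D.W_le hw).1 hq) hq h)
  · intro h
    rw [h, mul_inv_cancel_right]

theorem i_mem : i ∈ fixSet Ω W := fun _ hw => (D.W_le hw).1

theorem o_mem : o ∈ fixSet Ω W := fun _ hw => (D.W_le hw).2

theorem fixSet_eq : fixSet Ω W =
    insert i ((fun q : G => q • o) '' (Q ⊓ centralizer (W : Set G) : Subgroup G)) := by
  ext x
  rw [Set.mem_insert_iff]
  by_cases hx : x = i
  · simp [hx, D.i_mem]
  · obtain ⟨q, hq, rfl⟩ := D.exists_smul_eq hx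
    rw [D.mem_fixSet hq]
    constructor
    · exact fun h => Or.inr ⟨q, ⟨hq, h⟩, rfl⟩
    · rintro (h | ⟨r, hr, h⟩)
      · exact absurd h hx
      · rw [← D.smul_inj hr.1 hq h]
        exact hr.2

theorem ncard_fixSet : (fixSet Ω W).ncard = 74 := by
  rw [D.fixSet_eq, Set.ncard_insert_of_notMem _ (Set.toFinite _), Set.InjOn.ncard_image]
  · have := D.card_Z
    rw [← Nat.card_coe_set_eq]
    exact congrArg (· + 1) this
  · intro q hq r hr h
    exact D.smul_inj hq.1 hr.1 h
  · rintro ⟨q, hq, h⟩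
    exact D.smul_ne hq.1 h

theorem exists_pair {x y : Ω} (h : x ≠ y) : ∃ g : G, g • i = x ∧ g • o = y := by
  obtain ⟨g, rfl⟩ := D.trans x
  obtain ⟨q, hq, hy⟩ := D.exists_smul_eq (x := g⁻¹ • y) (fun hc => h (by
    rw [← hc, smul_inv_smul]))
  exact ⟨g * q, by rw [mul_smul, D.smul_eq_i hq], by rw [mul_smul, hy, smul_inv_smul]⟩

theorem conj_smul_eq_of_mem {g : G} (hi : i ∈ g • fixSet Ω W) (ho : o ∈ g • fixSet Ω W) :
    MulAut.conj g • W = W := by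
  rw [smul_fixSet] at hi ho
  have hc := card_conj_smul g W
  have h1 : MulAut.conj g • W ≤ W := by
    refine D.W_max _ (fun a ha => ⟨hi a ha, ho a ha⟩) ?_
    exact isPGroup_of_card_prime (hc.trans D.card_W)
  exact eq_of_le_of_card_ge h1 hc.ge

theorem conj_smul_eq_conj_smul {g h : G} {x y : Ω} (hxy : x ≠ y) (hx : x ∈ g • fixSet Ω W)
    (hy : y ∈ g • fixSet Ω W) (hx' : x ∈ h • fixSet Ω W) (hy' : y ∈ h • fixSet Ω W) :
    MulAut.conj g • W = MulAut.conj h • W := by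
  obtain ⟨t, rfl, rfl⟩ := D.exists_pair hxy
  have key : ∀ k : G, t • i ∈ k • fixSet Ω W → t • o ∈ k • fixSet Ω W →
      MulAut.conj k • W = MulAut.conj t • W := by
    intro k h1 h2
    have h3 := D.conj_smul_eq_of_mem (g := t⁻¹ * k)
      (by rw [mul_smul, Set.mem_smul_set_iff_inv_smul_mem, inv_inv]; exact h1)
      (by rw [mul_smul, Set.mem_smul_set_iff_inv_smul_mem, inv_inv]; exact h2)
    rw [map_mul, mul_smul, map_inv, inv_smul_eq_iff] at h3
    exact h3
  rw [key g hx hy, key h hx' hy']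

theorem block_ext {B C : Set Ω} (hB : B ∈ blocks Ω W) (hC : C ∈ blocks Ω W) {x y : Ω}
    (hxy : x ≠ y) (hx : x ∈ B) (hy : y ∈ B) (hx' : x ∈ C) (hy' : y ∈ C) : B = C := by
  obtain ⟨g, rfl⟩ := hB
  obtain ⟨h, rfl⟩ := hC
  change g • fixSet Ω W = h • fixSet Ω W
  rw [smul_fixSet, smul_fixSet, D.conj_smul_eq_conj_smul hxy hx hy hx' hy']

theorem ncard_block {B : Set Ω} (hB : B ∈ blocks Ω W) : B.ncard = 74 := by
  obtain ⟨g, rfl⟩ := hB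
  exact (Set.ncard_smul_set g _).trans D.ncard_fixSet

theorem exists_block {x y : Ω} (hxy : x ≠ y) : ∃ B ∈ blocks Ω W, x ∈ B ∧ y ∈ B := by
  obtain ⟨t, rfl, rfl⟩ := D.exists_pair hxy
  exact ⟨t • fixSet Ω W, ⟨t, rfl⟩, Set.smul_mem_smul_set D.i_mem, Set.smul_mem_smul_set D.o_mem⟩

theorem eq_smul_fixSet {B : Set Ω} (hB : B ∈ blocks Ω W) (hi : i ∈ B) :
    ∃ q ∈ Q, B = q • fixSet Ω W := by
  obtain ⟨y, hy, hne⟩ : ∃ y ∈ B, y ≠ i := by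
    have := D.ncard_block hB
    exact Set.exists_ne_of_one_lt_ncard (by omega) i
  obtain ⟨q, hq, rfl⟩ := D.exists_smul_eq hne
  refine ⟨q, hq, D.block_ext hB (smul_mem_blocks q fixSet_mem_blocks) hne.symm hi hy ?_
    (Set.smul_mem_smul_set D.o_mem)⟩
  rw [Set.mem_smul_set_iff_inv_smul_mem, D.smul_eq_i (Q.inv_mem hq)]
  exact D.i_mem

theorem ncard_blocks : (blocks Ω W).ncard = 5257 * 5329 := by
  classical
  have := Fintype.ofFinite Ω
  have h1 := Finset.card_eq_sum_card_fiberwise (s := (Finset.univ : Finset Ω).offDiag)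
    (t := (blocks Ω W).toFinset)
    (f := fun p => if h : p.1 ≠ p.2 then (D.exists_block h).choose else ∅) (by
      rintro ⟨x, y⟩ hxy
      have hne : x ≠ y := by simpa using hxy
      simp only [ne_eq, hne, not_false_eq_true, dite_true, Finset.mem_coe, Set.mem_toFinset]
      exact (D.exists_block hne).choose_spec.1)
  have h2 : ∀ B ∈ (blocks Ω W).toFinset, (Finset.filter (fun p : Ω × Ω =>
      (if h : p.1 ≠ p.2 then (D.exists_block h).choose else ∅) = B)
      (Finset.univ : Finset Ω).offDiag).card = 74 * 73 := by
    intro B hB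
    rw [Set.mem_toFinset] at hB
    have e : Finset.filter (fun p : Ω × Ω =>
      (if h : p.1 ≠ p.2 then (D.exists_block h).choose else ∅) = B)
      (Finset.univ : Finset Ω).offDiag = B.toFinset.offDiag := by
      ext ⟨x, y⟩
      simp only [Finset.mem_filter, Finset.mem_offDiag, Finset.mem_univ, true_and,
        Set.mem_toFinset]
      constructor
      · rintro ⟨hne, h⟩
        rw [dif_pos hne] at h
        have hs := (D.exists_block hne).choose_spec
        rw [h] at hs
        exact ⟨hs.2.1, hs.2.2, hne⟩
      · rintro ⟨hx, hy, hne⟩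
        refine ⟨hne, ?_⟩
        rw [dif_pos hne]
        have hs := (D.exists_block hne).choose_spec
        exact D.block_ext hs.1 hB hne hs.2.1 hs.2.2 hx hy
    rw [e, Finset.offDiag_card, ← Set.ncard_eq_toFinset_card', D.ncard_block hB]
  rw [Finset.sum_congr rfl h2, Finset.sum_const, smul_eq_mul, Finset.offDiag_card,
    Finset.card_univ, ← Nat.card_eq_fintype_card, D.card_points, ← Set.ncard_eq_toFinset_card'] at h1
  omega

theorem ncard_blocks_through : {B ∈ blocks Ω W | i ∈ B}.ncard = 5329 := by
  classical
  have := Fintype.ofFinite Ω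
  have h1 := Finset.card_eq_sum_card_fiberwise (s := (Finset.univ : Finset Ω).erase i)
    (t := ({B ∈ blocks Ω W | i ∈ B} : Set (Set Ω)).toFinset)
    (f := fun y => if h : i ≠ y then (D.exists_block h).choose else ∅) (by
      intro y hy
      have hne : i ≠ y := by simpa [eq_comm] using hy
      simp only [ne_eq, hne, not_false_eq_true, dite_true, Finset.mem_coe, Set.mem_toFinset]
      exact ⟨(D.exists_block hne).choose_spec.1, (D.exists_block hne).choose_spec.2.1⟩)
  have h2 : ∀ B ∈ ({B ∈ blocks Ω W | i ∈ B} : Set (Set Ω)).toFinset, (Finset.filter (fun y : Ω =>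
      (if h : i ≠ y then (D.exists_block h).choose else ∅) = B)
      ((Finset.univ : Finset Ω).erase i)).card = 73 := by
    intro B hB
    rw [Set.mem_toFinset] at hB
    have e : Finset.filter (fun y : Ω =>
      (if h : i ≠ y then (D.exists_block h).choose else ∅) = B)
      ((Finset.univ : Finset Ω).erase i) = B.toFinset.erase i := by
      ext y
      simp only [Finset.mem_filter, Finset.mem_erase, Finset.mem_univ, and_true,
        Set.mem_toFinset]
      constructor
      · rintro ⟨hne, h⟩
        rw [dif_pos (Ne.symm hne)] at h
        have hs := (D.exists_block (Ne.symm hne)).choose_spec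
        rw [h] at hs
        exact ⟨hne, hs.2.2⟩
      · rintro ⟨hne, hy⟩
        refine ⟨hne, ?_⟩
        rw [dif_pos (Ne.symm hne)]
        have hs := (D.exists_block (Ne.symm hne)).choose_spec
        exact D.block_ext hs.1 hB.1 (Ne.symm hne) hs.2.1 hs.2.2 hB.2 hy
    rw [e, Finset.card_erase_of_mem (by simpa using hB.2), ← Set.ncard_eq_toFinset_card',
      D.ncard_block hB.1]
  rw [Finset.sum_congr rfl h2, Finset.sum_const, smul_eq_mul,
    Finset.card_erase_of_mem (Finset.mem_univ _),
    Finset.card_univ, ← Nat.card_eq_fintype_card, D.card_points, ← Set.ncard_eq_toFinset_card'] at h1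
  omega

theorem ncard_blocks_missing : {B ∈ blocks Ω W | i ∉ B}.ncard = 5256 * 5329 := by
  have h1 := Set.ncard_inter_add_ncard_sdiff_eq_ncard (blocks Ω W) {B | i ∈ B} (Set.toFinite _)
  have h2 := D.ncard_blocks_through
  have h3 := D.ncard_blocks
  have e1 : blocks Ω W ∩ {B | i ∈ B} = {B ∈ blocks Ω W | i ∈ B} := rfl
  have e2 : blocks Ω W \ {B | i ∈ B} = {B ∈ blocks Ω W | i ∉ B} := rfl
  rw [e1, e2, h2, h3] at h1
  omega

end PointData

namespace PointData

variable {G Ω : Type*} [Group G] [MulAction G Ω] [Finite G] [Finite Ω]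
  {Q W : Subgroup G} {i o : Ω} (D : PointData G Q W i o)

/-- The `W`-invariant blocks other than the fixed point set of `W`. -/
def spread (Ω : Type*) [MulAction G Ω] (W : Subgroup G) : Set (Set Ω) :=
  {B | B ∈ blocks Ω W ∧ (∀ w ∈ W, w • B = B) ∧ B ≠ fixSet Ω W}

include D

theorem isPGroup_W : IsPGroup 37 W := isPGroup_of_card_prime D.card_W

theorem disjoint_fixSet {B : Set Ω} (hB : B ∈ spread Ω W) : B ∩ fixSet Ω W = ∅ := by
  have h1 := ncard_inter_fixSet_modEq D.isPGroup_W B (fun w hw x hx => by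
    rw [← hB.2.1 w hw]; exact Set.smul_mem_smul_set hx)
  rw [D.ncard_block hB.1] at h1
  have h2 : (B ∩ fixSet Ω W).ncard ≤ 1 := by
    rw [Set.ncard_le_one_iff]
    intro x y hx hy
    by_contra hne
    exact hB.2.2 (D.block_ext hB.1 fixSet_mem_blocks hne hx.1 hy.1 hx.2 hy.2)
  rw [← Set.ncard_eq_zero (Set.toFinite _)]
  have h3 : (B ∩ fixSet Ω W).ncard % 37 = 0 := h1
  omega

theorem notMem_of_mem_spread {B : Set Ω} (hB : B ∈ spread Ω W) {x : Ω} (hx : x ∈ B) :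
    x ∉ fixSet Ω W := fun h => by
  have : x ∈ B ∩ fixSet Ω W := ⟨hx, h⟩
  rw [D.disjoint_fixSet hB] at this
  exact this

theorem i_notMem_of_mem_spread {B : Set Ω} (hB : B ∈ spread Ω W) : i ∉ B :=
  fun h => D.notMem_of_mem_spread hB h D.i_mem

theorem eq_of_mem_spread {B C : Set Ω} (hB : B ∈ spread Ω W) (hC : C ∈ spread Ω W) {x : Ω}
    (hx : x ∈ B) (hx' : x ∈ C) : B = C := by
  by_contra hne
  refine D.notMem_of_mem_spread hB hx fun w hw => ?_
  by_contra h
  refine hne (D.block_ext hB.1 hC.1 h ?_ hx ?_ hx')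
  · rw [← hB.2.1 w hw]; exact Set.smul_mem_smul_set hx
  · rw [← hC.2.1 w hw]; exact Set.smul_mem_smul_set hx'

theorem smul_mem_spread {g : G} (hg : g ∈ normalizer (W : Set G)) {B : Set Ω}
    (hB : B ∈ spread Ω W) : g • B ∈ spread Ω W := by
  refine ⟨smul_mem_blocks g hB.1, fun w hw => ?_, fun h => hB.2.2 ?_⟩
  · have hw' : g⁻¹ * w * g ∈ W := (mem_normalizer_iff''.1 hg w).1 hw
    rw [← inv_smul_eq_iff, ← mul_smul, ← mul_smul, hB.2.1 _ hw']
  · have := smul_fixSet_of_mem_normalizer (α := Ω) (inv_mem hg)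
    rw [← this, ← h, inv_smul_smul]

theorem ncard_spread_modEq : (spread Ω W).ncard % 37 = 2 := by
  have h1 := ncard_inter_fixSet_modEq D.isPGroup_W (blocks Ω W)
    (fun w _ B hB => smul_mem_blocks w hB)
  have h2 : spread Ω W = (blocks Ω W ∩ fixSet (Set Ω) W) \ {fixSet Ω W} := by
    ext B
    constructor
    · rintro ⟨h1, h2, h3⟩; exact ⟨⟨h1, h2⟩, h3⟩
    · rintro ⟨⟨h1, h2⟩, h3⟩; exact ⟨h1, h2, h3⟩
  have hmem : fixSet Ω W ∈ blocks Ω W ∩ fixSet (Set Ω) W :=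
    ⟨fixSet_mem_blocks, fun w hw => smul_fixSet_of_mem_normalizer (le_normalizer hw)⟩
  have h3 := Set.ncard_sdiff_singleton_add_one hmem (Set.toFinite _)
  rw [← h2] at h3
  rw [← h3, D.ncard_blocks, Nat.ModEq] at h1
  omega

theorem center_dvd_ncard_spread : 73 ∣ (spread Ω W).ncard := by
  have hp : IsPGroup 73 (Q ⊓ centralizer (W : Set G) : Subgroup G) :=
    isPGroup_of_card_prime D.card_Z
  have h1 := ncard_inter_fixSet_modEq hp (spread Ω W) (fun z hz B hB =>
    D.smul_mem_spread (centralizer_le_normalizer _ hz.2) hB)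
  have h2 : spread Ω W ∩ fixSet (Set Ω) (Q ⊓ centralizer (W : Set G) : Subgroup G) = ∅ := by
    rw [Set.eq_empty_iff_forall_notMem]
    rintro B ⟨hB, hfix⟩
    have h3 := ncard_inter_fixSet_modEq hp B (fun z hz x hx => by
      rw [← hfix z hz]; exact Set.smul_mem_smul_set hx)
    rw [D.ncard_block hB.1] at h3
    obtain ⟨x, hx, hx'⟩ : (B ∩ fixSet Ω (Q ⊓ centralizer (W : Set G) : Subgroup G)).Nonempty := by
      rw [Set.nonempty_iff_ne_empty]
      intro h
      rw [h, Set.ncard_empty] at h3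
      exact absurd h3 (by decide)
    have hne : x ≠ i := fun h => D.i_notMem_of_mem_spread hB (h ▸ hx)
    have hbot : (Q ⊓ centralizer (W : Set G) : Subgroup G) = ⊥ := by
      rw [eq_bot_iff]
      intro z hz
      exact D.free z hz.1 x hne (hx' z hz)
    have := D.card_Z
    rw [hbot, card_bot] at this
    norm_num at this
  rw [h2, Set.ncard_empty] at h1
  exact (Nat.modEq_zero_iff_dvd.1 h1.symm)

theorem three_dvd_ncard_spread : 3 ∣ (spread Ω W).ncard := by
  obtain ⟨v, hv, hv3⟩ := exists_mem_orderOf (p := 3) (A := stabilizer G i ⊓ stabilizer G o)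
    (by rw [D.card_K]; norm_num)
  have hcard : Nat.card (zpowers v) = 3 := by rw [Nat.card_zpowers, hv3]
  have hp : IsPGroup 3 (zpowers v) := isPGroup_of_card_prime hcard
  have hvK : zpowers v ≤ stabilizer G i ⊓ stabilizer G o := by
    rwa [zpowers_le]
  have h1 := ncard_inter_fixSet_modEq hp (spread Ω W) (fun z hz B hB =>
    D.smul_mem_spread (D.K_le (hvK hz)) hB)
  have h2 : spread Ω W ∩ fixSet (Set Ω) (zpowers v) = ∅ := by
    rw [Set.eq_empty_iff_forall_notMem]
    rintro B ⟨hB, hfix⟩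
    have h3 := ncard_inter_fixSet_modEq hp B (fun z hz x hx => by
      rw [← hfix z hz]; exact Set.smul_mem_smul_set hx)
    rw [D.ncard_block hB.1] at h3
    obtain ⟨x, hx, hx'⟩ : (B ∩ fixSet Ω (zpowers v)).Nonempty := by
      rw [Set.nonempty_iff_ne_empty]
      intro h
      rw [h, Set.ncard_empty] at h3
      exact absurd h3 (by decide)
    have hne : x ≠ i := fun h => D.i_notMem_of_mem_spread hB (h ▸ hx)
    obtain ⟨q, hq, rfl⟩ := D.exists_smul_eq hne
    have hq1 : q ≠ 1 := by
      rintro rfl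
      rw [one_smul] at hx
      exact D.notMem_of_mem_spread hB hx D.o_mem
    have hc : zpowers v ≤ centralizer (zpowers q : Set G) := by
      rw [le_centralizer_iff, zpowers_le, mem_centralizer_coe_iff]
      intro a ha
      have h4 := hx' a ha
      rw [D.smul_smul_eq (hvK ha)] at h4
      exact mul_inv_eq_iff_eq_mul.1 (D.smul_inj (D.conj_mem (hvK ha).1 hq) hq h4)
    have hq73 : 73 ∣ Nat.card (zpowers q) := by
      have h5 : Nat.card (zpowers q) ∣ 73 ^ 3 := by
        rw [← D.card_Q]
        exact card_dvd_of_le (by rwa [zpowers_le])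
      obtain ⟨k, -, hk⟩ := (Nat.dvd_prime_pow (by norm_num)).1 h5
      rw [hk]
      refine dvd_pow_self 73 ?_
      rintro rfl
      rw [pow_zero, Nat.card_zpowers, orderOf_eq_one_iff] at hk
      exact hq1 hk
    obtain ⟨g, hg⟩ := exists_orderOf_mul (p := 3) (by norm_num) (by rw [hcard]) hq73 hc
    exact D.not_three g hg
  rw [h2, Set.ncard_empty] at h1
  exact (Nat.modEq_zero_iff_dvd.1 h1.symm)

theorem exists_mem_spread_and_ncard :
    (∀ y ∉ fixSet Ω W, ∃ B ∈ spread Ω W, y ∈ B) ∧ (spread Ω W).ncard = 5256 := by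
  classical
  have := Fintype.ofFinite Ω
  have h1 : ((spread Ω W).toFinset.biUnion fun B => B.toFinset).card =
      (spread Ω W).ncard * 74 := by
    rw [Finset.card_biUnion, Finset.sum_congr rfl (g := fun _ => 74), Finset.sum_const,
      smul_eq_mul, ← Set.ncard_eq_toFinset_card']
    · intro B hB
      rw [Set.mem_toFinset] at hB
      rw [← Set.ncard_eq_toFinset_card', D.ncard_block hB.1]
    · intro B hB C hC hne
      rw [Finset.mem_coe, Set.mem_toFinset] at hB hC
      rw [Function.onFun, Set.disjoint_toFinset, Set.disjoint_left]
      exact fun x hx hx' => hne (D.eq_of_mem_spread hB hC hx hx')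
  have h2 : ((spread Ω W).toFinset.biUnion fun B => B.toFinset) ⊆ ((fixSet Ω W)ᶜ).toFinset := by
    intro x hx
    simp only [Finset.mem_biUnion, Set.mem_toFinset] at hx
    obtain ⟨B, hB, hx⟩ := hx
    rw [Set.mem_toFinset]
    exact D.notMem_of_mem_spread hB hx
  have h3 : (((fixSet Ω W)ᶜ).toFinset).card = 5256 * 74 := by
    have := Set.ncard_add_ncard_compl (fixSet Ω W)
    rw [D.ncard_fixSet, D.card_points] at this
    rw [← Set.ncard_eq_toFinset_card']
    omega
  have h4 := Finset.card_le_card h2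
  rw [h1, h3] at h4
  have h5 := D.ncard_spread_modEq
  have h6 := D.center_dvd_ncard_spread
  have h7 := D.three_dvd_ncard_spread
  have h8 : (spread Ω W).ncard = 5256 := by omega
  refine ⟨fun y hy => ?_, h8⟩
  have h9 := Finset.eq_of_subset_of_card_le h2 (by rw [h1, h3, h8])
  have : y ∈ ((fixSet Ω W)ᶜ).toFinset := by rwa [Set.mem_toFinset]
  rw [← h9] at this
  simpa using this

theorem mem_centralizer_of_invariant {B : Set Ω} (hB : B ∈ blocks Ω W) (hi : i ∉ B) {q : G}
    (hq : q ∈ Q) (h : ∀ w ∈ W, w • B = B) (h' : ∀ w ∈ W, w • q⁻¹ • B = q⁻¹ • B) :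
    q ∈ centralizer (W : Set G) := by
  rw [mem_centralizer_coe_iff]
  intro w hw
  have hc : w * q * w⁻¹ * q⁻¹ ∈ Q :=
    Q.mul_mem (D.conj_mem (D.W_le hw).1 hq) (Q.inv_mem hq)
  have hcB : (w * q * w⁻¹ * q⁻¹) • B = B := by
    rw [mul_smul, mul_smul, mul_smul, h' _ (inv_mem hw), smul_inv_smul, h w hw]
  have hle : zpowers (w * q * w⁻¹ * q⁻¹) ≤ Q := by rwa [zpowers_le]
  have hp : IsPGroup 73 (zpowers (w * q * w⁻¹ * q⁻¹)) :=
    (IsPGroup.of_card (n := 3) D.card_Q).to_le hle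
  have hst : zpowers (w * q * w⁻¹ * q⁻¹) ≤ stabilizer G B := by rwa [zpowers_le]
  have h3 := ncard_inter_fixSet_modEq hp B (fun z hz x hx => by
    rw [← show z • B = B from hst hz]; exact Set.smul_mem_smul_set hx)
  rw [D.ncard_block hB] at h3
  obtain ⟨x, hx, hx'⟩ : (B ∩ fixSet Ω (zpowers (w * q * w⁻¹ * q⁻¹))).Nonempty := by
    rw [Set.nonempty_iff_ne_empty]
    intro h
    rw [h, Set.ncard_empty] at h3
    exact absurd h3 (by decide)
  have hne : x ≠ i := fun h => hi (h ▸ hx)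
  have h4 := D.free _ hc x hne (hx' _ (mem_zpowers _))
  rwa [mul_inv_eq_one, mul_inv_eq_iff_eq_mul] at h4

theorem mem_centralizer_of_smul_eq {B C : Set Ω} (hB : B ∈ spread Ω W) (hC : C ∈ spread Ω W)
    {q : G} (hq : q ∈ Q) (h : q • B = C) : q ∈ centralizer (W : Set G) := by
  refine D.mem_centralizer_of_invariant hC.1 (D.i_notMem_of_mem_spread hC) hq hC.2.1 ?_
  rw [← h, inv_smul_smul]
  exact hB.2.1

theorem exists_eq_smul_of_notMem {B : Set Ω} (hB : B ∈ blocks Ω W) (hi : i ∉ B) :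
    ∃ q ∈ Q, ∃ C ∈ spread Ω W, B = q • C := by
  classical
  have := Fintype.ofFinite Ω
  have := Fintype.ofFinite G
  let S : Finset (G × Set Ω) := (Q : Set G).toFinset ×ˢ (spread Ω W).toFinset
  let f : G × Set Ω → Set Ω := fun p => p.1 • p.2
  have hS : S.card = 73 ^ 3 * 5256 := by
    rw [Finset.card_product, ← Set.ncard_eq_toFinset_card', ← Set.ncard_eq_toFinset_card',
      D.exists_mem_spread_and_ncard.2, ← Nat.card_coe_set_eq]
    exact congrArg (· * 5256) D.card_Q
  have hsub : S.image f ⊆ ({B ∈ blocks Ω W | i ∉ B} : Set (Set Ω)).toFinset := by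
    intro C hC
    obtain ⟨⟨q, E⟩, hq, rfl⟩ := Finset.mem_image.1 hC
    rw [Finset.mem_product, Set.mem_toFinset, Set.mem_toFinset] at hq
    rw [Set.mem_toFinset]
    refine ⟨smul_mem_blocks q hq.2.1, fun h => D.i_notMem_of_mem_spread hq.2 ?_⟩
    have h : i ∈ q • E := h
    rwa [Set.mem_smul_set_iff_inv_smul_mem, D.smul_eq_i (Q.inv_mem hq.1)] at h
  have hle : S.card ≤ 73 * (S.image f).card := by
    refine Finset.card_le_mul_card_image S 73 fun C hC => ?_
    obtain ⟨⟨q, E⟩, hq, rfl⟩ := Finset.mem_image.1 hC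
    rw [Finset.mem_product, Set.mem_toFinset, Set.mem_toFinset] at hq
    have h1 : ((Q ⊓ centralizer (W : Set G) : Subgroup G) : Set G).toFinset.card = 73 := by
      rw [← Set.ncard_eq_toFinset_card', ← Nat.card_coe_set_eq]
      exact D.card_Z
    rw [← h1]
    refine Finset.card_le_card_of_injOn (fun p => q⁻¹ * p.1) ?_ ?_
    · rintro ⟨r, F⟩ hr
      rw [Finset.mem_coe, Finset.mem_filter, Finset.mem_product, Set.mem_toFinset,
        Set.mem_toFinset] at hr
      rw [Finset.mem_coe, Set.mem_toFinset]
      have hmem : q⁻¹ * r ∈ Q := Q.mul_mem (Q.inv_mem hq.1) hr.1.1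
      refine ⟨hmem, D.mem_centralizer_of_smul_eq hr.1.2 hq.2 hmem ?_⟩
      have h3 : r • F = q • E := hr.2
      rw [mul_smul, h3, inv_smul_smul]
    · rintro ⟨r, F⟩ hr ⟨s, F'⟩ hs h
      rw [Finset.mem_coe, Finset.mem_filter] at hr hs
      have hrs : r = s := mul_left_cancel h
      subst hrs
      have h3 : r • F = r • F' := (show r • F = q • E from hr.2).trans hs.2.symm
      rw [smul_left_cancel _ h3]
  have hcard : (({B ∈ blocks Ω W | i ∉ B} : Set (Set Ω)).toFinset).card = 5256 * 5329 := by
    rw [← Set.ncard_eq_toFinset_card', D.ncard_blocks_missing]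
  have heq := Finset.eq_of_subset_of_card_le hsub (by rw [hcard]; omega)
  have hmem : B ∈ ({B ∈ blocks Ω W | i ∉ B} : Set (Set Ω)).toFinset := by
    rw [Set.mem_toFinset]; exact ⟨hB, hi⟩
  rw [← heq] at hmem
  obtain ⟨⟨q, E⟩, hq, rfl⟩ := Finset.mem_image.1 hmem
  rw [Finset.mem_product, Set.mem_toFinset, Set.mem_toFinset] at hq
  exact ⟨q, hq.1, E, hq.2, rfl⟩

end PointData

namespace PointData

variable {G Ω : Type*} [Group G] [MulAction G Ω] [Finite G] [Finite Ω]
  {Q W : Subgroup G} {i o : Ω} (D : PointData G Q W i o)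

include D

theorem exists_spread_smul {x : G} (hx : x ∈ Q) (hx' : x ∉ centralizer (W : Set G)) :
    ∃ B ∈ spread Ω W, x • o ∈ B :=
  D.exists_mem_spread_and_ncard.1 _ (fun h => hx' ((D.mem_fixSet hx).1 h))

theorem conj_smul_mem {B : Set Ω} (hB : B ∈ spread Ω W) {x w : G} (hw : w ∈ W)
    (hxB : x • o ∈ B) : (w * x * w⁻¹) • o ∈ B := by
  rw [← D.smul_smul_eq (D.W_le hw), ← hB.2.1 w hw]
  exact Set.smul_mem_smul_set hxB

theorem exists_notMem : ∃ x ∈ Q, x ∉ centralizer (W : Set G) := by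
  by_contra! h
  have h1 : Q ⊓ centralizer (W : Set G) = Q := inf_eq_left.2 h
  have h2 := D.card_Z
  rw [h1, D.card_Q] at h2
  norm_num at h2

theorem mem_centralizer_of_commute {w q : G} (hw : w ∈ W) (h1 : w ≠ 1) (h : w * q = q * w) :
    q ∈ centralizer (W : Set G) := by
  have : Fact (Nat.Prime 37) := ⟨by norm_num⟩
  rw [← zpowers_eq_of_card D.card_W hw h1, mem_centralizer_coe_iff]
  rintro _ ⟨n, rfl⟩
  exact (show Commute w q from h).zpow_left n

/-- The group `Q` is not commutative. -/
theorem exists_not_commute : ∃ a ∈ Q, ∃ b ∈ Q, a * b ≠ b * a := by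
  by_contra! hab
  obtain ⟨x, hx, hx'⟩ := D.exists_notMem
  obtain ⟨w, hw, hwx⟩ : ∃ w ∈ W, w * x ≠ x * w := by
    by_contra! h
    exact hx' (mem_centralizer_coe_iff.2 h)
  have hw37 : w ^ 37 = 1 := by
    have := pow_card_mem hw
    rwa [D.card_W] at this
  have hwQ : ∀ n : ℕ, ∀ q ∈ Q, w ^ n * q * (w ^ n)⁻¹ ∈ Q := fun n q hq =>
    D.conj_mem (pow_mem (D.W_le hw).1 n) hq
  obtain ⟨y, hy, hyx⟩ : ∃ y ∈ Q, w ^ 2 * y * (w ^ 2)⁻¹ * x = y * (w ^ 38 * x * (w ^ 38)⁻¹) := by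
    have key : ∀ n : ℕ, ∃ y ∈ Q,
        w ^ 2 * y * (w ^ 2)⁻¹ * x = y * (w ^ (2 * n) * x * (w ^ (2 * n))⁻¹) := by
      intro n
      induction n with
      | zero => exact ⟨1, Q.one_mem, by simp⟩
      | succ n ih =>
        obtain ⟨y, hy, h⟩ := ih
        have h1 := hwQ (2 * n) x hx
        have h2 := hwQ (2 * (n + 1)) x hx
        refine ⟨y * (w ^ (2 * n) * x * (w ^ (2 * n))⁻¹), Q.mul_mem hy h1, ?_⟩
        have e1 : w ^ 2 * (y * (w ^ (2 * n) * x * (w ^ (2 * n))⁻¹)) * (w ^ 2)⁻¹ =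
            (w ^ 2 * y * (w ^ 2)⁻¹) * (w ^ (2 * (n + 1)) * x * (w ^ (2 * (n + 1)))⁻¹) := by
          rw [show 2 * (n + 1) = 2 + 2 * n by ring, pow_add]; group
        rw [e1, mul_assoc, hab _ h2 x hx, ← mul_assoc, h]
    exact key 19
  have hw38 : w ^ 38 = w := by rw [pow_succ, hw37, one_mul]
  rw [hw38] at hyx
  set c := w * x * w⁻¹ with hc
  set c2 := w ^ 2 * y * (w ^ 2)⁻¹ with hc2
  have hcQ : c ∈ Q := D.conj_mem (D.W_le hw).1 hx
  have hc2Q : c2 ∈ Q := hwQ 2 y hy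
  have hcx : c ≠ x := fun h => hwx (mul_inv_eq_iff_eq_mul.1 h)
  have hd : y⁻¹ * c2 = x⁻¹ * c := by
    rw [inv_mul_eq_iff_eq_mul, ← mul_assoc, hab y hy _ (Q.inv_mem hx), mul_assoc, ← hyx,
      hab c2 hc2Q x hx, inv_mul_cancel_left]
  have hy' : y ∉ centralizer (W : Set G) := by
    intro h
    have : c2 = y := by
      rw [hc2, mem_centralizer_coe_iff.1 h _ (W.pow_mem hw 2), mul_inv_cancel_right]
    rw [this, inv_mul_cancel] at hd
    exact hcx (inv_mul_eq_one.1 hd.symm).symm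
  obtain ⟨B, hB, hxB⟩ := D.exists_spread_smul hx hx'
  obtain ⟨C, hC, hyC⟩ := D.exists_spread_smul hy hy'
  have hBC : x⁻¹ • B = y⁻¹ • C := by
    refine D.block_ext (smul_mem_blocks _ hB.1) (smul_mem_blocks _ hC.1)
      (x := o) (y := (x⁻¹ * c) • o) ?_ ?_ ?_ ?_ ?_
    · intro h
      have := D.smul_inj (Q.one_mem) (Q.mul_mem (Q.inv_mem hx) hcQ) ((one_smul G o).trans h)
      exact hcx (inv_mul_eq_one.1 this.symm).symm
    · rwa [Set.mem_smul_set_iff_inv_smul_mem, inv_inv]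
    · rw [mul_smul]; exact Set.smul_mem_smul_set (D.conj_smul_mem hB hw hxB)
    · rwa [Set.mem_smul_set_iff_inv_smul_mem, inv_inv]
    · rw [← hd, mul_smul]; exact Set.smul_mem_smul_set (D.conj_smul_mem hC (W.pow_mem hw 2) hyC)
  have hZ := D.mem_centralizer_of_smul_eq hB hC (q := y * x⁻¹) (Q.mul_mem hy (Q.inv_mem hx)) (by
    rw [mul_smul, hBC, smul_inv_smul])
  rw [mem_centralizer_coe_iff] at hZ
  have h1 : c2 = y * x⁻¹ * (w ^ 2 * x * (w ^ 2)⁻¹) := by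
    have := hZ _ (W.pow_mem hw 2)
    calc c2 = w ^ 2 * (y * x⁻¹) * x * (w ^ 2)⁻¹ := by rw [hc2]; group
      _ = y * x⁻¹ * (w ^ 2 * x * (w ^ 2)⁻¹) := by rw [this]; group
  rw [h1] at hd
  have h2 : w * x * w⁻¹ = w * c * w⁻¹ := by
    calc w * x * w⁻¹ = x * (x⁻¹ * c) := by rw [mul_inv_cancel_left]
      _ = x * (y⁻¹ * (y * x⁻¹ * (w ^ 2 * x * (w ^ 2)⁻¹))) := by rw [hd]
      _ = w * c * w⁻¹ := by
        rw [hc, pow_two]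
        simp only [mul_assoc, mul_inv_rev, inv_mul_cancel_left, mul_inv_cancel_left]
  exact hcx (mul_left_cancel (mul_right_cancel h2)).symm

theorem isPGroup_Q : IsPGroup 73 Q := IsPGroup.of_card D.card_Q

theorem card_inf_centralizer {s a : G} (ha : a ∈ Q) (hsa : a * s ≠ s * a)
    (A : Subgroup G) (hA : A ≤ Q ⊓ centralizer ({s} : Set G)) : Nat.card A ∣ 73 ^ 2 := by
  refine (card_dvd_of_le hA).trans ?_
  have h1 : Nat.card (Q ⊓ centralizer ({s} : Set G) : Subgroup G) ∣ 73 ^ 3 := by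
    rw [← D.card_Q]; exact card_dvd_of_le inf_le_left
  obtain ⟨k, hk, h2⟩ := (Nat.dvd_prime_pow (by norm_num)).1 h1
  rw [h2]
  refine pow_dvd_pow _ ?_
  by_contra h
  have : k = 3 := by omega
  subst this
  have h3 := eq_of_le_of_card_ge (inf_le_left : Q ⊓ centralizer ({s} : Set G) ≤ Q)
    (by rw [h2, D.card_Q])
  rw [← h3] at ha
  exact hsa (mem_centralizer_singleton_iff.1 ha.2)

theorem centralizer_eq : Q ⊓ centralizer (Q : Set G) = Q ⊓ centralizer (W : Set G) := by
  have hQ : Nat.card (Q ⊓ centralizer (Q : Set G) : Subgroup G) ≡ Nat.card Q [MOD 73] :=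
    card_inf_centralizer_modEq D.isPGroup_Q le_normalizer
  have h1 : Nat.card (Q ⊓ centralizer (Q : Set G) : Subgroup G) ∣ 73 ^ 3 := by
    rw [← D.card_Q]; exact card_dvd_of_le inf_le_left
  obtain ⟨k, hk, h2⟩ := (Nat.dvd_prime_pow (by norm_num)).1 h1
  obtain ⟨a, ha, b, hb, hab⟩ := D.exists_not_commute
  have hle : Q ⊓ centralizer (Q : Set G) < Q ⊓ centralizer ({b} : Set G) := by
    refine lt_of_le_of_ne (inf_le_inf_left _ (centralizer_le (by simpa using hb))) fun h => ?_
    have : b ∈ Q ⊓ centralizer (Q : Set G) := h ▸ ⟨hb, mem_centralizer_singleton_iff.2 rfl⟩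
    exact hab (mem_centralizer_coe_iff.1 this.2 a ha)
  have h3 : Nat.card (Q ⊓ centralizer (Q : Set G) : Subgroup G) = 73 := by
    rw [D.card_Q, h2, Nat.ModEq] at hQ
    have h4 := Nat.le_of_dvd (by norm_num) (D.card_inf_centralizer ha hab _ le_rfl)
    have h5 := Set.ncard_lt_ncard (SetLike.coe_ssubset_coe.2 hle) (Set.toFinite _)
    have h6 : Nat.card (Q ⊓ centralizer (Q : Set G) : Subgroup G) <
      Nat.card (Q ⊓ centralizer ({b} : Set G) : Subgroup G) := h5
    rw [h2] at h6 ⊢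
    have : k = 0 ∨ k = 1 ∨ k = 2 ∨ k = 3 := by omega
    rcases this with rfl | rfl | rfl | rfl <;> norm_num at * <;> omega
  refine eq_of_le_of_card_ge (le_inf inf_le_left ?_) (by rw [h3, D.card_Z])
  refine le_centralizer_of_card_73 D.isPGroup_W h3 fun w hw => ?_
  have h7 := D.stabilizer_le (D.W_le hw).1
  refine normalizer_inf_le _ _ ⟨h7, ?_⟩
  exact normalizer_le_normalizer_centralizer _ h7

/-- The elements of `Q` commuting with `W` commute with `Q`. -/
theorem mul_comm_of_mem {ζ q : G} (hζ : ζ ∈ Q ⊓ centralizer (W : Set G)) (hq : q ∈ Q) :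
    q * ζ = ζ * q := by
  rw [← D.centralizer_eq] at hζ
  exact mem_centralizer_coe_iff.1 hζ.2 q hq

theorem exists_not_commute_of_notMem {s : G} (hs : s ∈ Q) (hs' : s ∉ centralizer (W : Set G)) :
    ∃ a ∈ Q, a * s ≠ s * a := by
  by_contra! h
  have : s ∈ Q ⊓ centralizer (Q : Set G) := ⟨hs, mem_centralizer_coe_iff.2 h⟩
  rw [D.centralizer_eq] at this
  exact hs' this.2

theorem commutator_mem {x y : G} (hx : x ∈ Q) (hy : y ∈ Q) :
    x * y * x⁻¹ * y⁻¹ ∈ Q ⊓ centralizer (W : Set G) := by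
  refine commutator_mem_of_card (p := 73) inf_le_left ?_ (by rw [D.card_Q, D.card_Z]; norm_num) hx hy
  rw [← D.centralizer_eq]
  intro q hq
  exact normalizer_inf_le _ _ ⟨le_normalizer hq, normalizer_le_normalizer_centralizer _
    (le_normalizer hq)⟩

/-- In `Q` the centralizer of `s` outside the centre is generated by `s` and the centre. -/
theorem le_of_mem {s : G} (hs : s ∈ Q) (hs' : s ∉ centralizer (W : Set G)) {A : Subgroup G}
    (hA : Q ⊓ centralizer (W : Set G) ≤ A) (hsA : s ∈ A) {u : G} (hu : u ∈ Q)
    (h : u * s = s * u) : u ∈ A := by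
  obtain ⟨a, ha, has⟩ := D.exists_not_commute_of_notMem hs hs'
  have h1 := D.card_inf_centralizer ha has _ le_rfl
  have hle : Q ⊓ centralizer (W : Set G) ≤ A ⊓ (Q ⊓ centralizer ({s} : Set G)) := by
    refine le_inf hA (le_inf inf_le_left fun ζ hζ => ?_)
    exact mem_centralizer_singleton_iff.2 (D.mul_comm_of_mem hζ hs).symm
  have h2 : Nat.card (A ⊓ (Q ⊓ centralizer ({s} : Set G)) : Subgroup G) ∣ 73 ^ 2 :=
    D.card_inf_centralizer ha has _ inf_le_right
  have h3 : Nat.card (Q ⊓ centralizer (W : Set G) : Subgroup G) <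
      Nat.card (A ⊓ (Q ⊓ centralizer ({s} : Set G)) : Subgroup G) := by
    refine Set.ncard_lt_ncard (SetLike.coe_ssubset_coe.2 (lt_of_le_of_ne hle fun h => ?_))
      (Set.toFinite _)
    have : s ∈ A ⊓ (Q ⊓ centralizer ({s} : Set G)) :=
      ⟨hsA, hs, mem_centralizer_singleton_iff.2 rfl⟩
    rw [← h] at this
    exact hs' this.2
  rw [D.card_Z] at h3
  have h4 : Nat.card (A ⊓ (Q ⊓ centralizer ({s} : Set G)) : Subgroup G) = 73 ^ 2 := by
    obtain ⟨k, hk, h5⟩ := (Nat.dvd_prime_pow (by norm_num)).1 h2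
    rw [h5] at h3 ⊢
    have : k = 0 ∨ k = 1 ∨ k = 2 := by omega
    rcases this with rfl | rfl | rfl <;> first | rfl | norm_num at h3
  have h5 := eq_of_le_of_card_ge (inf_le_right : A ⊓ (Q ⊓ centralizer ({s} : Set G)) ≤ _)
    (by rw [h4]; exact Nat.le_of_dvd (by norm_num) h1)
  have h6 : u ∈ Q ⊓ centralizer ({s} : Set G) := ⟨hu, mem_centralizer_singleton_iff.2 h⟩
  rw [← h5] at h6
  exact h6.1

end PointData

namespace PointData

variable {G Ω : Type*} [Group G] [MulAction G Ω] [Finite G] [Finite Ω]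
  {Q W : Subgroup G} {i o : Ω} (D : PointData G Q W i o)

include D

theorem eq_one_of_commute {g : G} (hg : g ∈ stabilizer G i ⊓ stabilizer G o)
    (h : ∀ x ∈ Q, g * x * g⁻¹ = x) : g = 1 := by
  refine D.faithful g fun y => ?_
  by_cases hy : y = i
  · rw [hy]; exact hg.1
  · obtain ⟨q, hq, rfl⟩ := D.exists_smul_eq hy
    rw [D.smul_smul_eq hg, h q hq]

theorem eq_one_of_eq_inv {u : G} (hu : u ∈ Q) (h : u = u⁻¹) : u = 1 := by
  have h1 : orderOf u ∣ 73 ^ 3 := by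
    rw [← D.card_Q]; exact orderOf_dvd_of_pow_eq_one (pow_card_mem hu)
  have h2 : orderOf u ∣ 2 := orderOf_dvd_of_pow_eq_one (by
    rw [pow_two]; nth_rw 2 [h]; exact mul_inv_cancel u)
  rw [← orderOf_eq_one_iff]
  exact Nat.eq_one_of_dvd_coprimes (by norm_num) h1 h2

theorem exists_involution : ∃ z ∈ stabilizer G i ⊓ stabilizer G o ⊓
    centralizer ((Q ⊓ centralizer (W : Set G) : Subgroup G) : Set G), orderOf z = 2 := by
  have : Fact (Nat.Prime 2) := ⟨Nat.prime_two⟩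
  refine exists_mem_orderOf ?_
  set Z := Q ⊓ centralizer (W : Set G) with hZ
  set K := stabilizer G i ⊓ stabilizer G o with hK
  have hKZ : K ≤ normalizer (Z : Set G) := fun k hk => normalizer_inf_le _ _
    ⟨D.stabilizer_le hk.1, normalizer_le_normalizer_centralizer _ (D.K_le hk)⟩
  have h1 : (centralizer (Z : Set G)).relIndex K ∣ 72 := by
    rw [← relIndex_subgroupOf hKZ]
    exact (relIndex_dvd_index_of_normal _ _).trans (relIndex_centralizer_dvd D.card_Z)
  have h2 := relIndex_mul_card (inf_le_left : K ⊓ centralizer (Z : Set G) ≤ K)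
  rw [inf_relIndex_left, D.card_K] at h2
  obtain ⟨k, hk⟩ := h1
  have hpos : 0 < (centralizer (Z : Set G)).relIndex K :=
    Nat.pos_of_ne_zero (fun h => by rw [h] at hk; omega)
  have h3 : Nat.card (K ⊓ centralizer (Z : Set G) : Subgroup G) = k * 74 := by
    refine Nat.eq_of_mul_eq_mul_left hpos ?_
    rw [h2, ← mul_assoc, ← hk]
  rw [h3]
  omega

theorem eq_one_of_conj_mul_mem {g : G} (hg : g ∈ stabilizer G i ⊓ stabilizer G o)
    (hgZ : g ∈ centralizer ((Q ⊓ centralizer (W : Set G) : Subgroup G) : Set G))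
    (h : ∀ x ∈ Q, g * x * g⁻¹ * x⁻¹ ∈ Q ⊓ centralizer (W : Set G)) : g = 1 := by
  rw [mem_centralizer_coe_iff] at hgZ
  have h1 : g ^ 73 = 1 := by
    refine D.eq_one_of_commute (pow_mem hg 73) fun x hx => ?_
    have hb := h x hx
    have h2 := conj_pow_apply (x := g) (a := x) (b := g * x * g⁻¹ * x⁻¹)
      (by rw [MulAut.conj_apply, inv_mul_cancel_right])
      (by rw [MulAut.conj_apply, ← hgZ _ hb, mul_inv_cancel_right]) 73
    have h3 := pow_card_mem hb
    rw [D.card_Z] at h3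
    rwa [h3, one_mul] at h2
  have h2 : orderOf g ∣ 73 := orderOf_dvd_of_pow_eq_one h1
  have h3 : orderOf g ∣ 72 * 74 := by
    rw [← D.card_K, ← Nat.card_zpowers]
    exact card_dvd_of_le (by rwa [zpowers_le])
  rw [← orderOf_eq_one_iff]
  exact Nat.eq_one_of_dvd_coprimes (by norm_num) h2 h3

section Involution

variable {z : G} (hz : z ∈ stabilizer G i ⊓ stabilizer G o)
  (hzZ : z ∈ centralizer ((Q ⊓ centralizer (W : Set G) : Subgroup G) : Set G))
  (hz2 : z * z = 1) (hz1 : z ≠ 1)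

include hz hzZ hz2

theorem conj_conj (x : G) : z * (z * x * z⁻¹) * z⁻¹ = x := by
  have : z⁻¹ = z := inv_eq_of_mul_eq_one_left hz2
  rw [this]
  calc z * (z * x * z) * z = (z * z) * x * (z * z) := by simp only [mul_assoc]
    _ = x := by rw [hz2, one_mul, mul_one]

theorem involution_commute {x : G} (hx : x ∈ Q) :
    x * (z * x * z⁻¹) = z * x * z⁻¹ * x := by
  have hc := D.commutator_mem hx (D.conj_mem hz.1 hx)
  refine mul_comm_of_commutator_sq ?_ ?_
  · have := pow_card_mem hc
    rwa [D.card_Z] at this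
  · have h1 := mem_centralizer_coe_iff.1 hzZ _ hc
    have h2 := D.conj_conj hz hzZ hz2 x
    rw [eq_comm, ← mul_inv_eq_iff_eq_mul] at h1
    set b := z * x * z⁻¹ with hb
    have h3 : z * (x * b * x⁻¹ * b⁻¹) * z⁻¹ = b * x * b⁻¹ * x⁻¹ := by
      rw [← MulAut.conj_apply, map_mul, map_mul, map_mul, map_inv, map_inv, MulAut.conj_apply,
        MulAut.conj_apply, h2]
    calc (x * b * x⁻¹ * b⁻¹)⁻¹ = b * x * b⁻¹ * x⁻¹ := by group
      _ = x * b * x⁻¹ * b⁻¹ := by rw [← h3, h1]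

theorem mul_conj_fixed {x : G} (hx : x ∈ Q) :
    z * (x * (z * x * z⁻¹)) * z⁻¹ = x * (z * x * z⁻¹) := by
  rw [← MulAut.conj_apply, map_mul, MulAut.conj_apply, MulAut.conj_apply,
    D.conj_conj hz hzZ hz2, D.involution_commute hz hzZ hz2 hx]

include hz1

theorem mem_centralizer_of_commute_involution {s : G} (hs : s ∈ Q) (hsz : z * s * z⁻¹ = s) :
    s ∈ centralizer (W : Set G) := by
  by_contra hs'
  refine hz1 (D.eq_one_of_commute hz fun x hx => ?_)
  set b := z * x * z⁻¹ with hb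
  have hbQ : b ∈ Q := D.conj_mem hz.1 hx
  have hxb : x * b = b * x := D.involution_commute hz hzZ hz2 hx
  set u := x * b⁻¹ with hu
  have huQ : u ∈ Q := Q.mul_mem hx (Q.inv_mem hbQ)
  have hzu : MulAut.conj z u = u⁻¹ := by
    rw [hu, map_mul, map_inv, MulAut.conj_apply, MulAut.conj_apply, ← hb, hb,
      D.conj_conj hz hzZ hz2, ← hb, mul_inv_rev, inv_inv]
  have hc := D.commutator_mem huQ hs
  have hus : u * s = s * u := by
    refine mul_comm_of_commutator_sq ?_ ?_
    · have := pow_card_mem hc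
      rwa [D.card_Z] at this
    · have h1 := mem_centralizer_coe_iff.1 hzZ _ hc
      rw [eq_comm, ← mul_inv_eq_iff_eq_mul, ← MulAut.conj_apply, map_mul, map_mul, map_mul,
        map_inv, map_inv, hzu, MulAut.conj_apply, hsz, inv_inv] at h1
      have h2 := D.mul_comm_of_mem hc huQ
      calc (u * s * u⁻¹ * s⁻¹)⁻¹ = u * (u⁻¹ * s * u * s⁻¹) * u⁻¹ := by group
        _ = u * s * u⁻¹ * s⁻¹ := by rw [h1, h2, mul_inv_cancel_right]
  have h1 := D.le_of_mem hs hs' (A := centralizer ({z} : Set G) ) (u := u) ?_ ?_ huQ hus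
  · rw [mem_centralizer_singleton_iff] at h1
    rw [MulAut.conj_apply, ← h1, mul_inv_cancel_right] at hzu
    have := D.eq_one_of_eq_inv huQ hzu
    exact (mul_inv_eq_one.1 this).symm
  · intro ζ hζ
    rw [mem_centralizer_singleton_iff]
    exact (mem_centralizer_coe_iff.1 hzZ ζ hζ)
  · rw [mem_centralizer_singleton_iff]
    exact (mul_inv_eq_iff_eq_mul.1 hsz).symm

theorem conj_mul_mem {x : G} (hx : x ∈ Q) : z * x * z⁻¹ * x ∈ Q ⊓ centralizer (W : Set G) := by
  refine ⟨Q.mul_mem (D.conj_mem hz.1 hx) hx, ?_⟩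
  rw [← D.involution_commute hz hzZ hz2 hx]
  exact D.mem_centralizer_of_commute_involution hz hzZ hz2 hz1
    (Q.mul_mem hx (D.conj_mem hz.1 hx)) (D.mul_conj_fixed hz hzZ hz2 hx)

theorem involution_unique {y : G} (hy : y ∈ stabilizer G i ⊓ stabilizer G o)
    (hyZ : y ∈ centralizer ((Q ⊓ centralizer (W : Set G) : Subgroup G) : Set G))
    (hy2 : y * y = 1) (hy1 : y ≠ 1) : y = z := by
  have h := D.eq_one_of_conj_mul_mem (g := z * y) (mul_mem hz hy) (mul_mem hzZ hyZ) fun x hx => by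
    have h1 := D.conj_mul_mem hy hyZ hy2 hy1 hx
    have h2 := D.conj_mul_mem hz hzZ hz2 hz1 (D.conj_mem hy.1 hx)
    have h3 : z * y * x * (z * y)⁻¹ * x⁻¹ =
        (z * (y * x * y⁻¹) * z⁻¹ * (y * x * y⁻¹)) * (x * (y * x * y⁻¹))⁻¹ := by group
    rw [h3, D.involution_commute hy hyZ hy2 hx]
    exact mul_mem h2 (inv_mem h1)
  exact (mul_left_cancel (a := z) (h.trans hz2.symm))

end Involution

end PointData

namespace PointData

variable {G Ω : Type*} [Group G] [MulAction G Ω] [Finite G] [Finite Ω]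
  {Q W : Subgroup G} {i o : Ω} (D : PointData G Q W i o)

include D

theorem forall_fixSet_iff {g : G} : (∀ x ∈ fixSet Ω W, g • x = x) ↔
    g ∈ stabilizer G i ⊓ stabilizer G o ∧
      g ∈ centralizer ((Q ⊓ centralizer (W : Set G) : Subgroup G) : Set G) := by
  constructor
  · intro h
    have hg : g ∈ stabilizer G i ⊓ stabilizer G o := ⟨h i D.i_mem, h o D.o_mem⟩
    refine ⟨hg, mem_centralizer_coe_iff.2 fun ζ hζ => ?_⟩
    have h1 := h _ ((D.mem_fixSet hζ.1).2 hζ.2)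
    rw [D.smul_smul_eq hg] at h1
    exact (mul_inv_eq_iff_eq_mul.1 (D.smul_inj (D.conj_mem hg.1 hζ.1) hζ.1 h1)).symm
  · rintro ⟨hg, hgZ⟩ x hx
    rw [D.fixSet_eq] at hx
    rcases hx with rfl | ⟨ζ, hζ, rfl⟩
    · exact hg.1
    · change g • ζ • o = ζ • o
      rw [D.smul_smul_eq hg, ← mem_centralizer_coe_iff.1 hgZ ζ hζ, mul_inv_cancel_right]

section Involution

variable {z : G} (hz : z ∈ stabilizer G i ⊓ stabilizer G o)
  (hzZ : z ∈ centralizer ((Q ⊓ centralizer (W : Set G) : Subgroup G) : Set G))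
  (hz2 : z * z = 1) (hz1 : z ≠ 1)

include hz hzZ hz2 hz1

theorem commute_involution {t : G} (ht : t • fixSet Ω W = fixSet Ω W) : t * z = z * t := by
  have h1 : ∀ x ∈ fixSet Ω W, (t * z * t⁻¹) • x = x := by
    intro x hx
    rw [← ht] at hx
    rw [mul_smul, mul_smul, D.forall_fixSet_iff.2 ⟨hz, hzZ⟩ _
      (Set.mem_smul_set_iff_inv_smul_mem.1 hx), smul_inv_smul]
  have h2 := D.forall_fixSet_iff.1 h1
  have h3 := D.involution_unique hz hzZ hz2 hz1 h2.1 h2.2 (by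
    rw [show t * z * t⁻¹ * (t * z * t⁻¹) = t * (z * z) * t⁻¹ by group, hz2]; group)
    (fun h => hz1 (by
      rwa [mul_inv_eq_one, mul_eq_left] at h))
  exact mul_inv_eq_iff_eq_mul.1 h3

theorem commute_of_mem {w : G} (hw : w ∈ W) : w * z = z * w :=
  D.commute_involution hz hzZ hz2 hz1 (smul_fixSet_of_mem_normalizer (le_normalizer hw))

theorem involution_smul {B : Set Ω} (hB : B ∈ spread Ω W) : z • B = B := by
  have : Fact (Nat.Prime 37) := ⟨by norm_num⟩
  obtain ⟨⟨g, hg⟩, hinv, -⟩ := id hB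
  have hg : g • fixSet Ω W = B := hg
  set V := MulAut.conj g • W with hV
  have hBV : B = fixSet Ω V := by rw [← hg, smul_fixSet]
  obtain ⟨x, hx, y, hy, hxy⟩ : ∃ x ∈ B, ∃ y ∈ B, x ≠ y := by
    have h1 := D.ncard_block hB.1
    obtain ⟨x, hx⟩ : B.Nonempty := by
      rw [← Set.ncard_pos (Set.toFinite _), h1]; norm_num
    obtain ⟨y, hy, hyx⟩ := Set.exists_ne_of_one_lt_ncard (s := B) (by rw [h1]; norm_num) x
    exact ⟨x, hx, y, hy, hyx.symm⟩
  have hWV : W ≤ normalizer (V : Set G) := by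
    intro w hw
    rw [← smul_eq_of_mem_normalizer, hV, ← mul_smul, ← map_mul]
    have h1 : (w * g) • fixSet Ω W = B := by rw [mul_smul, hg, hinv w hw]
    exact D.conj_smul_eq_conj_smul hxy (by rwa [h1]) (by rwa [h1]) (by rwa [hg]) (by rwa [hg])
  have hcV : Nat.card V = 37 := (card_conj_smul g W).trans D.card_W
  have h2 := card_inf_centralizer_modEq D.isPGroup_W hWV
  have h3 : Nat.card (V ⊓ centralizer (W : Set G) : Subgroup G) = 37 := by
    have h4 := card_inf_dvd V (centralizer (W : Set G))
    rw [hcV] at h2 h4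
    rcases (Nat.dvd_prime (by norm_num)).1 h4 with h5 | h5
    · rw [h5] at h2
      exact absurd h2 (by decide)
    · exact h5
  have h4 : V ≤ centralizer (W : Set G) :=
    inf_eq_left.1 (eq_of_le_of_card_ge inf_le_left (by rw [h3, hcV]))
  rw [hBV]
  refine smul_fixSet_of_mem_normalizer (centralizer_le_normalizer _ ?_)
  rw [mem_centralizer_coe_iff]
  intro t ht
  exact D.commute_involution hz hzZ hz2 hz1
    (smul_fixSet_of_mem_normalizer (centralizer_le_normalizer _ (h4 ht)))

theorem eq_one_of_commute_mem {x v : G} (hx : x ∈ Q) (hx' : x ∉ centralizer (W : Set G))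
    (hv : v ∈ W ∨ z * v ∈ W) (h : v * x * v⁻¹ = x) : v = 1 := by
  rcases hv with hv | hv
  · by_contra h1
    exact hx' (D.mem_centralizer_of_commute hv h1 (mul_inv_eq_iff_eq_mul.1 h))
  · exfalso
    refine hx' (D.mem_centralizer_of_commute_involution hz hzZ hz2 hz1 hx ?_)
    have h1 : v = z * (z * v) := by rw [← mul_assoc, hz2, one_mul]
    have h2 : Commute z (z * v) := (D.commute_of_mem hz hzZ hz2 hz1 hv).symm
    have h3 : (z * v) ^ 37 = 1 := by
      have := pow_card_mem hv
      rwa [D.card_W] at this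
    have h4 : v ^ 37 = z := by
      rw [h1, h2.mul_pow, h3, mul_one, show 37 = 2 * 18 + 1 by norm_num, pow_succ, pow_mul,
        pow_two, hz2, one_pow, one_mul]
    have h5 : Commute v x := mul_inv_eq_iff_eq_mul.1 h
    rw [mul_inv_eq_iff_eq_mul, ← h4]
    exact h5.pow_left 37

theorem spread_eq {B : Set Ω} (hB : B ∈ spread Ω W) {x : G} (hx : x ∈ Q) (hxB : x • o ∈ B) :
    B = {y | ∃ u : G, (u ∈ W ∨ z * u ∈ W) ∧ u • x • o = y} := by
  have hx' : x ∉ centralizer (W : Set G) := fun h =>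
    D.notMem_of_mem_spread hB hxB ((D.mem_fixSet hx).2 h)
  have hzinv : z⁻¹ = z := inv_eq_of_mul_eq_one_left hz2
  have hzW : z ∉ W := by
    intro h
    have h1 := pow_card_mem h
    rw [D.card_W, show 37 = 2 * 18 + 1 by norm_num, pow_succ, pow_mul, pow_two, hz2, one_pow,
      one_mul] at h1
    exact hz1 h1
  let f : W ⊕ W → Ω := Sum.elim (fun w => (w : G) • x • o) (fun w => (z * w) • x • o)
  have hmem : ∀ a, f a ∈ B := by
    rintro (⟨w, hw⟩ | ⟨w, hw⟩)
    · rw [← hB.2.1 w hw]; exact Set.smul_mem_smul_set hxB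
    · change (z * w) • x • o ∈ B
      rw [← D.involution_smul hz hzZ hz2 hz1 hB, mul_smul]
      refine Set.smul_mem_smul_set ?_
      rw [← hB.2.1 w hw]; exact Set.smul_mem_smul_set hxB
  have key : ∀ u v : G, u ∈ stabilizer G i ⊓ stabilizer G o → v ∈ stabilizer G i ⊓ stabilizer G o →
      (u⁻¹ * v ∈ W ∨ z * (u⁻¹ * v) ∈ W) → u • x • o = v • x • o → u = v := by
    intro u v hu hv huv h
    rw [← inv_mul_eq_one]
    refine D.eq_one_of_commute_mem hz hzZ hz2 hz1 hx hx' huv ?_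
    have hm := mul_mem (inv_mem hu) hv
    refine D.smul_inj (D.conj_mem hm.1 hx) hx ?_
    rw [← D.smul_smul_eq hm, mul_smul, ← h, inv_smul_smul]
  have hf : Function.Injective f := by
    rintro (⟨w, hw⟩ | ⟨w, hw⟩) (⟨v, hv⟩ | ⟨v, hv⟩) h
    · have := key w v (D.W_le hw) (D.W_le hv) (Or.inl (W.mul_mem (W.inv_mem hw) hv)) h
      subst this; rfl
    · have h1 := key w (z * v) (D.W_le hw) (mul_mem hz (D.W_le hv)) (Or.inr (by
        rw [← mul_assoc w⁻¹, D.commute_of_mem hz hzZ hz2 hz1 (W.inv_mem hw), mul_assoc, ← mul_assoc,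
          hz2, one_mul]
        exact W.mul_mem (W.inv_mem hw) hv)) h
      exact absurd (mul_inv_eq_iff_eq_mul.2 h1 ▸ W.mul_mem hw (W.inv_mem hv)) hzW
    · have h1 := key (z * w) v (mul_mem hz (D.W_le hw)) (D.W_le hv) (Or.inr (by
        rw [mul_inv_rev, hzinv, D.commute_of_mem hz hzZ hz2 hz1 (W.inv_mem hw), mul_assoc,
          ← mul_assoc, hz2, one_mul]
        exact W.mul_mem (W.inv_mem hw) hv)) h
      exact absurd (eq_mul_inv_of_mul_eq h1 ▸ W.mul_mem hv (W.inv_mem hw)) hzW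
    · have := key (z * w) (z * v) (mul_mem hz (D.W_le hw)) (mul_mem hz (D.W_le hv)) (Or.inl (by
        rw [mul_inv_rev, mul_assoc, inv_mul_cancel_left]
        exact W.mul_mem (W.inv_mem hw) hv)) h
      obtain rfl := mul_left_cancel this
      rfl
  have hr : Set.range f = B := by
    refine Set.eq_of_subset_of_ncard_le (Set.range_subset_iff.2 hmem) ?_ (Set.toFinite _)
    rw [D.ncard_block hB.1, ← Nat.card_coe_set_eq, Nat.card_range_of_injective hf, Nat.card_sum,
      D.card_W]
  rw [← hr]
  ext y
  constructor
  · rintro ⟨⟨w, hw⟩ | ⟨w, hw⟩, rfl⟩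
    · exact ⟨w, Or.inl hw, rfl⟩
    · exact ⟨z * w, Or.inr (by rwa [← mul_assoc, hz2, one_mul]), rfl⟩
  · rintro ⟨u, hu | hu, rfl⟩
    · exact ⟨Sum.inl ⟨u, hu⟩, rfl⟩
    · refine ⟨Sum.inr ⟨z * u, hu⟩, ?_⟩
      change (z * (z * u)) • x • o = _
      rw [← mul_assoc, hz2, one_mul]

theorem mem_blocks_iff {B : Set Ω} : B ∈ blocks Ω W ↔
    (∃ q ∈ Q, B = q • fixSet Ω W) ∨ ∃ q ∈ Q, ∃ x ∈ Q, x ∉ centralizer (W : Set G) ∧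
      B = {y | ∃ u : G, (u ∈ W ∨ z * u ∈ W) ∧ q • u • x • o = y} := by
  have hset : ∀ q x : G, q • {y | ∃ u : G, (u ∈ W ∨ z * u ∈ W) ∧ u • x • o = y} =
      {y | ∃ u : G, (u ∈ W ∨ z * u ∈ W) ∧ q • u • x • o = y} := by
    intro q x
    ext y
    rw [Set.mem_smul_set_iff_inv_smul_mem]
    simp only [Set.mem_ofPred_eq, eq_inv_smul_iff]
  constructor
  · intro hB
    by_cases hi : i ∈ B
    · exact Or.inl (D.eq_smul_fixSet hB hi)
    · obtain ⟨q, hq, C, hC, rfl⟩ := D.exists_eq_smul_of_notMem hB hi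
      obtain ⟨y, hy⟩ : C.Nonempty := by
        rw [← Set.ncard_pos (Set.toFinite _), D.ncard_block hC.1]; norm_num
      obtain ⟨x, hx, rfl⟩ := D.exists_smul_eq (x := y)
        (fun h => D.i_notMem_of_mem_spread hC (h ▸ hy))
      refine Or.inr ⟨q, hq, x, hx, fun h => D.notMem_of_mem_spread hC hy
        ((D.mem_fixSet hx).2 h), ?_⟩
      rw [← hset, ← D.spread_eq hz hzZ hz2 hz1 hC hx hy]
  · rintro (⟨q, -, rfl⟩ | ⟨q, -, x, hx, hx', rfl⟩)
    · exact smul_mem_blocks q fixSet_mem_blocks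
    · obtain ⟨C, hC, hxC⟩ := D.exists_spread_smul hx hx'
      rw [← hset, ← D.spread_eq hz hzZ hz2 hz1 hC hx hxC]
      exact smul_mem_blocks q hC.1

end Involution

end PointData

/-- The coordinate plane. -/
abbrev Plane := Fin 2 → ZMod 73

/-- The standard symplectic form. -/
def symp (a b : Plane) : ZMod 73 := a 0 * b 1 - a 1 * b 0

theorem symp_self (a : Plane) : symp a a = 0 := by simp [symp, mul_comm]

theorem symp_neg_left (a b : Plane) : symp (-a) b = -symp a b := by
  simp only [symp, Pi.neg_apply]; ring

theorem symp_neg_right (a b : Plane) : symp a (-b) = -symp a b := by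
  simp only [symp, Pi.neg_apply]; ring

theorem symp_swap (a b : Plane) : symp b a = -symp a b := by
  simp only [symp]; ring

theorem eq_zero_of_two_mul_eq_zero {b : ZMod 73} (h : 2 * b = 0) : b = 0 :=
  (mul_eq_zero.1 h).resolve_left (by decide)

theorem eq_zero_of_neg_eq {a : Plane} (h : -a = a) : a = 0 := by
  ext j
  have h1 := congrFun h j
  simp only [Pi.neg_apply, Pi.zero_apply] at h1 ⊢
  exact eq_zero_of_two_mul_eq_zero (by linear_combination -h1)

theorem eq_zero_of_symp {a : Plane} (h : ∀ b, symp b a = 0) : a = 0 := by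
  have h0 := h ![1, 0]
  have h1 := h ![0, 1]
  simp [symp] at h0 h1
  ext j
  fin_cases j
  · exact h1
  · exact h0

theorem exists_symp_eq {a : Plane} (ha : a ≠ 0) (d : ZMod 73) : ∃ c, symp c a = d := by
  by_contra! h
  refine ha (eq_zero_of_symp fun b => ?_)
  by_contra hb
  refine h ((d / symp b a) • b) ?_
  have : symp ((d / symp b a) • b) a = d / symp b a * symp b a := by
    simp only [symp, Pi.smul_apply, smul_eq_mul]; ring
  rw [this, div_mul_cancel₀ _ hb]

/-- A linear automorphism scales the symplectic form. -/
theorem exists_symp_map (m : (Plane →ₗ[ZMod 73] Plane)ˣ) :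
    ∃ d : ZMod 73, d ≠ 0 ∧ ∀ a b, symp (m.1 a) (m.1 b) = d * symp a b := by
  have key : ∀ a b, symp (m.1 a) (m.1 b) = symp (m.1 ![1, 0]) (m.1 ![0, 1]) * symp a b := by
    intro a b
    have h : ∀ c : Plane, m.1 c = c 0 • m.1 ![1, 0] + c 1 • m.1 ![0, 1] := by
      intro c
      rw [← map_smul, ← map_smul, ← map_add]
      congr 1
      ext j
      fin_cases j <;> simp
    rw [h a, h b]
    simp only [symp, Pi.add_apply, Pi.smul_apply, smul_eq_mul]
    ring
  refine ⟨_, fun h0 => ?_, key⟩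
  have h1 := key (m⁻¹.1 ![1, 0]) (m⁻¹.1 ![0, 1])
  have h2 : ∀ c, m.1 (m⁻¹.1 c) = c := fun c => by
    rw [← Module.End.mul_apply, ← Units.val_mul, mul_inv_cancel]; rfl
  rw [h2, h2, h0, zero_mul] at h1
  exact absurd h1 (by simp [symp])

section Power

variable {G : Type*} [Group G]

/-- Powers with exponents modulo `73`. -/
def zpw (x : G) (k : ZMod 73) : G := x ^ k.val

theorem zpw_zero (x : G) : zpw x 0 = 1 := by simp [zpw]

theorem zpw_natCast {x : G} (hx : x ^ 73 = 1) (n : ℕ) : zpw x n = x ^ n := by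
  rw [zpw, ZMod.val_natCast, ← pow_eq_pow_mod n hx]

theorem zpw_add {x : G} (hx : x ^ 73 = 1) (j k : ZMod 73) : zpw x (j + k) = zpw x j * zpw x k := by
  rw [zpw, ZMod.val_add, ← pow_eq_pow_mod _ hx, pow_add]; rfl

theorem zpw_neg {x : G} (hx : x ^ 73 = 1) (k : ZMod 73) : zpw x (-k) = (zpw x k)⁻¹ := by
  rw [eq_inv_iff_mul_eq_one, ← zpw_add hx, neg_add_cancel, zpw_zero]

theorem zpw_inv (x : G) (k : ZMod 73) : zpw x⁻¹ k = (zpw x k)⁻¹ := inv_pow _ _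

theorem zpw_conj (z x : G) (k : ZMod 73) : z * zpw x k * z⁻¹ = zpw (z * x * z⁻¹) k :=
  conj_pow.symm

theorem eq_zero_of_zpw_eq_one {x : G} (hx : orderOf x = 73) {k : ZMod 73} (h : zpw x k = 1) :
    k = 0 := by
  have h1 := orderOf_dvd_of_pow_eq_one h
  rw [hx] at h1
  exact (ZMod.val_eq_zero k).1 (Nat.eq_zero_of_dvd_of_lt h1 k.val_lt)

/-- Coordinates on a Heisenberg group. -/
def heis (x y ζ : G) (a : Plane) (b : ZMod 73) : G :=
  zpw x (a 0) * zpw y (a 1) * zpw ζ (b - a 0 * a 1)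

theorem pow_mul_pow_of_mul {x y ζ : G} (hxζ : Commute x ζ) (hyζ : Commute y ζ)
    (h : x * y = y * x * ζ ^ 2) (n m : ℕ) : x ^ n * y ^ m = y ^ m * x ^ n * ζ ^ (2 * n * m) := by
  have h1 : SemiconjBy y (x * ζ ^ 2) x := by
    rw [SemiconjBy, ← mul_assoc, h]
  have h2 := h1.pow_right n
  rw [(hxζ.pow_right 2).mul_pow, ← pow_mul] at h2
  have h3 : SemiconjBy (x ^ n) y (y * ζ ^ (2 * n)) := by
    rw [SemiconjBy, ← h2.eq, mul_assoc, ((hxζ.pow_left n).pow_right (2 * n)).eq]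
  have h4 := h3.pow_right m
  rw [(hyζ.pow_right _).mul_pow, ← pow_mul] at h4
  rw [h4.eq, mul_assoc (y ^ m), mul_assoc (y ^ m), ((hxζ.pow_left n).pow_right _).eq]

theorem heis_mul {x y ζ : G} (hx : x ^ 73 = 1) (hy : y ^ 73 = 1) (hζ : ζ ^ 73 = 1)
    (hxζ : Commute x ζ) (hyζ : Commute y ζ) (h : x * y = y * x * ζ ^ 2) (a a' : Plane)
    (b b' : ZMod 73) :
    heis x y ζ a b * heis x y ζ a' b' = heis x y ζ (a + a') (b + b' + symp a a') := by
  have h1 : zpw y (a 1) * zpw x (a' 0) =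
      zpw x (a' 0) * zpw y (a 1) * zpw ζ (-(2 * a' 0 * a 1)) := by
    rw [zpw_neg hζ, eq_mul_inv_iff_mul_eq]
    have := pow_mul_pow_of_mul hxζ hyζ h (a' 0).val (a 1).val
    rw [zpw, zpw, this, ← zpw_natCast hζ]
    simp
  have hc : ∀ k j, Commute (zpw ζ k) (zpw x j) := fun k j => (hxζ.symm.pow_left _).pow_right _
  have hc' : ∀ k j, Commute (zpw ζ k) (zpw y j) := fun k j => (hyζ.symm.pow_left _).pow_right _
  have h2 : b + b' + symp a a' - (a + a') 0 * (a + a') 1 =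
      -(2 * a' 0 * a 1) + (b - a 0 * a 1) + (b' - a' 0 * a' 1) := by
    simp only [symp, Pi.add_apply]; ring
  rw [heis, heis, heis, h2, zpw_add hζ, zpw_add hζ]
  simp only [Pi.add_apply]
  rw [zpw_add hx, zpw_add hy]
  calc zpw x (a 0) * zpw y (a 1) * zpw ζ (b - a 0 * a 1) *
        (zpw x (a' 0) * zpw y (a' 1) * zpw ζ (b' - a' 0 * a' 1))
      = zpw x (a 0) * zpw y (a 1) * (zpw ζ (b - a 0 * a 1) *
        zpw x (a' 0)) * zpw y (a' 1) * zpw ζ (b' - a' 0 * a' 1) := by group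
    _ = zpw x (a 0) * (zpw y (a 1) * zpw x (a' 0)) * (zpw ζ (b - a 0 * a 1) *
        zpw y (a' 1)) * zpw ζ (b' - a' 0 * a' 1) := by rw [(hc _ _).eq]; group
    _ = zpw x (a 0) * zpw x (a' 0) * zpw y (a 1) * (zpw ζ (-(2 * a' 0 * a 1)) * zpw y (a' 1)) *
        zpw ζ (b - a 0 * a 1) * zpw ζ (b' - a' 0 * a' 1) := by rw [(hc' _ _).eq, h1]; group
    _ = _ := by rw [(hc' _ _).eq]; group

theorem heis_zero (x y ζ : G) (b : ZMod 73) : heis x y ζ 0 b = zpw ζ b := by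
  simp [heis, zpw_zero]

theorem heis_conj {x y ζ z : G} (hx : x ^ 73 = 1) (hy : y ^ 73 = 1) (hzx : z * x * z⁻¹ = x⁻¹)
    (hzy : z * y * z⁻¹ = y⁻¹) (hzζ : z * ζ * z⁻¹ = ζ) (a : Plane) (b : ZMod 73) :
    z * heis x y ζ a b * z⁻¹ = heis x y ζ (-a) b := by
  have : z * heis x y ζ a b * z⁻¹ = (z * zpw x (a 0) * z⁻¹) * (z * zpw y (a 1) * z⁻¹) *
      (z * zpw ζ (b - a 0 * a 1) * z⁻¹) := by rw [heis]; group
  rw [this, zpw_conj, zpw_conj, zpw_conj, hzx, hzy, hzζ, zpw_inv, zpw_inv, ← zpw_neg hx,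
    ← zpw_neg hy, heis]
  simp

end Power

/-- Heisenberg coordinates on `Q` in which the involution `z` acts by a sign on the plane. -/
structure Frame {G : Type*} [Group G] (Q W : Subgroup G) (z : G) (Φ : Plane → ZMod 73 → G) :
    Prop where
  mem : ∀ a b, Φ a b ∈ Q
  surj : ∀ q ∈ Q, ∃ a b, Φ a b = q
  inj : ∀ a b a' b', Φ a b = Φ a' b' → a = a' ∧ b = b'
  mul : ∀ a b a' b', Φ a b * Φ a' b' = Φ (a + a') (b + b' + symp a a')
  mem_center : ∀ a b, Φ a b ∈ centralizer (W : Set G) ↔ a = 0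
  conj : ∀ a b, z * Φ a b * z⁻¹ = Φ (-a) b

theorem Frame.one {G : Type*} [Group G] {Q W : Subgroup G} {z : G} {Φ : Plane → ZMod 73 → G}
    (E : Frame Q W z Φ) : Φ 0 0 = 1 := by
  have := E.mul 0 0 0 0
  simpa [symp_self] using this

theorem Frame.inv {G : Type*} [Group G] {Q W : Subgroup G} {z : G} {Φ : Plane → ZMod 73 → G}
    (E : Frame Q W z Φ) (a : Plane) (b : ZMod 73) : (Φ a b)⁻¹ = Φ (-a) (-b) := by
  rw [inv_eq_iff_mul_eq_one, E.mul, symp_neg_right, symp_self, ← E.one]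
  simp

namespace PointData

variable {G Ω : Type*} [Group G] [MulAction G Ω] [Finite G] [Finite Ω]
  {Q W : Subgroup G} {i o : Ω} (D : PointData G Q W i o)
  {z : G} (hz : z ∈ stabilizer G i ⊓ stabilizer G o)
  (hzZ : z ∈ centralizer ((Q ⊓ centralizer (W : Set G) : Subgroup G) : Set G))
  (hz2 : z * z = 1) (hz1 : z ≠ 1)

include D

theorem pow_center {ζ : G} (hζ : ζ ∈ Q ⊓ centralizer (W : Set G)) : ζ ^ 73 = 1 := by
  have := pow_card_mem hζ
  rwa [D.card_Z] at this

include hzZ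

theorem conj_center {ζ : G} (hζ : ζ ∈ Q ⊓ centralizer (W : Set G)) : z * ζ * z⁻¹ = ζ := by
  rw [← mem_centralizer_coe_iff.1 hzZ ζ hζ, mul_inv_cancel_right]

theorem pow_of_inverted {x a : G} (hx : x ∈ Q) (hzx : z * x * z⁻¹ = x⁻¹) (ha : a ∈ Q)
    (hax : a * x ≠ x * a) : x ^ 73 = 1 := by
  let Z := Q ⊓ centralizer (W : Set G)
  let f : Z × zpowers x → (Q ⊓ centralizer ({x} : Set G) : Subgroup G) := fun p =>
    ⟨p.1 * p.2, by
      obtain ⟨⟨ζ, hζ⟩, ⟨u, hu⟩⟩ := p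
      obtain ⟨n, hn⟩ := mem_zpowers_iff.1 hu
      have h1 : Commute x ζ := D.mul_comm_of_mem hζ hx
      refine ⟨Q.mul_mem hζ.1 (hn ▸ Q.zpow_mem hx n), mem_centralizer_singleton_iff.2 ?_⟩
      exact (h1.symm.mul_left (hn ▸ (Commute.refl x).zpow_left n)).eq⟩
  have hf : Function.Injective f := by
    rintro ⟨⟨ζ, hζ⟩, ⟨u, hu⟩⟩ ⟨⟨ζ', hζ'⟩, ⟨u', hu'⟩⟩ h
    have h1 : ζ * u = ζ' * u' := congrArg Subtype.val h
    have h2 : ζ'⁻¹ * ζ = u' * u⁻¹ := by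
      rw [eq_mul_inv_iff_mul_eq, mul_assoc, h1, inv_mul_cancel_left]
    have h3 : ζ'⁻¹ * ζ ∈ Z := Z.mul_mem (Z.inv_mem hζ') hζ
    have h4 : ζ'⁻¹ * ζ ∈ zpowers x := h2 ▸ (zpowers x).mul_mem hu' ((zpowers x).inv_mem hu)
    have h5 : ζ'⁻¹ * ζ = 1 := by
      refine D.eq_one_of_eq_inv h3.1 ?_
      have h6 := D.conj_center hzZ h3
      obtain ⟨n, hn⟩ := h4
      have hn : x ^ n = ζ'⁻¹ * ζ := hn
      rw [← hn] at h6 ⊢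
      nth_rw 1 [← h6]
      rw [← conj_zpow, hzx, inv_zpow]
    have h6 : ζ = ζ' := (inv_mul_eq_one.1 h5).symm
    subst h6
    have h7 := mul_left_cancel h1
    subst h7
    rfl
  have h1 := Nat.card_le_card_of_injective f hf
  rw [Nat.card_prod, D.card_Z, Nat.card_zpowers] at h1
  have h2 := Nat.le_of_dvd (by norm_num) (D.card_inf_centralizer ha hax _ le_rfl)
  have h3 : orderOf x ∣ 73 ^ 3 := by
    rw [← D.card_Q]; exact orderOf_dvd_of_pow_eq_one (pow_card_mem hx)
  obtain ⟨k, -, hk⟩ := (Nat.dvd_prime_pow (by norm_num)).1 h3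
  have hk1 : k ≤ 1 := by
    by_contra h
    have : 73 ^ 2 ≤ 73 ^ k := Nat.pow_le_pow_right (by norm_num) (by omega)
    rw [hk] at h1
    omega
  refine orderOf_dvd_iff_pow_eq_one.1 ?_
  rw [hk]
  exact pow_dvd_pow 73 hk1

include hz hz2 hz1

theorem exists_inverted {x : G} (hx : x ∈ Q) : ∃ η ∈ Q ⊓ centralizer (W : Set G),
    z * (x * η) * z⁻¹ = (x * η)⁻¹ := by
  have hζ := D.conj_mul_mem hz hzZ hz2 hz1 hx
  set ζ := z * x * z⁻¹ * x with h
  have hη := pow_mem hζ 36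
  refine ⟨ζ ^ 36, hη, ?_⟩
  have h1 : z * (x * ζ ^ 36) * z⁻¹ = (z * x * z⁻¹) * (z * ζ ^ 36 * z⁻¹) := by group
  rw [h1, D.conj_center hzZ hη, eq_mul_inv_of_mul_eq h.symm, mul_inv_rev, mul_assoc]
  have h2 : x⁻¹ * ζ ^ 36 = ζ ^ 36 * x⁻¹ := D.mul_comm_of_mem hη (Q.inv_mem hx)
  rw [h2, ← mul_assoc, ← pow_succ']
  congr 1
  rw [eq_inv_iff_mul_eq_one, ← pow_add]
  exact D.pow_center hζ

theorem exists_frame : ∃ Φ, Frame Q W z Φ := by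
  obtain ⟨x, hx, y, hy, hzx, hzy, hxy⟩ : ∃ x ∈ Q, ∃ y ∈ Q, z * x * z⁻¹ = x⁻¹ ∧
      z * y * z⁻¹ = y⁻¹ ∧ x * y ≠ y * x := by
    obtain ⟨a, ha, b, hb, hab⟩ := D.exists_not_commute
    obtain ⟨η, hη, h1⟩ := D.exists_inverted hz hzZ hz2 hz1 ha
    obtain ⟨θ, hθ, h2⟩ := D.exists_inverted hz hzZ hz2 hz1 hb
    refine ⟨_, Q.mul_mem ha hη.1, _, Q.mul_mem hb hθ.1, h1, h2, fun h => hab ?_⟩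
    have h3 : Commute (a * η) (b * θ) := h
    have h4 : ∀ q ∈ Q, Commute q η := fun q hq => D.mul_comm_of_mem hη hq
    have h5 : ∀ q ∈ Q, Commute q θ := fun q hq => D.mul_comm_of_mem hθ hq
    have h6 : Commute (a * η * η⁻¹) (b * θ) :=
      h3.mul_left (h4 _ (Q.mul_mem hb hθ.1)).symm.inv_left
    rw [mul_inv_cancel_right] at h6
    have h7 : Commute a (b * θ * θ⁻¹) := h6.mul_right (h5 a ha).inv_right
    rwa [mul_inv_cancel_right] at h7
  have hx73 := D.pow_of_inverted hzZ hx hzx hy hxy.symm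
  have hy73 := D.pow_of_inverted hzZ hy hzy hx hxy
  have hc := D.commutator_mem (Q.inv_mem hx) (Q.inv_mem hy)
  rw [inv_inv, inv_inv] at hc
  have hζ := pow_mem hc 37
  set c := x⁻¹ * y⁻¹ * x * y with hcdef
  set ζ := c ^ 37 with hζdef
  have hζ2 : ζ ^ 2 = c := by
    rw [hζdef, ← pow_mul, show 37 * 2 = 73 + 1 by norm_num, pow_succ, D.pow_center hc, one_mul]
  have hζ73 := D.pow_center hζ
  have hxζ : Commute x ζ := D.mul_comm_of_mem hζ hx
  have hyζ : Commute y ζ := D.mul_comm_of_mem hζ hy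
  have hrel : x * y = y * x * ζ ^ 2 := by rw [hζ2, hcdef]; group
  have hζ1 : ζ ≠ 1 := by
    intro h
    rw [h, one_pow, mul_one] at hrel
    exact hxy hrel
  have hoζ : orderOf ζ = 73 := orderOf_eq_prime hζ73 hζ1
  have hmul := heis_mul hx73 hy73 hζ73 hxζ hyζ hrel
  have hconj := heis_conj hx73 hy73 hzx hzy (D.conj_center hzZ hζ)
  have hmemZ : ∀ b, zpw ζ b ∈ Q ⊓ centralizer (W : Set G) := fun b => pow_mem hζ _
  have hmem : ∀ a b, heis x y ζ a b ∈ Q := fun a b =>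
    Q.mul_mem (Q.mul_mem (Q.pow_mem hx _) (Q.pow_mem hy _)) (hmemZ _).1
  have hone : ∀ a b, heis x y ζ a b = 1 → a = 0 ∧ b = 0 := by
    intro a b h
    have hb : b = 0 := by
      have h1 := hconj a b
      rw [h, mul_one, mul_inv_cancel] at h1
      have h2 := hmul a (-a) b b
      rw [h, ← h1, mul_one, add_neg_cancel, symp_neg_right, symp_self, neg_zero, add_zero,
        heis_zero] at h2
      exact eq_zero_of_two_mul_eq_zero (by rw [two_mul]; exact eq_zero_of_zpw_eq_one hoζ h2.symm)
    subst hb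
    refine ⟨eq_zero_of_symp fun c => ?_, rfl⟩
    have h1 := hmul c a 0 0
    have h2 := hmul a c 0 0
    rw [h, mul_one] at h1
    rw [h, one_mul, h1, add_zero, zero_add, symp_swap c a, add_comm a c] at h2
    have h3 := hmul (-(c + a)) (c + a) 0 (symp c a)
    have h4 := hmul (-(c + a)) (c + a) 0 (-symp c a)
    rw [zero_add] at h2
    rw [← h2, h3, symp_neg_left, symp_self, neg_add_cancel, heis_zero, heis_zero] at h4
    have h5 : zpw ζ (2 * symp c a) = 1 := by
      simp only [zero_add, neg_zero, add_zero] at h4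
      rw [two_mul, zpw_add hζ73]
      nth_rw 1 [h4]
      rw [zpw_neg hζ73, inv_mul_cancel]
    exact eq_zero_of_two_mul_eq_zero (eq_zero_of_zpw_eq_one hoζ h5)
  have hinj : ∀ a b a' b', heis x y ζ a b = heis x y ζ a' b' → a = a' ∧ b = b' := by
    intro a b a' b' h
    have h1 := hmul (-a') a' (-b') b'
    rw [neg_add_cancel, neg_add_cancel, symp_neg_left, symp_self, neg_zero, add_zero, heis_zero,
      zpw_zero, ← h, hmul] at h1
    obtain ⟨h2, h3⟩ := hone _ _ h1
    have h4 : a = a' := (neg_add_eq_zero.1 h2).symm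
    subst h4
    rw [symp_neg_left, symp_self, neg_zero, add_zero] at h3
    exact ⟨rfl, (neg_add_eq_zero.1 h3).symm⟩
  have hsurj : ∀ q ∈ Q, ∃ a b, heis x y ζ a b = q := by
    let f : Plane × ZMod 73 → Q := fun p => ⟨heis x y ζ p.1 p.2, hmem _ _⟩
    have hf : Function.Bijective f := by
      refine (Nat.bijective_iff_injective_and_card f).2 ⟨?_, ?_⟩
      · rintro ⟨a, b⟩ ⟨a', b'⟩ h
        obtain ⟨rfl, rfl⟩ := hinj _ _ _ _ (congrArg Subtype.val h)
        rfl
      · rw [Nat.card_prod, Nat.card_fun, D.card_Q, Nat.card_zmod, Nat.card_eq_fintype_card,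
          Fintype.card_fin]
        norm_num
    intro q hq
    obtain ⟨⟨a, b⟩, h⟩ := hf.2 ⟨q, hq⟩
    exact ⟨a, b, congrArg Subtype.val h⟩
  refine ⟨heis x y ζ, hmem, hsurj, hinj, fun a b a' b' => hmul a a' b b', fun a b => ⟨?_, ?_⟩,
    hconj⟩
  · intro h
    have h1 := D.conj_center hzZ ⟨hmem a b, h⟩
    rw [hconj] at h1
    exact eq_zero_of_neg_eq (hinj _ _ _ _ h1).1
  · rintro rfl
    rw [heis_zero]
    exact (hmemZ b).2

end PointData

/-- Linear automorphisms of the plane. -/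
abbrev PlaneGL := (Plane →ₗ[ZMod 73] Plane)ˣ

instance : Finite (Plane →ₗ[ZMod 73] Plane) := DFunLike.finite _

theorem card_planeGL : Nat.card PlaneGL = 37 ^ 1 * (144 * 5256) := by
  have h := Nat.card_congr (Matrix.GeneralLinearGroup.toLin (n := Fin 2) (R := ZMod 73)).toEquiv
  rw [Matrix.card_GL_field, ZMod.card] at h
  change _ = Nat.card PlaneGL at h
  rw [← h]
  simp [Fin.prod_univ_two]

/-- A fixed subgroup of order `37` of the automorphism group of the plane. -/
noncomputable def stdSubgroup : Subgroup PlaneGL := ((default : Sylow 37 PlaneGL) : Subgroup PlaneGL)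

theorem exists_conj_stdSubgroup {A : Subgroup PlaneGL} (hA : Nat.card A = 37) :
    ∃ m : PlaneGL, MulAut.conj m • A = stdSubgroup := by
  have hp : IsPGroup 37 A := isPGroup_of_card_prime hA
  obtain ⟨P, hP⟩ := hp.exists_le_sylow
  have hc := card_sylow_eq card_planeGL (by norm_num) P
  have hAP : A = P := eq_of_le_of_card_ge hP (by rw [hc, hA]; norm_num)
  obtain ⟨m, hm⟩ := exists_smul_eq PlaneGL P default
  exact ⟨m, by rw [hAP, stdSubgroup, ← hm]; rfl⟩

namespace PointData

variable {G Ω : Type*} [Group G] [MulAction G Ω] [Finite G] [Finite Ω]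
  {Q W : Subgroup G} {i o : Ω} (D : PointData G Q W i o)
  {z : G} (hz : z ∈ stabilizer G i ⊓ stabilizer G o)
  (hzZ : z ∈ centralizer ((Q ⊓ centralizer (W : Set G) : Subgroup G) : Set G))
  (hz2 : z * z = 1) (hz1 : z ≠ 1)

include D hz hzZ hz2 hz1

theorem exists_linear {Φ : Plane → ZMod 73 → G} (E : Frame Q W z Φ) {u : G} (hu : u ∈ W) :
    ∃ A : Plane →ₗ[ZMod 73] Plane, ∀ a b, u * Φ a b * u⁻¹ = Φ (A a) b := by
  have hK := D.W_le hu
  have hc : ∀ b, u * Φ 0 b * u⁻¹ = Φ 0 b := fun b => by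
    rw [← mem_centralizer_coe_iff.1 ((E.mem_center 0 b).2 rfl) u hu |>.symm, mul_inv_cancel_right]
  have huz : u * z = z * u := D.commute_of_mem hz hzZ hz2 hz1 hu
  have h0 : ∀ a, ∃ a', u * Φ a 0 * u⁻¹ = Φ a' 0 := by
    intro a
    obtain ⟨a', b', h⟩ := E.surj _ (D.conj_mem hK.1 (E.mem a 0))
    have h1 : z * (u * Φ a 0 * u⁻¹) * z⁻¹ = (u * Φ a 0 * u⁻¹)⁻¹ := by
      have : z * (u * Φ a 0 * u⁻¹) * z⁻¹ = (z * u) * Φ a 0 * (z * u)⁻¹ := by group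
      rw [this, ← huz]
      have : u * z * Φ a 0 * (u * z)⁻¹ = u * (z * Φ a 0 * z⁻¹) * u⁻¹ := by group
      rw [this, E.conj, ← neg_zero (G := ZMod 73), ← E.inv, neg_zero]
      group
    rw [← h, E.conj, E.inv] at h1
    have h2 : b' = 0 := by
      have := (E.inj _ _ _ _ h1).2
      exact eq_zero_of_two_mul_eq_zero (by linear_combination this)
    exact ⟨a', by rw [← h, h2]⟩
  choose φ hφ using h0
  have hφ' : ∀ a b, u * Φ a b * u⁻¹ = Φ (φ a) b := by
    intro a b
    have h1 : ∀ a b, Φ a b = Φ a 0 * Φ 0 b := fun a b => by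
      rw [E.mul]; simp [symp]
    have h2 : u * (Φ a 0 * Φ 0 b) * u⁻¹ = (u * Φ a 0 * u⁻¹) * (u * Φ 0 b * u⁻¹) := by group
    rw [h1 a b, h1 (φ a) b, h2, hφ, hc]
  have hadd : ∀ a a', φ (a + a') = φ a + φ a' := by
    intro a a'
    have h1 := hφ' (a + a') (0 + 0 + symp a a')
    rw [← E.mul] at h1
    have h2 : u * (Φ a 0 * Φ a' 0) * u⁻¹ = (u * Φ a 0 * u⁻¹) * (u * Φ a' 0 * u⁻¹) := by group
    rw [h2, hφ', hφ', E.mul] at h1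
    exact (E.inj _ _ _ _ h1).1.symm
  exact ⟨(AddMonoidHom.mk' φ hadd).toZModLinearMap 73, hφ'⟩

theorem exists_std_frame : ∃ Ψ, Frame Q W z Ψ ∧
    (∀ u ∈ W, ∃ g ∈ stdSubgroup, ∀ a b, u * Ψ a b * u⁻¹ = Ψ (g.1 a) b) ∧
    ∀ g ∈ stdSubgroup, ∃ u ∈ W, ∀ a b, u * Ψ a b * u⁻¹ = Ψ (g.1 a) b := by
  obtain ⟨Φ, E⟩ := D.exists_frame hz hzZ hz2 hz1
  choose ρ hρ using fun u : W => D.exists_linear hz hzZ hz2 hz1 E u.2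
  let r : W →* (Plane →ₗ[ZMod 73] Plane) :=
    { toFun := ρ
      map_one' := by
        refine LinearMap.ext fun a => ?_
        have h := hρ 1 a 0
        simp only [OneMemClass.coe_one, one_mul, inv_one, mul_one] at h
        exact (E.inj _ _ _ _ h).1.symm
      map_mul' := fun u v => by
        refine LinearMap.ext fun a => ?_
        have h := hρ (u * v) a 0
        have h1 : ((u * v : W) : G) * Φ a 0 * ((u * v : W) : G)⁻¹ =
            u * (v * Φ a 0 * (v : G)⁻¹) * (u : G)⁻¹ := by
          push_cast; group
        rw [h1, hρ, hρ] at h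
        exact (E.inj _ _ _ _ h).1.symm }
  have hr : ∀ u : W, (r.toHomUnits u).1 = ρ u := fun u => rfl
  have hinj : Function.Injective r.toHomUnits := by
    rw [injective_iff_map_eq_one]
    intro u hu
    by_contra h1
    obtain ⟨x, hx, hx'⟩ := D.exists_notMem
    obtain ⟨a, b, rfl⟩ := E.surj x hx
    refine hx' (D.mem_centralizer_of_commute u.2 (fun h => h1 (Subtype.ext h)) ?_)
    rw [← mul_inv_eq_iff_eq_mul, hρ, ← hr, hu]
    rfl
  obtain ⟨m, hm⟩ := exists_conj_stdSubgroup (A := r.toHomUnits.range) (by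
    rw [← D.card_W]
    exact (Nat.card_congr (MonoidHom.ofInjective hinj).toEquiv).symm)
  obtain ⟨d, hd, hsymp⟩ := exists_symp_map m⁻¹
  have hmm : ∀ a, m⁻¹.1 (m.1 a) = a := fun a => by
    rw [← Module.End.mul_apply, ← Units.val_mul, inv_mul_cancel]; rfl
  have hmm' : ∀ a, m.1 (m⁻¹.1 a) = a := fun a => by
    rw [← Module.End.mul_apply, ← Units.val_mul, mul_inv_cancel]; rfl
  have hact : ∀ (u : W) (a : Plane) (b : ZMod 73), u * Φ (m⁻¹.1 a) (d * b) * (u : G)⁻¹ =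
      Φ (m⁻¹.1 ((MulAut.conj m (r.toHomUnits u)).1 a)) (d * b) := by
    intro u a b
    rw [hρ, MulAut.conj_apply, Units.val_mul, Units.val_mul, Module.End.mul_apply,
      Module.End.mul_apply, hmm]
    rfl
  refine ⟨fun a b => Φ (m⁻¹.1 a) (d * b), ⟨fun a b => E.mem _ _, fun q hq => ?_, ?_, ?_, ?_, ?_⟩,
    fun u hu => ?_, fun g hg => ?_⟩
  · obtain ⟨a, b, h⟩ := E.surj q hq
    exact ⟨m.1 a, d⁻¹ * b, by rw [hmm, mul_inv_cancel_left₀ hd, h]⟩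
  · intro a b a' b' h
    obtain ⟨h1, h2⟩ := E.inj _ _ _ _ h
    refine ⟨?_, mul_left_cancel₀ hd h2⟩
    rw [← hmm' a, h1, hmm']
  · intro a b a' b'
    simp only [E.mul, map_add, hsymp, mul_add]
  · intro a b
    rw [E.mem_center]
    constructor
    · intro h
      rw [← hmm' a, h, map_zero]
    · rintro rfl
      rw [map_zero]
  · intro a b
    simp only [E.conj, map_neg]
  · refine ⟨MulAut.conj m (r.toHomUnits ⟨u, hu⟩), ?_, fun a b => hact ⟨u, hu⟩ a b⟩
    rw [← hm]
    exact smul_mem_pointwise_smul _ _ _ ⟨_, rfl⟩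
  · rw [← hm] at hg
    obtain ⟨_, ⟨u, rfl⟩, rfl⟩ := hg
    exact ⟨u, u.2, fun a b => hact u a b⟩

end PointData

theorem planeGL_neg_neg (g : PlaneGL) : - -g = g := Units.ext (neg_neg g.1)

/-- The point set of the model unital-like geometry. -/
abbrev ModelPoint := Option (Plane × ZMod 73)

/-- The blocks through the point at infinity. -/
def line (a : Plane) : Set ModelPoint := {p | p = none ∨ ∃ b, p = some (a, b)}

/-- The blocks missing the point at infinity. -/
def circle (c a : Plane) (v : ZMod 73) : Set ModelPoint :=
  {p | ∃ g : PlaneGL, (g ∈ stdSubgroup ∨ -g ∈ stdSubgroup) ∧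
    p = some (c + g.1 a, v + symp c (g.1 a))}

/-- The block set of the model geometry. -/
def modelBlocks : Set (Set ModelPoint) :=
  {B | (∃ a, B = line a) ∨ ∃ c a v, a ≠ 0 ∧ B = circle c a v}

theorem none_notMem_circle {c a : Plane} {v : ZMod 73} : none ∉ circle c a v := by
  rintro ⟨g, -, h⟩
  exact absurd h (by simp)

theorem add_mem_circle (c a : Plane) (v : ZMod 73) :
    (some (c + a, v + symp c a) : ModelPoint) ∈ circle c a v :=
  ⟨1, Or.inl (one_mem _), rfl⟩

theorem sub_mem_circle (c a : Plane) (v : ZMod 73) :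
    (some (c - a, v - symp c a) : ModelPoint) ∈ circle c a v := by
  refine ⟨-1, Or.inr (by rw [planeGL_neg_neg]; exact one_mem _), ?_⟩
  have : (-1 : PlaneGL).1 a = -a := rfl
  rw [this, symp_neg_right, sub_eq_add_neg, sub_eq_add_neg]

/-- The projection of the points to the plane. -/
def proj : ModelPoint → Plane
  | none => 0
  | some p => p.1

/-- The reflection in a point of the plane. -/
def reflect (c : Plane) (v : ZMod 73) : ModelPoint → ModelPoint
  | none => none
  | some p => some (c + c - p.1, v + v - p.2)

theorem reflect_reflect (c : Plane) (v : ZMod 73) (p : ModelPoint) :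
    reflect c v (reflect c v p) = p := by
  rcases p with - | ⟨a, b⟩ <;> simp [reflect]

theorem reflect_mem_circle {c a : Plane} {v : ZMod 73} {p : ModelPoint} (hp : p ∈ circle c a v) :
    reflect c v p ∈ circle c a v := by
  obtain ⟨g, hg, rfl⟩ := hp
  refine ⟨-g, by rw [planeGL_neg_neg]; exact hg.symm, ?_⟩
  have : (-g).1 a = -(g.1 a) := rfl
  rw [this, symp_neg_right]
  simp only [reflect, Option.some.injEq, Prod.mk.injEq]
  exact ⟨by abel, by ring⟩

/-- The centre of a circle is determined by its projection. -/
theorem sum_proj_circle {c a : Plane} {v : ZMod 73} (h : (circle c a v).ncard = 74) :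
    ∑ᶠ p ∈ circle c a v, proj p = c := by
  classical
  have hfin : (circle c a v).Finite := Set.toFinite _
  rw [finsum_mem_eq_finite_toFinset_sum _ hfin]
  set S := hfin.toFinset with hS
  have hcard : S.card = 74 := by rw [hS, ← Set.ncard_eq_toFinset_card, h]
  have h1 : ∑ p ∈ S, proj p = ∑ p ∈ S, (c + c - proj p) := by
    refine Finset.sum_nbij' (reflect c v) (reflect c v) ?_ ?_ ?_ ?_ ?_
    · intro p hp
      exact hfin.mem_toFinset.2 (reflect_mem_circle (hfin.mem_toFinset.1 hp))
    · intro p hp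
      exact hfin.mem_toFinset.2 (reflect_mem_circle (hfin.mem_toFinset.1 hp))
    · exact fun p _ => reflect_reflect c v p
    · exact fun p _ => reflect_reflect c v p
    · intro p hp
      obtain ⟨g, -, rfl⟩ := hfin.mem_toFinset.1 hp
      simp only [reflect, proj]
      abel
  rw [Finset.sum_sub_distrib, Finset.sum_const, hcard] at h1
  ext j
  have h2 := congrFun h1 j
  have h3 : ((74 : ℕ) : ZMod 73) = 1 := by decide
  rw [Pi.sub_apply, Pi.smul_apply, Pi.add_apply, nsmul_eq_mul, h3, one_mul] at h2
  exact sub_eq_zero.1 (eq_zero_of_two_mul_eq_zero (by linear_combination h2))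

/-- An automorphism of the model fixing the point at infinity and all blocks through it is a
central translation. -/
theorem exists_eq_translation (h74 : ∀ B ∈ modelBlocks, B.ncard = 74)
    {σ : Equiv.Perm ModelPoint} (hσ : ∀ B ∈ modelBlocks, σ '' B ∈ modelBlocks)
    (hnone : σ none = none) (hline : ∀ a, σ '' line a = line a) :
    ∃ d, ∀ a b, σ (some (a, b)) = some (a, b + d) := by
  have h0 : ∀ a b, ∃ b', σ (some (a, b)) = some (a, b') := by
    intro a b
    have h1 : σ (some (a, b)) ∈ line a := by
      rw [← hline a]; exact Set.mem_image_of_mem _ (Or.inr ⟨b, rfl⟩)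
    rcases h1 with h1 | h1
    · rw [← hnone] at h1
      exact absurd (σ.injective h1) (by simp)
    · exact h1
  choose φ hφ using h0
  have hproj : ∀ p, proj (σ p) = proj p := by
    rintro (- | ⟨a, b⟩)
    · rw [hnone]
    · rw [hφ]; rfl
  have hstar : ∀ c a v, a ≠ 0 → ∃ v', φ (c + a) (v + symp c a) = v' + symp c a ∧
      φ (c - a) (v - symp c a) = v' - symp c a := by
    intro c a v ha
    have hmem : circle c a v ∈ modelBlocks := Or.inr ⟨c, a, v, ha, rfl⟩
    rcases hσ _ hmem with ⟨a', h⟩ | ⟨c', a', v', ha', h⟩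
    · exfalso
      have h1 : none ∈ σ '' circle c a v := by rw [h]; exact Or.inl rfl
      obtain ⟨p, hp, hp'⟩ := h1
      rw [← hnone] at hp'
      exact none_notMem_circle (σ.injective hp' ▸ hp)
    · have hc : c' = c := by
        rw [← sum_proj_circle (h74 _ hmem),
          ← sum_proj_circle (h74 _ (Or.inr ⟨c', a', v', ha', rfl⟩)), ← h,
          finsum_mem_image σ.injective.injOn]
        exact finsum_mem_congr rfl fun p _ => hproj p
      subst hc
      have key : ∀ x y : Plane, ∀ b, y = c' + x → some (y, b) ∈ circle c' a v →
          φ y b = v' + symp c' x := by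
        intro x y b hy hp
        have h1 : σ (some (y, b)) ∈ circle c' a' v' := by
          rw [← h]; exact Set.mem_image_of_mem _ hp
        rw [hφ] at h1
        obtain ⟨g, -, h2⟩ := h1
        simp only [Option.some.injEq, Prod.mk.injEq] at h2
        have h3 : x = g.1 a' := add_left_cancel (hy.symm.trans h2.1)
        rw [h2.2, h3]
      refine ⟨v', key _ _ _ rfl (add_mem_circle _ _ _), ?_⟩
      rw [key (-a) _ _ (sub_eq_add_neg _ _) (sub_mem_circle _ _ _), symp_neg_right, sub_eq_add_neg]
  have hhalf : ∀ b : ZMod 73, 37 * b + 37 * b = b := fun b => by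
    have h : (37 : ZMod 73) + 37 = 1 := by decide
    rw [← add_mul, h, one_mul]
  have hconst : ∀ a b, φ a b = φ 0 b := by
    intro a b
    by_cases ha : a = 0
    · rw [ha]
    · set c : Plane := (37 : ZMod 73) • a with hc
      have hcc : c + c = a := by
        ext j; simp only [hc, Pi.add_apply, Pi.smul_apply, smul_eq_mul]; exact hhalf _
      have hc0 : c ≠ 0 := by
        intro h; rw [h, add_zero] at hcc; exact ha hcc.symm
      obtain ⟨v', h1, h2⟩ := hstar c c b hc0
      rw [symp_self, add_zero, add_zero, hcc] at h1
      rw [symp_self, sub_zero, sub_zero, sub_self] at h2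
      rw [h1, h2]
  refine ⟨φ 0 0, fun a b => ?_⟩
  rw [hφ, hconst]
  have h10 : (![1, 0] : Plane) ≠ 0 := fun h => by simpa using congrFun h 0
  obtain ⟨c, hc⟩ := exists_symp_eq h10 (37 * b)
  obtain ⟨v', h1, h2⟩ := hstar c _ (37 * b) h10
  rw [hc, hconst, hhalf] at h1
  rw [hc, hconst, sub_self] at h2
  rw [h1, h2, add_comm b, sub_add_eq_add_sub, add_sub_assoc]
  congr 3
  exact eq_sub_of_add_eq (hhalf b)

namespace PointData

variable {G Ω : Type*} [Group G] [MulAction G Ω] [Finite G] [Finite Ω]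
  {Q W : Subgroup G} {i o : Ω} (D : PointData G Q W i o)

include D

theorem exists_model : ∃ e : ModelPoint ≃ Ω, e none = i ∧
    (∀ S : Set ModelPoint, e '' S ∈ blocks Ω W ↔ S ∈ modelBlocks) ∧
    ∀ d, ∃ t : G, t • i = i ∧ ∀ a b, t • e (some (a, b)) = e (some (a, b + d)) := by
  obtain ⟨z, ⟨hz, hzZ⟩, hz2'⟩ := D.exists_involution
  have hz2 : z * z = 1 := by rw [← pow_two, ← hz2', pow_orderOf_eq_one]
  have hz1 : z ≠ 1 := by rintro rfl; rw [orderOf_one] at hz2'; omega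
  have hzinv : z⁻¹ = z := inv_eq_of_mul_eq_one_left hz2
  obtain ⟨Ψ, E, hW, hW'⟩ := D.exists_std_frame hz hzZ hz2 hz1
  let f : ModelPoint → Ω := fun p => p.elim i fun q => Ψ q.1 q.2 • o
  have hf : Function.Bijective f := by
    constructor
    · rintro (- | ⟨a, b⟩) (- | ⟨a', b'⟩) h
      · rfl
      · exact absurd h.symm (D.smul_ne (E.mem _ _))
      · exact absurd h (D.smul_ne (E.mem _ _))
      · obtain ⟨rfl, rfl⟩ := E.inj _ _ _ _ (D.smul_inj (E.mem _ _) (E.mem _ _) h)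
        rfl
    · intro x
      by_cases hx : x = i
      · exact ⟨none, hx.symm⟩
      · obtain ⟨q, hq, rfl⟩ := D.exists_smul_eq hx
        obtain ⟨a, b, rfl⟩ := E.surj q hq
        exact ⟨some (a, b), rfl⟩
  let e : ModelPoint ≃ Ω := Equiv.ofBijective f hf
  have hnone : e none = i := rfl
  have hsome : ∀ a b, e (some (a, b)) = Ψ a b • o := fun _ _ => rfl
  have hl : ∀ c v, e '' line c = Ψ c v • fixSet Ω W := by
    intro c v
    rw [D.fixSet_eq]
    ext y
    constructor
    · rintro ⟨_, rfl | ⟨b, rfl⟩, rfl⟩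
      · exact ⟨i, Or.inl rfl, D.smul_eq_i (E.mem _ _)⟩
      · refine ⟨Ψ 0 (b - v) • o, Or.inr ⟨_, ⟨E.mem _ _, (E.mem_center _ _).2 rfl⟩, rfl⟩, ?_⟩
        change Ψ c v • Ψ 0 (b - v) • o = _
        rw [← mul_smul, E.mul, hsome]
        simp [symp]
    · rintro ⟨_, rfl | ⟨q, ⟨hq, hqW⟩, rfl⟩, rfl⟩
      · exact ⟨none, Or.inl rfl, (D.smul_eq_i (E.mem _ _)).symm⟩
      · obtain ⟨a, b, rfl⟩ := E.surj q hq
        obtain rfl := (E.mem_center a b).1 hqW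
        refine ⟨_, Or.inr ⟨v + b, rfl⟩, ?_⟩
        change _ = Ψ c v • Ψ 0 b • o
        rw [← mul_smul, E.mul, hsome]
        simp [symp]
  have hact : ∀ (u : G), u ∈ stabilizer G i ⊓ stabilizer G o → ∀ (h : Plane) c v a b,
      u * Ψ a b * u⁻¹ = Ψ h b →
      Ψ c v • u • Ψ a b • o = e (some (c + h, v + b + symp c h)) := by
    intro u hu h c v a b hh
    rw [D.smul_smul_eq hu, hh, ← mul_smul, E.mul, hsome]
  have hc : ∀ c v a b, e '' circle c a (v + b) =
      {y | ∃ u : G, (u ∈ W ∨ z * u ∈ W) ∧ Ψ c v • u • Ψ a b • o = y} := by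
    intro c v a b
    have hzu : ∀ (u : G) (h : Plane), z * u * Ψ a b * (z * u)⁻¹ = Ψ h b →
        u * Ψ a b * u⁻¹ = Ψ (-h) b := by
      intro u h hh
      rw [← E.conj, ← hh, mul_inv_rev, hzinv]
      calc u * Ψ a b * u⁻¹ = (z * z) * (u * Ψ a b * u⁻¹) * (z * z) := by
            rw [hz2, one_mul, mul_one]
        _ = _ := by group
    ext y
    constructor
    · rintro ⟨_, ⟨g, hg | hg, rfl⟩, rfl⟩
      · obtain ⟨u, hu, h⟩ := hW' g hg
        exact ⟨u, Or.inl hu, hact u (D.W_le hu) _ _ _ _ _ (h a b)⟩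
      · obtain ⟨u, hu, h⟩ := hW' _ hg
        have h1 : z * (z * u) = u := by rw [← mul_assoc, hz2, one_mul]
        refine ⟨z * u, Or.inr (by rwa [h1]), hact _ (mul_mem hz (D.W_le hu)) _ _ _ _ _ ?_⟩
        rw [hzu (z * u) ((-g).1 a) (by rw [h1, h])]
        congr 1
        exact neg_neg _
    · rintro ⟨u, hu | hu, rfl⟩
      · obtain ⟨g, hg, h⟩ := hW u hu
        exact ⟨_, ⟨g, Or.inl hg, rfl⟩, (hact u (D.W_le hu) _ _ _ _ _ (h a b)).symm⟩
      · obtain ⟨g, hg, h⟩ := hW _ hu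
        refine ⟨_, ⟨-g, Or.inr (by rw [planeGL_neg_neg]; exact hg), rfl⟩, ?_⟩
        have h1 : z * (z * u) = u := by rw [← mul_assoc, hz2, one_mul]
        refine (hact u (h1 ▸ mul_mem hz (D.W_le hu)) _ _ _ _ _ ?_).symm
        rw [hzu u _ (h a b)]
        rfl
  refine ⟨e, hnone, fun S => ?_, fun d => ⟨Ψ 0 d, D.smul_eq_i (E.mem _ _), fun a b => ?_⟩⟩
  · rw [D.mem_blocks_iff hz hzZ hz2 hz1]
    have hinj : ∀ {T}, e '' S = e '' T ↔ S = T := e.injective.image_injective.eq_iff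
    constructor
    · rintro (⟨q, hq, h⟩ | ⟨q, hq, x, hx, hx', h⟩)
      · obtain ⟨c, v, rfl⟩ := E.surj q hq
        rw [← hl, hinj] at h
        exact Or.inl ⟨c, h⟩
      · obtain ⟨c, v, rfl⟩ := E.surj q hq
        obtain ⟨a, b, rfl⟩ := E.surj x hx
        rw [← hc, hinj] at h
        exact Or.inr ⟨c, a, _, fun ha => hx' ((E.mem_center _ _).2 ha), h⟩
    · rintro (⟨c, rfl⟩ | ⟨c, a, v, ha, rfl⟩)
      · exact Or.inl ⟨Ψ c 0, E.mem _ _, hl c 0⟩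
      · refine Or.inr ⟨Ψ c v, E.mem _ _, Ψ a 0, E.mem _ _,
          fun h => ha ((E.mem_center _ _).1 h), ?_⟩
        rw [← hc, add_zero]
  · rw [hsome, hsome, ← mul_smul, E.mul, add_comm b]
    simp [symp]

end PointData

/-- The elations of a block structure: the automorphisms fixing a point and every block
through it. -/
def elations {Ω : Type*} (𝓑 : Set (Set Ω)) : Set (Equiv.Perm Ω) :=
  {σ | (∀ B ∈ 𝓑, σ '' B ∈ 𝓑) ∧ ∃ P, σ P = P ∧ ∀ B ∈ 𝓑, P ∈ B → σ '' B = B}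

/-- The group generated by the elations of a block structure. -/
def elationGroup {Ω : Type*} (𝓑 : Set (Set Ω)) : Subgroup (Equiv.Perm Ω) :=
  closure (elations 𝓑)

/-- Isomorphic block structures have isomorphic elation groups. -/
theorem nonempty_elationGroup_mulEquiv {Ω Ω' : Type*} (e : Ω ≃ Ω') {𝓑 : Set (Set Ω)}
    {𝓑' : Set (Set Ω')} (he : ∀ S, e '' S ∈ 𝓑' ↔ S ∈ 𝓑) :
    Nonempty (elationGroup 𝓑 ≃* elationGroup 𝓑') := by
  have hsurj : ∀ T : Set Ω', ∃ S, e '' S = T := fun T => ⟨e ⁻¹' T, e.image_preimage T⟩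
  have hconj : ∀ (σ : Equiv.Perm Ω) (S : Set Ω), e.permCongrHom σ '' (e '' S) = e '' (σ '' S) := by
    intro σ S
    rw [Set.image_image, Set.image_image]
    refine Set.image_congr fun x _ => ?_
    change e (σ (e.symm (e x))) = _
    rw [e.symm_apply_apply]
  have hset : e.permCongrHom.toMonoidHom '' elations 𝓑 = elations 𝓑' := by
    have key : ∀ σ : Equiv.Perm Ω, σ ∈ elations 𝓑 ↔ e.permCongrHom σ ∈ elations 𝓑' := by
      intro σ
      refine and_congr ⟨fun h B hB => ?_, fun h B hB => ?_⟩ ⟨?_, ?_⟩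
      · obtain ⟨S, rfl⟩ := hsurj B
        rw [hconj, he]
        exact h S ((he S).1 hB)
      · have := h _ ((he B).2 hB)
        rwa [hconj, he] at this
      · rintro ⟨P, hP, h⟩
        refine ⟨e P, ?_, fun B hB hPB => ?_⟩
        · change e (σ (e.symm (e P))) = _
          rw [e.symm_apply_apply, hP]
        · obtain ⟨S, rfl⟩ := hsurj B
          rw [hconj, h S ((he S).1 hB) (by
            obtain ⟨x, hx, hx'⟩ := hPB
            exact e.injective hx' ▸ hx)]
      · rintro ⟨P, hP, h⟩
        have hP : e (σ (e.symm P)) = P := hP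
        refine ⟨e.symm P, by rw [Equiv.eq_symm_apply, hP], fun B hB hPB => ?_⟩
        have := h _ ((he B).2 hB) ⟨_, hPB, e.apply_symm_apply P⟩
        rw [hconj] at this
        exact e.injective.image_injective this
    ext σ
    obtain ⟨τ, rfl⟩ := e.permCongrHom.surjective σ
    constructor
    · rintro ⟨τ', h, h'⟩
      obtain rfl := e.permCongrHom.injective h'
      exact (key _).1 h
    · intro h
      exact ⟨τ, (key _).2 h, rfl⟩
  have hmap : (elationGroup 𝓑).map e.permCongrHom.toMonoidHom = elationGroup 𝓑' := by
    rw [elationGroup, MonoidHom.map_closure, hset, elationGroup]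
  rw [← hmap]
  exact ⟨e.permCongrHom.subgroupMap _⟩

theorem card_sylow_751 {G : Type*} [Group G] [Finite G] (U : UData G) (P : Sylow 751 G) :
    Nat.card P = 751 := by
  have := card_sylow_eq (p := 751) (n := 1) (m := 2^5 * 3^2 * 7 * 37^2 * 73^3) (U.card.trans
    (by norm_num)) (by norm_num) P
  simpa using this

theorem card_normalizer_751 {G : Type*} [Group G] [Finite G] (U : UData G) {P : Subgroup G}
    (hP : Nat.card P = 751) : Nat.card (normalizer (P : Set G)) = 21 * 751 := by
  have hp : IsPGroup 751 P := isPGroup_of_card_prime hP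
  obtain ⟨S, hS⟩ := hp.exists_le_sylow
  have : P = S := eq_of_le_of_card_ge hS (by rw [hP]; exact (card_sylow_751 U S).le)
  rw [this, U.card_normalizer]

/-- A normal subgroup of order divisible by `73` does not have index `3`. -/
theorem index_ne_three {G : Type*} [Group G] [Finite G] (U : UData G) (M : Subgroup G) [M.Normal]
    (h73 : 73 ∣ Nat.card M) : M.index ≠ 3 := by
  intro h3
  have hcM : Nat.card M = 751 ^ 1 * (2^5 * 3 * 7 * 37^2 * 73^3) := by
    have := M.card_mul_index
    rw [h3, U.card] at this
    omega
  let P : Sylow 751 M := default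
  have hP : Nat.card P = 751 := by
    have := card_sylow_eq hcM (by norm_num) P
    simpa using this
  set P' := map M.subtype (P : Subgroup M) with hP'def
  have hP' : Nat.card P' = 751 := by
    rw [hP'def, card_map_of_injective (subtype_injective M)]; exact hP
  have hN' := card_normalizer_751 U hP'
  have h7 : Nat.card (normalizer ((P : Subgroup M) : Set M)) ∣ 7 * 751 := by
    have h1 : Nat.card (M ⊓ normalizer (P' : Set G) : Subgroup G) = 7 * 751 := by
      have h2 := relIndex_mul_card (H := M ⊓ normalizer (P' : Set G)) inf_le_right
      have h4 := relIndex_sup_right (normalizer (P' : Set G)) M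
      rw [hP'def, P.normalizer_sup_eq_top, relIndex_top_right, h3, ← hP'def] at h4
      rw [inf_relIndex_right, ← h4, hN'] at h2
      omega
    rw [← h1, ← card_map_of_injective (subtype_injective M)]
    exact card_dvd_of_le (le_inf (map_subtype_le _) (le_normalizer_map _))
  have hle : normalizer ((P : Subgroup M) : Set M) ≤ centralizer ((P : Subgroup M) : Set M) := by
    have h1 := relIndex_centralizer_dvd (P := (P : Subgroup M)) hP
    rw [← relIndex_eq_one]
    have h2 : (centralizer ((P : Subgroup M) : Set M)).relIndex
        (normalizer ((P : Subgroup M) : Set M)) ∣ 7 * 751 := by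
      refine dvd_trans ?_ h7
      rw [relIndex]
      exact index_dvd_card _
    have h3 := Nat.dvd_gcd h1 h2
    exact Nat.dvd_one.1 (by simpa using h3)
  set K := (MonoidHom.transferSylow P hle).ker with hK
  have hKi : K.index = 751 := by
    rw [hK, (MonoidHom.ker_transferSylow_isComplement' P hle).symm.index_eq_card]
    exact hP
  have h73K : 73 ∣ Nat.card K := by
    have h1 := K.card_mul_index
    rw [hKi] at h1
    rw [← h1] at h73
    exact (Nat.Coprime.dvd_mul_right (by norm_num)).1 h73
  obtain ⟨D, -, hD, hne, hdvd⟩ := exists_index_dvd_card_normalizer K h73K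
  refine (not_dvd_normalizer_73 U (hD.map M.subtype) ?_).2 ?_
  · rwa [Ne, map_eq_bot_iff_of_injective _ (subtype_injective M)]
  · rw [← hKi]
    refine hdvd.trans ?_
    rw [← card_map_of_injective (subtype_injective M)]
    exact card_dvd_of_le (le_normalizer_map _)

theorem eq_top_of_normal {G : Type*} [Group G] [Finite G] (U : UData G) (M : Subgroup G) [M.Normal]
    (h73 : 73 ∣ Nat.card M) : M = ⊤ := by
  have h751 := dvd_card_of_normal U M h73
  obtain ⟨D, -, hD, hne, hdvd⟩ := exists_index_dvd_card_normalizer M h73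
  have h7 : ¬ 7 ∣ M.index := fun h => (not_dvd_normalizer_73 U hD hne).1 (h.trans hdvd)
  have h751' : ¬ 751 ∣ M.index := fun h => (not_dvd_normalizer_73 U hD hne).2 (h.trans hdvd)
  obtain ⟨E, -, hE, hEne, hEdvd⟩ := exists_index_dvd_card_normalizer M h751
  have hcE : Nat.card E = 751 := by
    obtain ⟨S, hS⟩ := hE.exists_le_sylow
    have h1 := card_dvd_of_le hS
    rw [card_sylow_751 U S] at h1
    exact ((Nat.dvd_prime (by norm_num)).1 h1).resolve_left fun h => hEne (eq_bot_of_card_eq _ h)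
  rw [card_normalizer_751 U hcE, show 21 * 751 = 3 * (7 * 751) by norm_num] at hEdvd
  have h3 : M.index ∣ 3 := by
    refine Nat.Coprime.dvd_of_dvd_mul_right ?_ hEdvd
    exact Nat.Coprime.mul_right ((Nat.Prime.coprime_iff_not_dvd (by norm_num)).2 h7).symm
      ((Nat.Prime.coprime_iff_not_dvd (by norm_num)).2 h751').symm
  rw [← index_eq_one]
  exact ((Nat.dvd_prime (by norm_num)).1 h3).resolve_right (index_ne_three U M h73)

namespace PointData

variable {G Ω : Type*} [Group G] [MulAction G Ω] [Finite G] [Finite Ω]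
  {Q W : Subgroup G} {i o : Ω} (D : PointData G Q W i o)

include D

theorem toPerm_mem_elations {g ζ : G} (hζ : ζ ∈ Q ⊓ centralizer (W : Set G)) :
    toPermHom G Ω (g * ζ * g⁻¹) ∈ elations (blocks Ω W) := by
  refine ⟨fun B hB => smul_mem_blocks _ hB, g • i, ?_, fun B hB hi => ?_⟩
  · change (g * ζ * g⁻¹) • g • i = g • i
    rw [mul_smul, inv_smul_smul, mul_smul, D.smul_eq_i hζ.1]
  · change (g * ζ * g⁻¹) • B = B
    obtain ⟨q, hq, h⟩ := D.eq_smul_fixSet (smul_mem_blocks g⁻¹ hB)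
      (Set.mem_smul_set_iff_inv_smul_mem.2 (by rwa [inv_inv]))
    have h1 : ζ • g⁻¹ • B = g⁻¹ • B := by
      rw [h, ← mul_smul, ← D.mul_comm_of_mem hζ hq, mul_smul,
        smul_fixSet_of_mem_normalizer (centralizer_le_normalizer _ hζ.2)]
    rw [mul_smul, mul_smul, h1, smul_inv_smul]

theorem elations_subset : elations (blocks Ω W) ⊆ (toPermHom G Ω).range := by
  rintro σ ⟨hσ, P, hP, hB⟩
  obtain ⟨g, rfl⟩ := D.trans P
  obtain ⟨e, he, heB, ht⟩ := D.exists_model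
  set τ : Equiv.Perm Ω := (toPermHom G Ω g)⁻¹ * σ * toPermHom G Ω g with hτ
  have hτa : ∀ x, τ x = g⁻¹ • σ (g • x) := fun x => by
    rw [hτ, ← map_inv]; rfl
  have hτS : ∀ S : Set Ω, τ '' S = g⁻¹ • σ '' (g • S) := by
    intro S
    rw [← Set.image_smul, ← Set.image_smul, Set.image_image, Set.image_image]
    exact Set.image_congr fun x _ => hτa x
  have himg : ∀ S, e '' (e.permCongr.symm τ '' S) = τ '' (e '' S) := by
    intro S
    rw [Set.image_image, Set.image_image]
    refine Set.image_congr fun x _ => ?_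
    simp [Equiv.permCongr]
  obtain ⟨d, hd⟩ := exists_eq_translation (σ := e.permCongr.symm τ)
    (fun B hB => by
      rw [← Set.ncard_image_of_injective B e.injective]
      exact D.ncard_block ((heB B).2 hB))
    (fun B hB => by
      rw [← heB, himg, hτS]
      exact smul_mem_blocks _ (hσ _ (smul_mem_blocks _ ((heB B).2 hB))))
    (by
      have : e (e.permCongr.symm τ none) = e none := by
        simp only [Equiv.permCongr_symm_apply, Equiv.apply_symm_apply]
        rw [he, hτa, hP, inv_smul_smul]
      exact e.injective this)
    (fun a => by
      apply e.injective.image_injective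
      rw [himg, hτS]
      have h1 : e '' line a ∈ blocks Ω W := (heB _).2 (Or.inl ⟨a, rfl⟩)
      have h2 : i ∈ e '' line a := ⟨none, Or.inl rfl, he⟩
      rw [hB _ (smul_mem_blocks g h1) (Set.smul_mem_smul_set h2), inv_smul_smul])
  obtain ⟨t, hti, ht⟩ := ht d
  have h1 : τ = toPermHom G Ω t := by
    ext x
    obtain ⟨p, rfl⟩ := e.surjective x
    rcases p with - | ⟨a, b⟩
    · rw [he, hτa, hP, inv_smul_smul]
      exact hti.symm
    · have h2 := congrArg e (hd a b)
      simp only [Equiv.permCongr_symm_apply, Equiv.apply_symm_apply] at h2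
      rw [h2]
      exact (ht a b).symm
  refine ⟨g * t * g⁻¹, ?_⟩
  rw [map_mul, map_mul, map_inv, ← h1, hτ]
  group

theorem range_toPermHom (hM : normalClosure ((Q ⊓ centralizer (W : Set G) : Subgroup G) : Set G) = ⊤) :
    (toPermHom G Ω).range = elationGroup (blocks Ω W) := by
  refine le_antisymm ?_ ((closure_le _).2 D.elations_subset)
  rw [MonoidHom.range_eq_map, ← hM, normalClosure, MonoidHom.map_closure, closure_le]
  rintro _ ⟨x, hx, rfl⟩
  obtain ⟨ζ, hζ, h⟩ := Group.mem_conjugatesOfSet_iff.1 hx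
  obtain ⟨g, rfl⟩ := isConj_iff.1 h
  exact subset_closure (D.toPerm_mem_elations hζ)

end PointData

/-- A group with the given data is isomorphic to the elation group of the model geometry. -/
theorem UData.nonempty_mulEquiv {G : Type*} [Group G] [Finite G] (U : UData G) :
    Nonempty (G ≃* elationGroup modelBlocks) := by
  let Q : Sylow 73 G := default
  obtain ⟨W, o, D⟩ := exists_pointData U Q
  have hM := eq_top_of_normal U
    (normalClosure (((Q : Subgroup G) ⊓ centralizer (W : Set G) : Subgroup G) : Set G)) (by
      have h1 := card_dvd_of_le (H := (Q : Subgroup G) ⊓ centralizer (W : Set G)) le_normalClosure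
      rwa [D.card_Z] at h1)
  obtain ⟨e, -, he, -⟩ := D.exists_model
  obtain ⟨f⟩ := nonempty_elationGroup_mulEquiv e he
  have hinj : Function.Injective (toPermHom G (Sylow 73 G)) := by
    rw [injective_iff_map_eq_one]
    exact fun g hg => D.faithful g fun x => congrArg (fun σ : Equiv.Perm _ => σ x) hg
  exact ⟨(MonoidHom.ofInjective hinj).trans
    ((MulEquiv.subgroupCongr (D.range_toPermHom hM)).trans f.symm)⟩

end OD

/-- Any two finite groups of order `2^5 * 3^2 * 7 * 37^2 * 73^3 * 751` whose prime graphs have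
vertex degrees deg 2 = 3, deg 3 = 2, deg 7 = 1, deg 37 = 3, deg 73 = 2, deg 751 = 1 are isomorphic (the
order and degree pattern of the simple unitary group `U_3(73)`). -/
theorem od_characterization_U_3_73
    (G H : Type*) [Group G] [Finite G] [Group H] [Finite H]
    (hG : Nat.card G = 2^5 * 3^2 * 7 * 37^2 * 73^3 * 751)
    (hH : Nat.card H = 2^5 * 3^2 * 7 * 37^2 * 73^3 * 751)
    (hG2 : gkDegree G 2 = 3)
    (hG3 : gkDegree G 3 = 2)
    (hG7 : gkDegree G 7 = 1)
    (hG37 : gkDegree G 37 = 3)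
    (hG73 : gkDegree G 73 = 2)
    (hG751 : gkDegree G 751 = 1)
    (hH2 : gkDegree H 2 = 3)
    (hH3 : gkDegree H 3 = 2)
    (hH7 : gkDegree H 7 = 1)
    (hH37 : gkDegree H 37 = 3)
    (hH73 : gkDegree H 73 = 2)
    (hH751 : gkDegree H 751 = 1) :
    Nonempty (G ≃* H) := by
  obtain ⟨e⟩ := (OD.uData_of_gkDegree hG hG2 hG3 hG7 hG37 hG751).nonempty_mulEquiv
  obtain ⟨f⟩ := (OD.uData_of_gkDegree hH hH2 hH3 hH7 hH37 hH751).nonempty_mulEquiv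
  exact ⟨e.trans f.symm⟩
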